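/- Let n ≥ 2, let Λ ≤ SL(n,ℝ) be a discrete subgroup, and let μ be a probability measure on the left-coset space SL(n,ℝ)⧸Λ invariant under the left-translation action of SL(n,ℝ). Let F' ≤ SL(n,ℝ) be a subgroup generated by unipotent elements that acts ergodically on (SL(n,ℝ)⧸Λ, μ). Suppose φ : SL(n,ℝ)⧸Λ → SL(n,ℝ)⧸Λ is a measurable, measure-preserving map that is injective on a μ-conull set, whose image contains a μ-conull set, and that commutes with F' in the sense that for every f ∈ F' and μ-almost every x, φ(f•x) = f•φ(x). Then there exist a continuous group automorphism A of SL(n,ℝ) with A(Λ) = Λ and an element h ∈ SL(n,ℝ) such that φ(gΛ) = h·A(g)·Λ for μ-almost every coset gΛ; moreover the map gΛ ↦ h·A(g)·Λ commutes with the left-translation action of every element of F'. -/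

import Mathlib

open Matrix MeasureTheory
open scoped Pointwise

abbrev SLR (n : ℕ) : Type := Matrix.SpecialLinearGroup (Fin n) ℝ

instance (n : ℕ) : TopologicalSpace (SLR n) :=
  TopologicalSpace.induced (fun g => (g : Matrix (Fin n) (Fin n) ℝ)) inferInstance

noncomputable instance (n : ℕ) : MeasurableSpace (SLR n) := borel _

/-- `u ∈ SL(n,ℝ)` is unipotent if `(u - I)ⁿ = 0` as a matrix. -/
def IsUnipotent (n : ℕ) (u : SLR n) : Prop :=
  ((u : Matrix (Fin n) (Fin n) ℝ) - 1) ^ n = 0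

section Quotient

set_option linter.unusedSectionVars false

open Set Filter Topology
open scoped symmDiff ENNReal

theorem t2Space_quotient_of_discrete {G : Type*} [Group G] [TopologicalSpace G]
    [IsTopologicalGroup G] [T2Space G] (Γ : Subgroup G) [DiscreteTopology Γ] :
    T2Space (G ⧸ Γ) := by
  rw [t2Space_iff_of_isOpenQuotientMap (π := (QuotientGroup.mk : G → G ⧸ Γ))
    QuotientGroup.isOpenQuotientMap_mk]
  have h1 : IsClosed (Γ : Set G) := Subgroup.isClosed_of_discrete
  have h2 : IsClosed ((fun q : G × G => q.1⁻¹ * q.2) ⁻¹' (Γ : Set G)) := h1.preimage (by fun_prop)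
  convert h2 using 1
  ext q
  simp [QuotientGroup.eq]

attribute [local instance] t2Space_quotient_of_discrete

variable {G : Type*} [Group G] [TopologicalSpace G] [IsTopologicalGroup G]
  [LocallyCompactSpace G] [PolishSpace G] [MeasurableSpace G] [BorelSpace G]
  {Γ : Subgroup G} [DiscreteTopology Γ] {μ : Measure (G ⧸ Γ)} [IsProbabilityMeasure μ]
  [SMulInvariantMeasure G (G ⧸ Γ) μ]

/-- A measurable subset of `G ⧸ Γ` is null iff the set of group elements moving a given base
point into it is Haar-null. -/
theorem measure_eq_zero_iff_ae_orbit {s : Set (G ⧸ Γ)} (hs : MeasurableSet s) (x₀ : G ⧸ Γ) :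
    μ s = 0 ↔ ∀ᵐ g ∂(Measure.haar : Measure G), g • x₀ ∉ s := by
  set ν : Measure G := Measure.haar
  have hN : MeasurableSet {p : G × (G ⧸ Γ) | p.1 • p.2 ∈ s} := measurable_smul hs
  have h1 : (ν.prod μ) {p : G × (G ⧸ Γ) | p.1 • p.2 ∈ s} = 0 ↔ μ s = 0 := by
    rw [Measure.measure_prod_null hN]
    have : ∀ g : G, μ (Prod.mk g ⁻¹' {p : G × (G ⧸ Γ) | p.1 • p.2 ∈ s}) = μ s := fun g =>
      measure_preimage_smul μ g s
    simp only [this]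
    constructor
    · intro h
      exact h.exists.choose_spec
    · intro h
      simp [h]
      rfl
  have h2 : (ν.prod μ) {p : G × (G ⧸ Γ) | p.1 • p.2 ∈ s} = 0 ↔
      ∀ᵐ g ∂ν, g • x₀ ∉ s := by
    rw [← Measure.prod_swap, Measure.map_apply measurable_swap hN,
      Measure.measure_prod_null (measurable_swap hN)]
    have : ∀ x : G ⧸ Γ, ν (Prod.mk x ⁻¹' (Prod.swap ⁻¹' {p : G × (G ⧸ Γ) | p.1 • p.2 ∈ s})) = 0
        ↔ ∀ᵐ g ∂ν, g • x₀ ∉ s := by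
      intro x
      obtain ⟨k, rfl⟩ := MulAction.exists_smul_eq G x₀ x
      have := measure_mul_right_null ν k (s := {g : G | g • x₀ ∈ s})
      rw [ae_iff]
      simp only [not_not]
      rw [← this]
      simp [mul_smul, preimage]
    simp only [Filter.EventuallyEq, Pi.zero_apply, this]
    simp
  rw [← h1, h2]

theorem ae_iff_ae_orbit {p : G ⧸ Γ → Prop} (hp : MeasurableSet {x | p x}) (x₀ : G ⧸ Γ) :
    (∀ᵐ x ∂μ, p x) ↔ ∀ᵐ g ∂(Measure.haar : Measure G), p (g • x₀) := by
  rw [ae_iff, ← compl_ofPred, measure_eq_zero_iff_ae_orbit hp.compl x₀]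
  simp

theorem measure_eq_zero_or_compl_of_invariant {s : Set (G ⧸ Γ)} (hs : MeasurableSet s)
    (h : ∀ g : G, μ (((fun x => g • x) ⁻¹' s) ∆ s) = 0) : μ s = 0 ∨ μ sᶜ = 0 := by
  set ν : Measure G := Measure.haar
  by_contra! hc
  have hN : MeasurableSet {p : G × (G ⧸ Γ) | (p.1 • p.2 ∈ s ↔ p.2 ∈ s)} := by
    have h1 : MeasurableSet {p : G × (G ⧸ Γ) | p.1 • p.2 ∈ s} := measurable_smul hs
    have h2 : MeasurableSet {p : G × (G ⧸ Γ) | p.2 ∈ s} := measurable_snd hs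
    exact h1.iff h2
  have h1 : ∀ g : G, ∀ᵐ x ∂μ, (g • x ∈ s ↔ x ∈ s) := fun g => by
    rw [ae_iff]
    refine measure_mono_null (fun x hx => ?_) (h g)
    simp only [mem_symmDiff, mem_preimage, mem_ofPred_eq] at hx ⊢
    tauto
  have h2 : ∀ᵐ x ∂μ, ∀ᵐ g ∂ν, (g • x ∈ s ↔ x ∈ s) :=
    (Measure.ae_ae_comm hN).1 (Eventually.of_forall h1)
  obtain ⟨x, hxs, hx⟩ : ∃ x, x ∈ s ∧ ∀ᵐ g ∂ν, (g • x ∈ s ↔ x ∈ s) := by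
    by_contra hne
    refine hc.1 (measure_mono_null (fun x hx => ?_) (ae_iff.1 h2))
    exact fun h => hne ⟨x, hx, h⟩
  refine hc.2 ((measure_eq_zero_iff_ae_orbit hs.compl x).2 ?_)
  filter_upwards [hx] with g hg
  simp [hg, hxs]

/-- The displacement of a set under the group action. -/
noncomputable def displacement (μ : Measure (G ⧸ Γ)) (s : Set (G ⧸ Γ)) (g : G) : ℝ≥0∞ :=
  μ (((fun x => g • x) ⁻¹' s) ∆ s)

theorem displacement_one (s : Set (G ⧸ Γ)) : displacement μ s (1 : G) = 0 := by
  simp [displacement]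

theorem displacement_mul_le (s : Set (G ⧸ Γ)) (g h : G) :
    displacement μ s (g * h) ≤ displacement μ s g + displacement μ s h := by
  calc displacement μ s (g * h)
      ≤ μ (((fun x => h • x) ⁻¹' (((fun x => g • x) ⁻¹' s) ∆ s)) ∪
          (((fun x => h • x) ⁻¹' s) ∆ s)) := by
        refine measure_mono fun x hx => ?_
        simp only [mem_symmDiff, mem_preimage, mem_union, mul_smul] at hx ⊢
        tauto
    _ ≤ _ := by
        refine (measure_union_le _ _).trans ?_
        rw [measure_preimage_smul]
        rfl

theorem displacement_inv (s : Set (G ⧸ Γ)) (g : G) :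
    displacement μ s g⁻¹ = displacement μ s g := by
  unfold displacement
  rw [← measure_preimage_smul μ g]
  congr 1
  ext x
  simp only [mem_symmDiff, mem_preimage, inv_smul_smul]
  tauto

theorem tendsto_displacement {s : Set (G ⧸ Γ)} (hs : MeasurableSet s) :
    Tendsto (displacement μ s) (𝓝 (1 : G)) (𝓝 0) := by
  let f : C(G × (G ⧸ Γ), G ⧸ Γ) := ⟨(· • ·).uncurry, continuous_smul⟩
  have := tendsto_measure_symmDiff_preimage_nhds_zero (μ := μ) (ν := μ) (s := s)
    (l := 𝓝 (1 : G)) (f := f.curry) (g := f.curry 1) (f.curry.continuous.tendsto 1)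
    (.of_forall fun g => measurePreserving_smul g μ) (measurePreserving_smul (1 : G) μ)
    hs.nullMeasurableSet (measure_ne_top _ _)
  have h1 : ⇑(f.curry 1) = id := funext fun x => one_smul G x
  rw [h1] at this
  exact this

/-- If every function with the formal properties of a displacement that vanishes at `u` vanishes
identically, then `u` acts ergodically. -/
theorem measure_eq_zero_or_compl_of_smul_invariant {u : G}
    (hu : ∀ d : G → ℝ≥0∞, d 1 = 0 → (∀ g h, d (g * h) ≤ d g + d h) → (∀ g, d g⁻¹ = d g) →
      Tendsto d (𝓝 1) (𝓝 0) → d u = 0 → ∀ g, d g = 0)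
    {s : Set (G ⧸ Γ)} (hs : MeasurableSet s) (hus : ∀ᵐ x ∂μ, (u • x ∈ s ↔ x ∈ s)) :
    μ s = 0 ∨ μ sᶜ = 0 := by
  refine measure_eq_zero_or_compl_of_invariant hs fun g => hu (displacement μ s)
    (displacement_one s) (displacement_mul_le s) (displacement_inv s) (tendsto_displacement hs) ?_ g
  refine measure_mono_null (fun x hx => ?_) (ae_iff.1 hus)
  simp only [mem_symmDiff, mem_preimage, mem_ofPred_eq] at hx ⊢
  tauto

/-- A measurable self-map is continuous on compact sets of almost full measure. -/
theorem exists_isCompact_continuousOn {X : Type*} [TopologicalSpace X] [T2Space X]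
    [SecondCountableTopology X]
    [MeasurableSpace X] [BorelSpace X] (μ : Measure X) [IsFiniteMeasure μ] [μ.InnerRegular]
    [μ.OuterRegular] {s : Set X} (hs : MeasurableSet s)
    {φ : X → X} (hφ : Measurable φ) {ε : ℝ≥0∞} (hε : ε ≠ 0) :
    ∃ K ⊆ s, IsCompact K ∧ ContinuousOn φ K ∧ μ (s \ K) < ε := by
  classical
  obtain ⟨ε', hε', hsum⟩ := ENNReal.exists_pos_sum_of_countable' (ENNReal.half_pos hε).ne'
    (TopologicalSpace.countableBasis X)
  have hU : ∀ b : TopologicalSpace.countableBasis X, ∃ U, φ ⁻¹' (b : Set X) ⊆ U ∧ IsOpen U ∧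
      μ (U \ φ ⁻¹' (b : Set X)) < ε' b := fun b => by
    have hm : MeasurableSet (φ ⁻¹' (b : Set X)) :=
      hφ (TopologicalSpace.isOpen_of_mem_countableBasis b.2).measurableSet
    obtain ⟨U, h1, h2, _, h4⟩ := hm.exists_isOpen_sdiff_lt (measure_ne_top μ _) (hε' b).ne'
    exact ⟨U, h1, h2, h4⟩
  choose U hU1 hU2 hU3 using hU
  set D : Set X := ⋃ b, U b \ φ ⁻¹' (b : Set X)
  have hDm : MeasurableSet D := MeasurableSet.iUnion fun b => (hU2 b).measurableSet.diff
    (hφ (TopologicalSpace.isOpen_of_mem_countableBasis b.2).measurableSet)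
  have hD : μ D < ε / 2 := by
    refine (measure_iUnion_le _).trans_lt (lt_of_le_of_lt ?_ hsum)
    exact ENNReal.tsum_le_tsum fun b => (hU3 b).le
  obtain ⟨K, hK1, hK2, hK3⟩ := (hs.diff hDm).exists_isCompact_sdiff_lt
    (measure_ne_top μ _) (ENNReal.half_pos hε).ne'
  refine ⟨K, fun x hx => (hK1 hx).1, hK2, ?_, ?_⟩
  · rw [continuousOn_iff_continuous_domRestrict]
    refine (TopologicalSpace.isBasis_countableBasis X).continuous_iff.2 fun b hb => ?_
    have : K.domRestrict φ ⁻¹' b = Subtype.val ⁻¹' (U ⟨b, hb⟩) := by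
      ext x
      simp only [mem_preimage, domRestrict_apply]
      constructor
      · intro h
        exact hU1 ⟨b, hb⟩ h
      · intro h
        by_contra hn
        exact (hK1 x.2).2 (mem_iUnion.2 ⟨⟨b, hb⟩, h, hn⟩)
    rw [this]
    exact (hU2 _).preimage continuous_subtype_val
  · calc μ (s \ K) ≤ μ (D ∪ (s \ D) \ K) := by
          refine measure_mono fun x hx => ?_
          by_cases h : x ∈ D
          · exact Or.inl h
          · exact Or.inr ⟨⟨hx.1, h⟩, hx.2⟩
      _ ≤ μ D + μ ((s \ D) \ K) := measure_union_le _ _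
      _ < ε / 2 + ε / 2 := ENNReal.add_lt_add hD hK3
      _ = ε := ENNReal.add_halves ε

end Quotient

section Quotient

set_option linter.unusedSectionVars false

open Set Filter Topology
open scoped symmDiff ENNReal

attribute [local instance] t2Space_quotient_of_discrete

variable {G : Type*} [Group G] [TopologicalSpace G] [IsTopologicalGroup G]
  [LocallyCompactSpace G] [PolishSpace G] [MeasurableSpace G] [BorelSpace G]
  {Γ : Subgroup G} [DiscreteTopology Γ] {μ : Measure (G ⧸ Γ)} [IsProbabilityMeasure μ]
  [SMulInvariantMeasure G (G ⧸ Γ) μ]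

/-- On a compact set of cosets, stabilizers are uniformly discrete. -/
theorem eventually_smul_eq_self_imp {K : Set (G ⧸ Γ)} (hK : IsCompact K) :
    ∀ᶠ k in 𝓝 (1 : G), ∀ p ∈ K, k • p = p → k = 1 := by
  refine hK.eventually_forall_of_forall_eventually fun p _ => ?_
  obtain ⟨g, rfl⟩ := QuotientGroup.mk_surjective p
  obtain ⟨O, hO, hOΓ⟩ : ∃ O ∈ 𝓝 (1 : G), ∀ γ ∈ O, γ ∈ Γ → γ = 1 := by
    have h1 : ({1} : Set Γ) ∈ 𝓝 (1 : Γ) := by simp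
    obtain ⟨O, hO, h2⟩ := mem_nhds_subtype _ _ _ |>.1 h1
    exact ⟨O, hO, fun γ hγ hγΓ => congrArg Subtype.val (@h2 ⟨γ, hγΓ⟩ hγ)⟩
  have hc : Tendsto (fun q : G × G => q.2⁻¹ * q.1 * q.2) (𝓝 (1, g)) (𝓝 1) := by
    have : Continuous (fun q : G × G => q.2⁻¹ * q.1 * q.2) := by fun_prop
    simpa using this.tendsto (1, g)
  have h3 := hc hO
  rw [nhds_prod_eq, mem_map, Filter.mem_prod_iff] at h3
  obtain ⟨A, hA, B, hB, hAB⟩ := h3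
  have h4 : QuotientGroup.mk '' B ∈ 𝓝 (QuotientGroup.mk g : G ⧸ Γ) :=
    QuotientGroup.isOpenMap_coe.image_mem_nhds hB
  rw [nhds_prod_eq]
  filter_upwards [prod_mem_prod hA h4]
  rintro ⟨k, _⟩ ⟨hk, ⟨x, hx, rfl⟩⟩ heq
  have h5 : x⁻¹ * k * x ∈ Γ := by
    have h6 : (QuotientGroup.mk (k * x) : G ⧸ Γ) = QuotientGroup.mk x := heq
    have h7 := QuotientGroup.eq.1 h6.symm
    simpa [mul_assoc] using h7
  have h8 : x⁻¹ * k * x = 1 := hOΓ _ (hAB (mk_mem_prod hk hx)) h5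
  have h9 : k = x * (x⁻¹ * k * x) * x⁻¹ := by group
  rw [h8] at h9
  simpa using h9

theorem image_smul_mem_nhds {B : Set G} (hB : B ∈ 𝓝 (1 : G)) (p : G ⧸ Γ) :
    (fun b : G => b • p) '' B ∈ 𝓝 p := by
  obtain ⟨g, rfl⟩ := QuotientGroup.mk_surjective p
  have h1 : (fun b : G => b * g) '' B ∈ 𝓝 g := by
    simpa using (isOpenMap_mul_right g).image_mem_nhds hB
  have h2 := (QuotientGroup.isOpenMap_coe (N := Γ)).image_mem_nhds h1
  rw [image_image] at h2
  exact h2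

theorem eventually_exists_smul_eq {K : Set (G ⧸ Γ)} (hK : IsCompact K)
    {φ : G ⧸ Γ → G ⧸ Γ} (hφ : ContinuousOn φ K) {B : Set G} (hB : B ∈ 𝓝 (1 : G)) :
    ∀ᶠ v in 𝓝 (1 : G), ∀ x ∈ K, v • x ∈ K → ∃ h ∈ B, φ (v • x) = h • φ x := by
  suffices H : ∀ᶠ v in 𝓝 (1 : G), ∀ x ∈ K, x ∈ K → v • x ∈ K → ∃ h ∈ B, φ (v • x) = h • φ x from
    H.mono fun v hv x hx => hv x hx hx
  refine hK.eventually_forall_of_forall_eventually fun x₀ hx₀ => ?_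
  have hdiv : Tendsto (fun q : G × G => q.1 * q.2⁻¹) (𝓝 1 ×ˢ 𝓝 1) (𝓝 1) := by
    have : Continuous (fun q : G × G => q.1 * q.2⁻¹) := by fun_prop
    simpa [nhds_prod_eq] using this.tendsto (1, 1)
  obtain ⟨B₁, hB₁, B₂, hB₂, hBB⟩ := Filter.mem_prod_iff.1 (hdiv hB)
  have h1 := hφ x₀ hx₀ (image_smul_mem_nhds (inter_mem hB₁ hB₂) (φ x₀))
  rw [mem_map, mem_nhdsWithin_iff_eventually] at h1
  have h2 : Tendsto (fun q : G × (G ⧸ Γ) => q.1 • q.2) (𝓝 (1, x₀)) (𝓝 x₀) := by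
    simpa using (continuous_smul (M := G) (X := G ⧸ Γ)).tendsto (1, x₀)
  have h3 : Tendsto (fun q : G × (G ⧸ Γ) => q.2) (𝓝 (1, x₀)) (𝓝 x₀) :=
    continuous_snd.tendsto (1, x₀)
  filter_upwards [h2.eventually h1, h3.eventually h1]
  intro q hv hx hxK hvK
  obtain ⟨v, x⟩ := q
  obtain ⟨b, hb, hb'⟩ := hv hvK
  obtain ⟨c, hc, hc'⟩ := hx hxK
  refine ⟨b * c⁻¹, hBB (mk_mem_prod hb.1 hc.2), ?_⟩
  simp only at hb' hc'
  rw [← hb', ← hc', smul_smul]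
  simp

/-- The pair `(g, h)` is intertwined by `φ`. -/
def Intertwines (μ : Measure (G ⧸ Γ)) (φ : G ⧸ Γ → G ⧸ Γ) (g h : G) : Prop :=
  ∀ᵐ x ∂μ, φ (g • x) = h • φ x

theorem ae_smul (μ : Measure (G ⧸ Γ)) [SMulInvariantMeasure G (G ⧸ Γ) μ]
    {p : G ⧸ Γ → Prop} (h : ∀ᵐ x ∂μ, p x) (g : G) : ∀ᵐ x ∂μ, p (g • x) :=
  (measurePreserving_smul g μ).quasiMeasurePreserving.ae h

namespace Intertwines

variable {φ : G ⧸ Γ → G ⧸ Γ} {g h g' h' : G}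

theorem one : Intertwines μ φ 1 1 := by simp [Intertwines]

theorem mul (H : Intertwines μ φ g h) (H' : Intertwines μ φ g' h') :
    Intertwines μ φ (g * g') (h * h') := by
  filter_upwards [ae_smul μ H g', H'] with x h1 h2
  rw [mul_smul, h1, h2, mul_smul]

theorem inv (H : Intertwines μ φ g h) : Intertwines μ φ g⁻¹ h⁻¹ := by
  filter_upwards [ae_smul μ H g⁻¹] with x h1
  rw [smul_inv_smul] at h1
  rw [h1, inv_smul_smul]

theorem pow (H : Intertwines μ φ g h) (n : ℕ) : Intertwines μ φ (g ^ n) (h ^ n) := by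
  induction n with
  | zero => simpa using one
  | succ n ih => simpa [pow_succ] using ih.mul H

/-- Conjugating `φ` by translations. -/
theorem conj (H : Intertwines μ φ g h) (a b : G) :
    Intertwines μ (fun x => b • φ (a • x)) (a⁻¹ * g * a) (b * h * b⁻¹) := by
  filter_upwards [ae_smul μ H a] with x h1
  simp only [mul_smul, smul_inv_smul, inv_smul_smul, h1]

theorem unconj {a b : G} (H : Intertwines μ (fun x => b • φ (a • x)) g h) :
    Intertwines μ φ (a * g * a⁻¹) (b⁻¹ * h * b) := by
  have := H.conj a⁻¹ b⁻¹
  simpa using this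

end Intertwines

/-- Discrete rising sun inequality along orbits. -/
theorem mul_sum_indicator_le {X : Type*} (T : X → X) (B : Set X) (a : ℝ≥0∞) (N : ℕ)
    (E : Set X) (hE : ∀ x ∈ E, ∃ M, 1 ≤ M ∧ M ≤ N ∧
      a * M ≤ ∑ m ∈ Finset.range M, B.indicator 1 (T^[m] x)) (L : ℕ) (x : X) :
    a * ∑ m ∈ Finset.range L, E.indicator 1 (T^[m] x) ≤
      ∑ m ∈ Finset.range (L + N), B.indicator 1 (T^[m] x) := by
  induction L using Nat.strong_induction_on generalizing x with
  | _ L ih =>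
    rcases Nat.eq_zero_or_pos L with rfl | hL
    · simp
    have hsplit : ∀ (S : Set X) (M R : ℕ), ∑ m ∈ Finset.range (M + R),
        S.indicator (1 : X → ℝ≥0∞) (T^[m] x) = ∑ m ∈ Finset.range M, S.indicator 1 (T^[m] x) +
          ∑ m ∈ Finset.range R, S.indicator 1 (T^[m] (T^[M] x)) := fun S M R => by
      rw [Finset.sum_range_add]
      congr 1
      refine Finset.sum_congr rfl fun m _ => ?_
      rw [← Function.iterate_add_apply, add_comm]
    have hsum : ∀ M : ℕ, ∑ m ∈ Finset.range M, E.indicator (1 : X → ℝ≥0∞) (T^[m] x) ≤ M :=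
      fun M => by
        refine (Finset.sum_le_card_nsmul _ _ 1 fun m _ => ?_).trans (by simp)
        exact indicator_le_self' (fun _ _ => zero_le) _
    by_cases hx : x ∈ E
    · obtain ⟨M, hM1, hMN, hM⟩ := hE x hx
      rcases le_or_gt L M with hLM | hLM
      · calc a * ∑ m ∈ Finset.range L, E.indicator 1 (T^[m] x)
            ≤ a * L := mul_le_mul_right (hsum L) a
          _ ≤ a * M := by gcongr
          _ ≤ _ := hM
          _ ≤ _ := Finset.sum_le_sum_of_subset (Finset.range_subset_range.2 (by omega))
      · obtain ⟨R, rfl⟩ := Nat.exists_eq_add_of_le hLM.le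
        rw [hsplit, add_assoc, hsplit, mul_add]
        exact add_le_add ((mul_le_mul_right (hsum M) a).trans hM) (ih R (by omega) _)
    · obtain ⟨R, rfl⟩ := Nat.exists_eq_add_of_le hL
      rw [hsplit, add_assoc, hsplit, mul_add]
      refine add_le_add ?_ (ih R (by omega) _)
      simp [hx]

/-- The maximal inequality for the frequency of visits to a set. -/
theorem mul_measure_frequent_visits_le {X : Type*} [MeasurableSpace X] {μ : Measure X}
    [IsProbabilityMeasure μ] {T : X → X} (hT : MeasurePreserving T μ μ) {B : Set X}
    (hB : MeasurableSet B) {a : ℝ≥0∞} (ha : a ≠ ∞) :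
    a * μ {x | ∃ M : ℕ, 1 ≤ M ∧ a * M ≤ ∑ m ∈ Finset.range M, B.indicator 1 (T^[m] x)} ≤ μ B := by
  set E : ℕ → Set X := fun N => {x | ∃ M : ℕ, 1 ≤ M ∧ M ≤ N ∧
    a * M ≤ ∑ m ∈ Finset.range M, B.indicator 1 (T^[m] x)}
  have hmeasB : ∀ m, Measurable fun x => B.indicator (1 : X → ℝ≥0∞) (T^[m] x) := fun m =>
    (measurable_one.indicator hB).comp (hT.measurable.iterate m)
  have hEm : ∀ N, MeasurableSet (E N) := fun N => by
    have : E N = ⋃ M ∈ {M : ℕ | 1 ≤ M ∧ M ≤ N},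
        {x | a * M ≤ ∑ m ∈ Finset.range M, B.indicator 1 (T^[m] x)} := by
      ext x
      simp [E, and_assoc]
    rw [this]
    refine MeasurableSet.biUnion (to_countable _) fun M _ => ?_
    exact measurableSet_le measurable_const (Finset.measurable_sum _ fun m _ => hmeasB m)
  have hint : ∀ (S : Set X), MeasurableSet S → ∀ L : ℕ,
      ∫⁻ x, ∑ m ∈ Finset.range L, S.indicator 1 (T^[m] x) ∂μ = L * μ S := fun S hS L => by
    rw [lintegral_finsetSum]
    · have : ∀ m, ∫⁻ x, S.indicator 1 (T^[m] x) ∂μ = μ S := fun m => by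
        rw [(hT.iterate m).lintegral_comp (measurable_one.indicator hS)]
        simp [lintegral_indicator_one hS]
      simp [this]
    · exact fun m _ => (measurable_one.indicator hS).comp (hT.measurable.iterate m)
  have hEN : ∀ N, a * μ (E N) ≤ μ B := fun N => by
    have h1 : ∀ L : ℕ, a * (L * μ (E N)) ≤ (L + N : ℕ) * μ B := fun L => by
      rw [← hint _ (hEm N), ← hint _ hB, ← lintegral_const_mul']
      · refine lintegral_mono fun x => ?_
        exact mul_sum_indicator_le T B a N (E N) (fun x hx => hx) L x
      · exact ha
    have hfin : a * μ (E N) ≠ ∞ := ENNReal.mul_ne_top ha (measure_ne_top _ _)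
    rw [← ENNReal.toReal_le_toReal hfin (measure_ne_top _ _)]
    set A := (a * μ (E N)).toReal
    set b := (μ B).toReal
    have h2 : ∀ L : ℕ, A * L ≤ (L + N) * b := fun L => by
      have h3 := ENNReal.toReal_mono (ENNReal.mul_ne_top (by simp) (measure_ne_top _ _)) (h1 L)
      rw [mul_left_comm, ENNReal.toReal_mul, ENNReal.toReal_mul (a := ((L + N : ℕ) : ℝ≥0∞))] at h3
      simp only [ENNReal.toReal_natCast] at h3
      push_cast at h3
      linarith [mul_comm A L]
    by_contra! hlt
    obtain ⟨L, hL⟩ := exists_nat_gt (N * b / (A - b))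
    rw [div_lt_iff₀ (by linarith)] at hL
    linarith [h2 L]
  have hmono : Monotone E := fun N N' hNN' x ⟨M, h1, h2, h3⟩ => ⟨M, h1, h2.trans hNN', h3⟩
  have hU : {x | ∃ M : ℕ, 1 ≤ M ∧ a * M ≤ ∑ m ∈ Finset.range M, B.indicator 1 (T^[m] x)} =
      ⋃ N, E N := by
    ext x
    simp only [mem_ofPred_eq, mem_iUnion, E]
    exact ⟨fun ⟨M, h1, h2⟩ => ⟨M, M, h1, le_rfl, h2⟩, fun ⟨_, M, h1, _, h2⟩ => ⟨M, h1, h2⟩⟩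
  rw [hU, hmono.measure_iUnion, ENNReal.mul_iSup]
  exact iSup_le hEN

end Quotient

section Quotient

set_option linter.unusedSectionVars false

open Set Filter Topology
open scoped symmDiff ENNReal

attribute [local instance] t2Space_quotient_of_discrete

variable {G : Type*} [Group G] [TopologicalSpace G] [IsTopologicalGroup G]
  [LocallyCompactSpace G] [PolishSpace G] [MeasurableSpace G] [BorelSpace G]
  {Γ : Subgroup G} [DiscreteTopology Γ] {μ : Measure (G ⧸ Γ)} [IsProbabilityMeasure μ]
  [SMulInvariantMeasure G (G ⧸ Γ) μ]

theorem measure_compl_frequently_le {X : Type*} [MeasurableSpace X] {μ : Measure X}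
    {E : ℕ → Set X} {ε : ℝ≥0∞} (hE : ∀ k, μ (E k)ᶜ ≤ ε) :
    μ {x | ∃ᶠ k in atTop, x ∈ E k}ᶜ ≤ ε := by
  have h1 : {x | ∃ᶠ k in atTop, x ∈ E k}ᶜ = ⋃ N, ⋂ k ∈ Ici N, (E k)ᶜ := by
    ext x
    simp [Filter.not_frequently, eventually_atTop]
  rw [h1, Monotone.measure_iUnion]
  · exact iSup_le fun N => (measure_mono (biInter_subset_of_mem (mem_Ici.2 le_rfl))).trans (hE N)
  · intro N N' hNN'
    exact biInter_subset_biInter_left (Ici_subset_Ici.2 hNN')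

/-- Most points have orbits that mostly stay in a compact set on which `φ` is continuous. -/
theorem exists_good_set (μ : Measure (G ⧸ Γ)) [IsProbabilityMeasure μ]
    [SMulInvariantMeasure G (G ⧸ Γ) μ] {φ : G ⧸ Γ → G ⧸ Γ} (hφ : Measurable φ) (q : ℕ)
    {ε : ℝ≥0∞} (hε : ε ≠ 0) :
    ∃ K : Set (G ⧸ Γ), IsCompact K ∧ ContinuousOn φ K ∧ ∀ u : G, ∃ E, MeasurableSet E ∧ μ Eᶜ ≤ ε ∧
      ∀ x ∈ E, ∀ M : ℕ, 1 ≤ M →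
        q * {m | m < M ∧ ¬ u ^ m • x ∈ K}.ncard < M := by
  classical
  set a : ℝ≥0∞ := ((q + 1 : ℕ) : ℝ≥0∞)⁻¹
  have ha0 : a ≠ 0 := by simp [a]
  have ha : a ≠ ∞ := by simp [a]
  obtain ⟨K, -, hK, hφK, hμK⟩ := exists_isCompact_continuousOn μ MeasurableSet.univ hφ
    (mul_ne_zero ha0 hε)
  refine ⟨K, hK, hφK, fun u => ?_⟩
  have hmp := measurePreserving_smul u μ
  have hmax := mul_measure_frequent_visits_le hmp (B := Kᶜ) hK.measurableSet.compl ha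
  set F : Set (G ⧸ Γ) := {x | ∃ M : ℕ, 1 ≤ M ∧
    a * M ≤ ∑ m ∈ Finset.range M, Kᶜ.indicator 1 ((fun x => u • x)^[m] x)}
  have hF : μ F ≤ ε := by
    have h1 : a * μ F ≤ a * ε := hmax.trans (by rw [compl_eq_univ_sdiff]; exact hμK.le)
    exact (ENNReal.mul_le_mul_iff_right ha0 ha).1 h1
  refine ⟨(toMeasurable μ F)ᶜ, (measurableSet_toMeasurable _ _).compl, by
    rw [compl_compl, measure_toMeasurable]; exact hF, fun x hx M hM => ?_⟩
  have hxF : x ∉ F := fun h => hx (subset_toMeasurable μ F h)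
  have h2 : ∑ m ∈ Finset.range M, Kᶜ.indicator (1 : G ⧸ Γ → ℝ≥0∞) ((fun x => u • x)^[m] x) <
      a * M := by
    by_contra! h
    exact hxF ⟨M, hM, h⟩
  have h3 : ∑ m ∈ Finset.range M, Kᶜ.indicator (1 : G ⧸ Γ → ℝ≥0∞) ((fun x => u • x)^[m] x) =
      ({m | m < M ∧ u ^ m • x ∉ K}.ncard : ℝ≥0∞) := by
    have : {m | m < M ∧ u ^ m • x ∉ K} =
        ↑((Finset.range M).filter fun m => u ^ m • x ∉ K) := by
      ext; simp
    rw [this, Set.ncard_coe_finset, Finset.card_filter]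
    push_cast
    refine Finset.sum_congr rfl fun m _ => ?_
    rw [smul_iterate_apply, indicator_apply]
    simp
  rw [h3] at h2
  have h4 : ((q + 1 : ℕ) : ℝ≥0∞) * ({m | m < M ∧ u ^ m • x ∉ K}.ncard : ℝ≥0∞) < M := by
    calc _ < ((q + 1 : ℕ) : ℝ≥0∞) * (a * M) := by
          refine ENNReal.mul_lt_mul_right (by simp) (by simp) h2
      _ = M := by
          rw [← mul_assoc, ENNReal.mul_inv_cancel (by simp) (by simp), one_mul]
  have h5 : (q + 1) * {m | m < M ∧ u ^ m • x ∉ K}.ncard < M := by exact_mod_cast h4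
  nlinarith

/-- Limits of approximate intertwining relations. -/
theorem measure_compl_intertwined_le {φ : G ⧸ Γ → G ⧸ Γ} (hφ : Measurable φ)
    {g : ℕ → G} {g₀ : G} (hg : Tendsto g atTop (𝓝 g₀)) {E : ℕ → Set (G ⧸ Γ)} {ε ε' : ℝ≥0∞}
    (hE : ∀ k, μ (E k)ᶜ ≤ ε) (hε : ε < ε') (P : ℕ → G → Prop)
    (hP : ∀ k, ∀ x ∈ E k, ∃ h, P k h ∧ φ (g k • x) = h • φ x) {C : Set G} (hC : IsCompact C)
    (hPC : ∀ k h, P k h → h ∈ C) (Q : Set G)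
    (hQ : ∀ (k : ℕ → ℕ) (h : ℕ → G) (h₀ : G), StrictMono k → (∀ j, P (k j) (h j)) →
      Tendsto h atTop (𝓝 h₀) → h₀ ∈ Q) :
    μ {x | ∃ h ∈ Q, φ (g₀ • x) = h • φ x}ᶜ ≤ ε' := by
  set η := (ε' - ε) / 2
  have hη : η ≠ 0 := (ENNReal.half_pos (tsub_pos_iff_lt.2 hε).ne').ne'
  obtain ⟨K, -, hK, hφK, hμK⟩ := exists_isCompact_continuousOn μ MeasurableSet.univ hφ hη
  rw [← compl_eq_univ_sdiff] at hμK
  set E' : ℕ → Set (G ⧸ Γ) := fun k => {x | x ∈ E k ∧ g k • x ∈ K ∧ g₀ • x ∈ K}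
  have hE' : ∀ k, μ (E' k)ᶜ ≤ ε' := fun k => by
    calc μ (E' k)ᶜ ≤ μ ((E k)ᶜ ∪ (((fun x => g k • x) ⁻¹' Kᶜ) ∪ ((fun x => g₀ • x) ⁻¹' Kᶜ))) := by
          refine measure_mono fun x hx => ?_
          simp only [E', mem_compl_iff, mem_ofPred_eq, mem_union, mem_preimage] at hx ⊢
          tauto
      _ ≤ ε + (η + η) := by
          refine (measure_union_le _ _).trans (add_le_add (hE k)
            ((measure_union_le _ _).trans (add_le_add ?_ ?_))) <;>
          · rw [measure_preimage_smul]
            exact hμK.le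
      _ = ε' := by
          rw [ENNReal.add_halves, add_tsub_cancel_of_le hε.le]
  refine (measure_mono (compl_subset_compl.2 fun x hx => ?_)).trans
    (measure_compl_frequently_le hE')
  obtain ⟨k, hk, hxk⟩ := extraction_of_frequently_atTop hx
  choose h hPh hh using fun j => hP (k j) x (hxk j).1
  obtain ⟨h₀, -, i, hi, hlim⟩ := hC.tendsto_subseq fun j => hPC _ _ (hPh j)
  refine ⟨h₀, hQ (k ∘ i) (h ∘ i) h₀ (hk.comp hi) (fun j => hPh (i j)) hlim, ?_⟩
  have h1 : Tendsto (fun j => φ (g (k (i j)) • x)) atTop (𝓝 (φ (g₀ • x))) := by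
    have h2 := hφK _ (hxk 0).2.2
    refine h2.tendsto.comp (tendsto_nhdsWithin_iff.2 ⟨?_, ?_⟩)
    · exact (hg.comp (hk.comp hi).tendsto_atTop).smul_const x
    · exact Eventually.of_forall fun j => (hxk (i j)).2.1
  have h3 : Tendsto (fun j => φ (g (k (i j)) • x)) atTop (𝓝 (h₀ • φ x)) := by
    simp_rw [hh]
    exact hlim.smul_const _
  exact tendsto_nhds_unique h1 h3

theorem measure_eq_zero_of_forall_le {X : Type*} [MeasurableSpace X] {μ : Measure X}
    [IsFiniteMeasure μ] {s : Set X} (h : ∀ ε : ℝ≥0∞, ε ≠ 0 → μ s ≤ ε) : μ s = 0 := by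
  by_contra hne
  exact (ENNReal.half_lt_self hne (measure_ne_top _ _)).not_ge (h _ (ENNReal.half_pos hne).ne')

theorem Intertwines.of_tendsto {φ : G ⧸ Γ → G ⧸ Γ} (hφ : Measurable φ)
    {g h : ℕ → G} {g₀ h₀ : G} (hg : Tendsto g atTop (𝓝 g₀)) (hh : Tendsto h atTop (𝓝 h₀))
    (H : ∀ k, Intertwines μ φ (g k) (h k)) : Intertwines μ φ g₀ h₀ := by
  rw [Intertwines, ae_iff]
  refine measure_eq_zero_of_forall_le fun ε hε => ?_
  have := measure_compl_intertwined_le (μ := μ) hφ hg (E := fun k => {x | φ (g k • x) = h k • φ x})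
    (ε := 0) (ε' := ε) (fun k => (ae_iff.1 (H k)).le) (pos_iff_ne_zero.2 hε)
    (fun k h' => h' = h k) (fun k x hx => ⟨h k, rfl, hx⟩) hh.isCompact_insert_range
    (fun k h' hk => by simp [hk]) {h₀} (fun k h' h₁ hk hkh hlim => ?_)
  · refine (measure_mono fun x hx => ?_).trans this
    simpa using hx
  · have : h' = h ∘ k := funext hkh
    rw [this] at hlim
    exact tendsto_nhds_unique hlim (hh.comp hk.tendsto_atTop)

/-- Two maps with the same equivariance under an ergodic element which are related by a compact
set of centralizing elements on a non-null set differ by a single centralizing element. -/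
theorem exists_ae_eq_smul {u w : G}
    (hu : ∀ s : Set (G ⧸ Γ), MeasurableSet s → (∀ᵐ x ∂μ, (u • x ∈ s ↔ x ∈ s)) →
      μ s = 0 ∨ μ sᶜ = 0)
    {φ ψ : G ⧸ Γ → G ⧸ Γ} (hφ : Measurable φ) (hψ : Measurable ψ)
    (hφu : Intertwines μ φ u w) (hψu : Intertwines μ ψ u w)
    {C : Set G} (hC : IsCompact C) (hCw : ∀ c ∈ C, c * w = w * c)
    (hne : μ {x | ∃ c ∈ C, ψ x = c • φ x} ≠ 0) :
    ∃ c ∈ C, ∀ᵐ x ∂μ, ψ x = c • φ x := by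
  have key : ∀ D ⊆ C, IsCompact D → μ {x | ∃ c ∈ D, ψ x = c • φ x} ≠ 0 →
      ∀ᵐ x ∂μ, ∃ c ∈ D, ψ x = c • φ x := by
    intro D hDC hD hne
    have hclosed : IsClosed {p : (G ⧸ Γ) × (G ⧸ Γ) | ∃ c ∈ D, p.2 = c • p.1} := by
      have : CompactSpace D := isCompact_iff_compactSpace.1 hD
      have h1 : IsClosed {q : D × ((G ⧸ Γ) × (G ⧸ Γ)) | q.2.2 = (q.1 : G) • q.2.1} :=
        isClosed_eq (by fun_prop) (by fun_prop)
      convert isClosedMap_snd_of_compactSpace _ h1 using 1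
      ext p
      simp
    have hm : MeasurableSet {x | ∃ c ∈ D, ψ x = c • φ x} :=
      (hφ.prodMk hψ) hclosed.measurableSet
    refine ae_iff.2 ((hu _ hm ?_).resolve_left hne)
    filter_upwards [hφu, hψu] with x h1 h2
    simp only [h1, h2]
    refine exists_congr fun c => and_congr_right fun hc => ?_
    rw [smul_smul, hCw c (hDC hc), ← smul_smul]
    exact (MulAction.injective w).eq_iff
  obtain ⟨c, hc, hcN⟩ : ∃ c ∈ C, ∀ t ∈ 𝓝[C] c, μ {x | ∃ c ∈ t, ψ x = c • φ x} ≠ 0 := by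
    by_contra! hcon
    refine hne (hC.induction_on (p := fun t => μ {x | ∃ c ∈ t, ψ x = c • φ x} = 0) ?_ ?_ ?_ hcon)
    · simp
    · intro s t hst ht
      refine measure_mono_null ?_ ht
      rintro x ⟨c, hc, h⟩
      exact ⟨c, hst hc, h⟩
    · intro s t hs ht
      refine measure_mono_null (fun x ⟨c, hc, h⟩ => ?_) (measure_union_null hs ht)
      rcases hc with hc | hc
      · exact Or.inl ⟨c, hc, h⟩
      · exact Or.inr ⟨c, hc, h⟩
  refine ⟨c, hc, ?_⟩
  obtain ⟨N, hN, hNc⟩ := (closed_nhds_basis c).exists_antitone_subbasis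
  have h1 : ∀ᵐ x ∂μ, ∀ i, ∃ d ∈ C ∩ N i, ψ x = d • φ x := ae_all_iff.2 fun i =>
    key _ inter_subset_left (hC.inter_right (hN i).2)
      (hcN _ (inter_mem_nhdsWithin C (hN i).1))
  filter_upwards [h1] with x hx
  choose d hd hdx using hx
  have hlim : Tendsto d atTop (𝓝 c) := by
    rw [hNc.toHasBasis.tendsto_right_iff]
    intro i _
    filter_upwards [eventually_ge_atTop i] with j hj
    exact hNc.antitone hj (hd j).2
  refine tendsto_nhds_unique (f := fun _ : ℕ => ψ x) (l := atTop) tendsto_const_nhds ?_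
  have h2 : (fun _ : ℕ => ψ x) = fun i => d i • φ x := funext hdx
  rw [h2]
  exact hlim.smul_const _

/-- An element intertwined with `1` commutes with a neighbourhood of `1`. -/
theorem Intertwines.eventually_commute {φ : G ⧸ Γ → G ⧸ Γ} (hφ : Measurable φ)
    (hmp : Measure.map φ μ = μ) {h : G} (H : Intertwines μ φ 1 h) :
    ∀ᶠ g in 𝓝 (1 : G), g * h = h * g := by
  have hcl : IsClosed {x : G ⧸ Γ | x = h • x} := isClosed_eq continuous_id (by fun_prop)
  have h1 : ∀ᵐ x ∂μ, x = h • x := by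
    rw [← hmp, ae_map_iff hφ.aemeasurable hcl.measurableSet]
    simpa [Intertwines] using H
  rw [ae_iff_ae_orbit hcl.measurableSet (QuotientGroup.mk 1)] at h1
  have hΓ : IsClosed (Γ : Set G) := Subgroup.isClosed_of_discrete
  have hcl2 : IsClosed {g : G | g⁻¹ * h * g ∈ Γ} := by
    have : Continuous fun g : G => g⁻¹ * h * g := by fun_prop
    exact hΓ.preimage this
  have h2 : ∀ g : G, g⁻¹ * h * g ∈ Γ := by
    have h3 : Dense {g : G | g⁻¹ * h * g ∈ Γ} := by
      refine (Measure.dense_of_ae (μ := Measure.haar) ?_)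
      filter_upwards [h1] with g hg
      have hg' : (QuotientGroup.mk (g * 1) : G ⧸ Γ) = QuotientGroup.mk (h * (g * 1)) := hg
      simpa [mul_assoc] using QuotientGroup.eq.1 hg'
    intro g
    have := h3.closure_eq
    rw [hcl2.closure_eq] at this
    exact (Set.eq_univ_iff_forall.1 this) g
  have h4 : Tendsto (fun g : G => (⟨g⁻¹ * h * g, h2 g⟩ : Γ)) (𝓝 1)
      (𝓝 ⟨h, by simpa using h2 1⟩) := by
    have : Continuous fun g : G => (⟨g⁻¹ * h * g, h2 g⟩ : Γ) := by fun_prop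
    simpa using this.tendsto 1
  rw [nhds_discrete Γ, tendsto_pure] at h4
  filter_upwards [h4] with g hg
  have := congrArg Subtype.val hg
  simp only at this
  calc g * h = g * (g⁻¹ * h * g) := by rw [this]
    _ = h * g := by group

/-- An essentially injective measure preserving map has a measurable essential inverse. -/
theorem exists_measurable_inverse {φ : G ⧸ Γ → G ⧸ Γ} (hφ : Measurable φ)
    (hmp : Measure.map φ μ = μ) (hinj : ∃ s : Set (G ⧸ Γ), μ sᶜ = 0 ∧ Set.InjOn φ s) :
    ∃ φ' : G ⧸ Γ → G ⧸ Γ, Measurable φ' ∧ Measure.map φ' μ = μ ∧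
      (∀ᵐ x ∂μ, φ' (φ x) = x) ∧ (∀ᵐ x ∂μ, φ (φ' x) = x) := by
  classical
  obtain ⟨s, hs0, hs⟩ := hinj
  set s' := (toMeasurable μ sᶜ)ᶜ
  have hs' : s' ⊆ s := by
    rw [← compl_compl s]
    exact compl_subset_compl.2 (subset_toMeasurable _ _)
  have hs'm : MeasurableSet s' := (measurableSet_toMeasurable _ _).compl
  have hs'0 : μ s'ᶜ = 0 := by rw [compl_compl, measure_toMeasurable, hs0]
  have hK : ∀ k : ℕ, ∃ K ⊆ s', IsCompact K ∧ ContinuousOn φ K ∧ μ (s' \ K) <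
      ((k + 1 : ℕ) : ℝ≥0∞)⁻¹ :=
    fun k => exists_isCompact_continuousOn μ hs'm hφ (by simp)
  choose K hKs hK hφK hμK using hK
  set U := ⋃ k, K k
  have hUs : U ⊆ s := iUnion_subset fun k => (hKs k).trans hs'
  have hU : μ Uᶜ = 0 := by
    have h1 : μ (s' \ U) = 0 := by
      by_contra hne
      obtain ⟨k, hk⟩ := ENNReal.exists_inv_nat_lt hne
      refine (hk.trans_le ((measure_mono (sdiff_subset_sdiff_right (subset_iUnion K k))).trans
        (hμK k).le)).not_ge ?_
      exact ENNReal.inv_le_inv.2 (Nat.cast_le.2 k.le_succ)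
    refine measure_mono_null (fun x hx => ?_) (measure_union_null hs'0 h1)
    by_cases h : x ∈ s'
    · exact Or.inr ⟨h, hx⟩
    · exact Or.inl h
  have hUae : ∀ᵐ x ∂μ, x ∈ U := hU
  have hinjU : InjOn φ U := hs.mono hUs
  have himg : ∀ D, IsClosed D → MeasurableSet (φ '' (U ∩ D)) := fun D hD => by
    rw [iUnion_inter, image_iUnion]
    exact MeasurableSet.iUnion fun k => (((hK k).inter_right hD).image_of_continuousOn
      ((hφK k).mono inter_subset_left)).measurableSet
  have hUm : MeasurableSet (φ '' U) := by simpa using himg univ isClosed_univ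
  set φ' : G ⧸ Γ → G ⧸ Γ := fun y => if h : y ∈ φ '' U then h.choose else QuotientGroup.mk 1
  have hφ'1 : ∀ x ∈ U, φ' (φ x) = x := fun x hx => by
    have h : φ x ∈ φ '' U := mem_image_of_mem φ hx
    simp only [φ', dif_pos h]
    exact hinjU h.choose_spec.1 hx h.choose_spec.2
  have hφ'm : Measurable φ' := by
    refine measurable_of_isClosed fun D hD => ?_
    have : φ' ⁻¹' D = φ '' (U ∩ D) ∪ ((φ '' U)ᶜ ∩ {_y | QuotientGroup.mk 1 ∈ D}) := by
      ext y
      by_cases hy : y ∈ φ '' U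
      · obtain ⟨x, hx, rfl⟩ := hy
        simp only [mem_preimage, hφ'1 x hx, mem_union, mem_image, mem_inter_iff, mem_compl_iff]
        constructor
        · exact fun h => Or.inl ⟨x, ⟨hx, h⟩, rfl⟩
        · rintro (⟨x', ⟨hx', hD'⟩, h⟩ | ⟨h, -⟩)
          · rwa [← hinjU hx' hx h]
          · exact absurd ⟨x, hx, rfl⟩ h
      · have h1 : y ∉ φ '' (U ∩ D) := fun h => hy (image_mono inter_subset_left h)
        have h2 : φ' y = QuotientGroup.mk 1 := dif_neg hy
        simp only [mem_preimage, h2, mem_union, h1, mem_inter_iff, mem_compl_iff, hy,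
          mem_ofPred_eq, not_false_eq_true, true_and, false_or]
    rw [this]
    exact (himg D hD).union (hUm.compl.inter (MeasurableSet.const _))
  have h1 : ∀ᵐ x ∂μ, φ' (φ x) = x := hUae.mono hφ'1
  refine ⟨φ', hφ'm, ?_, h1, ?_⟩
  · conv_lhs => rw [← hmp]
    rw [Measure.map_map hφ'm hφ]
    conv_rhs => rw [← Measure.map_id (μ := μ)]
    exact Measure.map_congr h1
  · have h2 : ∀ᵐ y ∂μ, y ∈ φ '' U := by
      have h3 : ∀ᵐ y ∂(Measure.map φ μ), y ∈ φ '' U :=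
        (ae_map_iff hφ.aemeasurable (p := fun y => y ∈ φ '' U) hUm).2
          (hUae.mono fun x hx => mem_image_of_mem φ hx)
      rwa [hmp] at h3
    filter_upwards [h2]
    rintro _ ⟨x, hx, rfl⟩
    rw [hφ'1 x hx]

theorem Intertwines.inverse {φ φ' : G ⧸ Γ → G ⧸ Γ} (hφ' : Measurable φ')
    (hmp' : Measure.map φ' μ = μ) (h1 : ∀ᵐ x ∂μ, φ' (φ x) = x) (h2 : ∀ᵐ x ∂μ, φ (φ' x) = x)
    {g h : G} (H : Intertwines μ φ g h) : Intertwines μ φ' h g := by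
  have hq : Measure.QuasiMeasurePreserving φ' μ μ :=
    ⟨hφ', by rw [hmp']⟩
  have h3 := hq.ae H
  have h4 := hq.ae (ae_smul μ h1 g)
  filter_upwards [h3, h4, h2] with x h3 h4 h2
  rw [h3, h2] at h4
  exact h4

end Quotient

section SpecialLinear

open Set Filter Topology
open scoped Matrix.Norms.Operator

instance instIsTopologicalGroupSLR (n : ℕ) : IsTopologicalGroup (SLR n) :=
  Matrix.SpecialLinearGroup.topologicalGroup

theorem isClosedEmbedding_coe_SLR (n : ℕ) :
    IsClosedEmbedding fun g : SLR n => (g : Matrix (Fin n) (Fin n) ℝ) :=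
  Matrix.SpecialLinearGroup.isClosedEmbedding_val

instance instPolishSpaceSLR (n : ℕ) : PolishSpace (SLR n) :=
  have : PolishSpace (Matrix (Fin n) (Fin n) ℝ) := inferInstanceAs (PolishSpace (Fin n → Fin n → ℝ))
  (isClosedEmbedding_coe_SLR n).polishSpace

instance instLocallyCompactSpaceSLR (n : ℕ) : LocallyCompactSpace (SLR n) :=
  have : LocallyCompactSpace (Matrix (Fin n) (Fin n) ℝ) :=
    inferInstanceAs (LocallyCompactSpace (Fin n → Fin n → ℝ))
  (isClosedEmbedding_coe_SLR n).locallyCompactSpace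

instance instBorelSpaceSLR (n : ℕ) : BorelSpace (SLR n) := ⟨rfl⟩

variable {n : ℕ}

local notation "Mat" => Matrix (Fin n) (Fin n) ℝ

theorem continuous_coe_SLR : Continuous fun g : SLR n => (g : Mat) := continuous_induced_dom

theorem tendsto_SLR_iff {α : Type*} {l : Filter α} {f : α → SLR n} {g : SLR n} :
    Tendsto f l (𝓝 g) ↔ Tendsto (fun a => (f a : Mat)) l (𝓝 (g : Mat)) :=
  (isClosedEmbedding_coe_SLR n).isEmbedding.isInducing.tendsto_nhds_iff

theorem eventually_norm_sub_one_lt {δ : ℝ} (hδ : 0 < δ) :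
    ∀ᶠ g : SLR n in 𝓝 1, ‖(g : Mat) - 1‖ < δ := by
  have : Tendsto (fun g : SLR n => ‖(g : Mat) - 1‖) (𝓝 1) (𝓝 0) := by
    have h : Continuous fun g : SLR n => ‖(g : Mat) - 1‖ :=
      (continuous_coe_SLR.sub continuous_const).norm
    simpa using h.tendsto 1
  exact this.eventually_lt_const hδ

theorem exists_norm_sub_one_lt_subset {V : Set (SLR n)} (hV : V ∈ 𝓝 1) :
    ∃ δ > 0, ∀ g : SLR n, ‖(g : Mat) - 1‖ < δ → g ∈ V := by
  rw [(isClosedEmbedding_coe_SLR n).isEmbedding.isInducing.nhds_eq_comap, mem_comap] at hV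
  obtain ⟨t, ht, htV⟩ := hV
  obtain ⟨δ, hδ, hδt⟩ := Metric.mem_nhds_iff.1 ht
  exact ⟨δ, hδ, fun g hg => htV (hδt (by simpa [dist_eq_norm] using hg))⟩

theorem isCompact_norm_sub_one_le (δ : ℝ) : IsCompact {g : SLR n | ‖(g : Mat) - 1‖ ≤ δ} := by
  have := (isClosedEmbedding_coe_SLR n).isCompact_preimage (isCompact_closedBall (1 : Mat) δ)
  convert this using 1
  ext g
  simp [dist_eq_norm]

/-! ### Unipotent matrices -/

theorem Matrix.pow_eq_zero_of_isNilpotent {N : Mat} (hN : IsNilpotent N) : N ^ n = 0 := by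
  have h1 : N.charpoly = Polynomial.X ^ n := by
    have := (Matrix.isNilpotent_charpoly_sub_pow_of_isNilpotent hN).eq_zero
    simpa [sub_eq_zero] using this
  simpa [h1] using N.aeval_self_charpoly

theorem Matrix.det_one_add_of_isNilpotent {N : Mat} (hN : IsNilpotent N) : (1 + N).det = 1 := by
  have h1 : (-N).charpoly = Polynomial.X ^ n := by
    have := (Matrix.isNilpotent_charpoly_sub_pow_of_isNilpotent hN.neg).eq_zero
    simpa [sub_eq_zero] using this
  have h2 := Matrix.eval_charpoly (-N) 1
  simpa [h1] using h2.symm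

theorem Matrix.isNilpotent_of_det_one_add {N : Mat} (h : ∀ z : ℝ, (1 + z • N).det = 1) :
    IsNilpotent N := by
  have h1 : N.charpoly = Polynomial.X ^ n := by
    refine Polynomial.eq_of_infinite_eval_eq _ _ (Set.infinite_of_injective_forall_mem
      (f := fun k : ℕ => (k + 1 : ℝ)) (fun a b h => by simpa using h) fun k => ?_)
    have hk : (k + 1 : ℝ) ≠ 0 := by positivity
    have h2 : Matrix.scalar (Fin n) (k + 1 : ℝ) - N =
        (k + 1 : ℝ) • (1 + (-(k + 1 : ℝ)⁻¹) • N) := by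
      rw [smul_add, smul_smul, mul_neg, mul_inv_cancel₀ hk]
      ext i j
      simp [Matrix.one_apply, Matrix.diagonal_apply, sub_eq_add_neg]
    simp only [mem_ofPred_eq, Matrix.eval_charpoly, h2, Matrix.det_smul, h, Fintype.card_fin,
      Polynomial.eval_pow, Polynomial.eval_X, mul_one]
  refine ⟨n, ?_⟩
  simpa [h1] using N.aeval_self_charpoly

/-- The special linear matrix `1 + N`, for `N` nilpotent. -/
def oneAdd (N : Mat) (hN : IsNilpotent N) : SLR n := ⟨1 + N, Matrix.det_one_add_of_isNilpotent hN⟩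

theorem coe_oneAdd (N : Mat) (hN : IsNilpotent N) : (oneAdd N hN : Mat) = 1 + N := rfl

theorem isUnipotent_iff {u : SLR n} : IsUnipotent n u ↔ IsNilpotent ((u : Mat) - 1) :=
  ⟨fun h => ⟨n, h⟩, Matrix.pow_eq_zero_of_isNilpotent⟩

theorem isUnipotent_oneAdd (N : Mat) (hN : IsNilpotent N) : IsUnipotent n (oneAdd N hN) := by
  rw [isUnipotent_iff]
  simpa [coe_oneAdd] using hN

theorem isUnipotent_iff_det {u : SLR n} :
    IsUnipotent n u ↔ ∀ z : ℝ, (1 + z • ((u : Mat) - 1)).det = 1 :=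
  isUnipotent_iff.trans ⟨fun h z => Matrix.det_one_add_of_isNilpotent (h.smul z),
    Matrix.isNilpotent_of_det_one_add⟩

theorem IsUnipotent.conj {u : SLR n} (hu : IsUnipotent n u) (g : SLR n) :
    IsUnipotent n (g * u * g⁻¹) := by
  rw [isUnipotent_iff_det] at hu ⊢
  intro z
  have h1 : (1 : Mat) + z • (((g * u * g⁻¹ : SLR n) : Mat) - 1) =
      (g : Mat) * (1 + z • ((u : Mat) - 1)) * ((g⁻¹ : SLR n) : Mat) := by
    have h2 : (g : Mat) * ((g⁻¹ : SLR n) : Mat) = 1 := by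
      rw [← Matrix.SpecialLinearGroup.coe_mul, mul_inv_cancel, Matrix.SpecialLinearGroup.coe_one]
    simp only [Matrix.SpecialLinearGroup.coe_mul, mul_add, add_mul, mul_one, h2, smul_sub,
      mul_sub, sub_mul, Matrix.mul_smul, Matrix.smul_mul]
  rw [h1, Matrix.det_mul, Matrix.det_mul, hu, Matrix.SpecialLinearGroup.det_coe,
    Matrix.SpecialLinearGroup.det_coe]
  norm_num

theorem IsUnipotent.one : IsUnipotent n 1 := by
  rw [isUnipotent_iff]
  simp

theorem IsUnipotent.trace {u : SLR n} (hu : IsUnipotent n u) : (u : Mat).trace = n := by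
  have := (Matrix.isNilpotent_trace_of_isNilpotent (isUnipotent_iff.1 hu)).eq_zero
  simpa [sub_eq_zero] using this

theorem Commute.coe_SLR {u v : SLR n} (h : Commute u v) : Commute (u : Mat) (v : Mat) := by
  have := congrArg (fun g : SLR n => (g : Mat)) h.eq
  simp only [Matrix.SpecialLinearGroup.coe_mul] at this
  exact this

theorem Commute.of_coe_SLR {u v : SLR n} (h : Commute (u : Mat) (v : Mat)) : Commute u v :=
  Subtype.ext (by simpa only [Matrix.SpecialLinearGroup.coe_mul] using h.eq)

theorem IsUnipotent.mul {u v : SLR n} (hu : IsUnipotent n u) (hv : IsUnipotent n v)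
    (h : Commute u v) : IsUnipotent n (u * v) := by
  rw [isUnipotent_iff] at *
  have h' := h.coe_SLR
  have h1 : ((u * v : SLR n) : Mat) - 1 = ((u : Mat) - 1) * v + (v - 1) := by
    rw [Matrix.SpecialLinearGroup.coe_mul]
    noncomm_ring
  have h2 : Commute ((u : Mat) - 1) v := h'.sub_left (Commute.one_left _)
  rw [h1]
  refine Commute.isNilpotent_add ?_ (h2.isNilpotent_mul_right hu) hv
  exact ((h2.mul_left (Commute.refl _)).sub_right (Commute.one_right _))

theorem IsUnipotent.inv {u : SLR n} (hu : IsUnipotent n u) : IsUnipotent n u⁻¹ := by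
  rw [isUnipotent_iff] at *
  have h2 : ((u⁻¹ : SLR n) : Mat) * (u : Mat) = 1 := by
    rw [← Matrix.SpecialLinearGroup.coe_mul, inv_mul_cancel, Matrix.SpecialLinearGroup.coe_one]
  have h1 : ((u⁻¹ : SLR n) : Mat) - 1 = -(((u⁻¹ : SLR n) : Mat) * (u - 1)) := by
    rw [mul_sub, h2]
    simp
  have h3 : Commute ((u⁻¹ : SLR n) : Mat) (u : Mat) := (Commute.inv_left (Commute.refl u)).coe_SLR
  rw [h1]
  exact ((h3.sub_right (Commute.one_right _)).isNilpotent_mul_left hu).neg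

theorem IsUnipotent.pow {u : SLR n} (hu : IsUnipotent n u) (k : ℕ) : IsUnipotent n (u ^ k) := by
  induction k with
  | zero => simpa using IsUnipotent.one
  | succ k ih =>
    rw [pow_succ]
    exact ih.mul hu (Commute.pow_left (Commute.refl u) k)

theorem isClosed_isUnipotent : IsClosed {u : SLR n | IsUnipotent n u} := by
  unfold IsUnipotent
  exact isClosed_eq ((continuous_coe_SLR.sub continuous_const).pow n) continuous_const

end SpecialLinear

section UnipotentPowers

open Set Filter Topology
open scoped Matrix.Norms.Operator Nat

variable {n : ℕ}

local notation "Mat" => Matrix (Fin n) (Fin n) ℝ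

/-- The real power `(1 + N) ^ t` of a unipotent matrix. -/
noncomputable def unipotentPow (N : Mat) (t : ℝ) : Mat :=
  ∑ i ∈ Finset.range n, ((descPochhammer ℝ i).eval t / i !) • N ^ i

theorem one_add_pow_eq_sum {N : Mat} {p : ℕ} (hN : N ^ p = 0) (m : ℕ) :
    (1 + N) ^ m = ∑ i ∈ Finset.range p, (m.choose i : ℝ) • N ^ i := by
  have h0 : ∀ i, p ≤ i → N ^ i = 0 := fun i hi => pow_eq_zero_of_le hi hN
  have h1 : ∑ i ∈ Finset.range p, (m.choose i : ℝ) • N ^ i =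
      ∑ i ∈ Finset.range (p + (m + 1)), (m.choose i : ℝ) • N ^ i := by
    refine Finset.sum_subset (Finset.range_mono (Nat.le_add_right _ _)) fun i _ hi => ?_
    rw [h0 i (by simpa using hi), smul_zero]
  have h2 : ∑ i ∈ Finset.range (m + 1), (m.choose i : ℝ) • N ^ i =
      ∑ i ∈ Finset.range (p + (m + 1)), (m.choose i : ℝ) • N ^ i := by
    refine Finset.sum_subset (Finset.range_mono (Nat.le_add_left _ _)) fun i _ hi => ?_
    rw [Nat.choose_eq_zero_of_lt (by simpa using hi), Nat.cast_zero, zero_smul]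
  rw [h1, ← h2, add_comm, (Commute.one_right N).add_pow]
  refine Finset.sum_congr rfl fun i _ => ?_
  simp [Algebra.smul_def, (Nat.cast_commute (m.choose i) (N ^ i)).eq]

theorem unipotentPow_natCast {N : Mat} (hN : N ^ n = 0) (m : ℕ) :
    unipotentPow N m = (1 + N) ^ m := by
  rw [one_add_pow_eq_sum hN, unipotentPow]
  refine Finset.sum_congr rfl fun i _ => ?_
  rw [descPochhammer_eval_eq_descFactorial, Nat.descFactorial_eq_factorial_mul_choose,
    Nat.cast_mul, mul_div_cancel_left₀ _ (by positivity)]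

/-- Polynomial functions of a real variable which agree on natural numbers agree. -/
theorem unipotentPow_mul_eq {N M : Mat} {c : ℝ}
    (h : ∀ m : ℕ, unipotentPow M (c * m) = unipotentPow N m) (t : ℝ) :
    unipotentPow M (c * t) = unipotentPow N t := by
  have key : ∀ (P : Mat) (c : ℝ) (i j : Fin n), ∃ p : Polynomial ℝ, ∀ x,
      unipotentPow P (c * x) i j = p.eval x := by
    intro P c i j
    refine ⟨∑ k ∈ Finset.range n, Polynomial.C ((P ^ k) i j / k !) *
      (descPochhammer ℝ k).comp (Polynomial.C c * Polynomial.X), fun x => ?_⟩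
    simp only [unipotentPow, Matrix.sum_apply, Matrix.smul_apply, Polynomial.eval_finsetSum,
      Polynomial.eval_mul, Polynomial.eval_C, Polynomial.eval_comp, Polynomial.eval_X, smul_eq_mul]
    exact Finset.sum_congr rfl fun k _ => by ring
  ext i j
  obtain ⟨p, hp⟩ := key M c i j
  obtain ⟨q, hq⟩ := key N 1 i j
  have hpq : p = q := by
    refine Polynomial.eq_of_infinite_eval_eq _ _ (Set.infinite_of_injective_forall_mem
      (f := fun k : ℕ => (k : ℝ)) Nat.cast_injective fun m => ?_)
    have := congrFun (congrFun (h m) i) j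
    rw [hp] at this
    rw [mem_ofPred_eq, this, ← hq, one_mul]
  rw [hp, hpq, ← hq, one_mul]

theorem eq_unipotentPow_inv_of_pow_eq {N M : Mat} (hN : N ^ n = 0) (hM : M ^ n = 0) {k : ℕ}
    (hk : k ≠ 0) (h : (1 + M) ^ k = 1 + N) : 1 + M = unipotentPow N (k : ℝ)⁻¹ := by
  have h1 := unipotentPow_mul_eq (N := N) (M := M) (c := k) (fun m => by
    rw [← Nat.cast_mul, unipotentPow_natCast hM, unipotentPow_natCast hN, pow_mul, h]) (k : ℝ)⁻¹
  rw [mul_inv_cancel₀ (by exact_mod_cast hk)] at h1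
  rw [← h1]
  simpa using (unipotentPow_natCast hM 1).symm

theorem unipotentPow_zero {N : Mat} (hN : N ^ n = 0) : unipotentPow N 0 = 1 := by
  simpa using unipotentPow_natCast hN 0

theorem exists_tendsto_smul_unipotentPow {N : Mat} (hN : N ^ n = 0) : ∃ D : Mat,
    Tendsto (fun t : ℝ => t⁻¹ • (unipotentPow N t - 1)) (𝓝[≠] 0) (𝓝 D) := by
  have h1 : Differentiable ℝ (unipotentPow N) := by
    unfold unipotentPow
    refine Differentiable.fun_sum fun i _ => ?_
    exact (((descPochhammer ℝ i).differentiable).div_const _).smul_const _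
  refine ⟨deriv (unipotentPow N) 0, ?_⟩
  have h2 := hasDerivAt_iff_tendsto_slope.1 (h1 0).hasDerivAt
  refine h2.congr fun t => ?_
  rw [slope_def_module, unipotentPow_zero hN, sub_zero]

theorem tendsto_natCast_inv_pow_mul_choose {i p : ℕ} (hip : i ≤ p) :
    Tendsto (fun k : ℕ => ((k : ℝ) ^ p)⁻¹ * (k.choose i : ℝ)) atTop
      (𝓝 (if i = p then (p ! : ℝ)⁻¹ else 0)) := by
  have h1 : Tendsto (fun k : ℕ => (k.choose i : ℝ) / ((k : ℝ) ^ i / i !)) atTop (𝓝 1) := by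
    refine (Asymptotics.isEquivalent_iff_tendsto_one ?_).1 (isEquivalent_choose i)
    filter_upwards [eventually_gt_atTop 0] with k hk
    positivity
  have h2 : Tendsto (fun k : ℕ => ((k : ℝ) ^ (p - i))⁻¹ * (i ! : ℝ)⁻¹) atTop
      (𝓝 (if i = p then (p ! : ℝ)⁻¹ else 0)) := by
    split_ifs with h
    · subst h
      simp
    · have h3 : Tendsto (fun k : ℕ => (k : ℝ) ^ (p - i)) atTop atTop :=
        (tendsto_pow_atTop (by omega)).comp tendsto_natCast_atTop_atTop
      simpa using h3.inv_tendsto_atTop.mul_const (i ! : ℝ)⁻¹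
  have h3 := h1.mul h2
  rw [one_mul] at h3
  refine h3.congr' ?_
  filter_upwards [eventually_gt_atTop 0] with k hk
  obtain ⟨j, rfl⟩ := Nat.exists_eq_add_of_le hip
  have : (k : ℝ) ≠ 0 := by positivity
  have h4 : (i ! : ℝ) ≠ 0 := by positivity
  rw [Nat.add_sub_cancel_left, pow_add]
  field_simp

theorem tendsto_smul_one_add_pow {N : Mat} {p : ℕ} (hN : N ^ (p + 1) = 0) :
    Tendsto (fun k : ℕ => ((k : ℝ) ^ p)⁻¹ • (1 + N) ^ k) atTop (𝓝 ((p ! : ℝ)⁻¹ • N ^ p)) := by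
  have h1 : ∀ k : ℕ, ((k : ℝ) ^ p)⁻¹ • (1 + N) ^ k =
      ∑ i ∈ Finset.range (p + 1), (((k : ℝ) ^ p)⁻¹ * (k.choose i : ℝ)) • N ^ i := by
    intro k
    rw [one_add_pow_eq_sum hN, Finset.smul_sum]
    simp_rw [smul_smul]
  simp_rw [h1]
  have h2 : (p ! : ℝ)⁻¹ • N ^ p = ∑ i ∈ Finset.range (p + 1),
      (if i = p then (p ! : ℝ)⁻¹ else 0) • N ^ i := by
    simp [ite_smul]
  rw [h2]
  exact tendsto_finsetSum _ fun i hi => (tendsto_natCast_inv_pow_mul_choose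
    (by simpa [Nat.lt_succ_iff] using hi)).smul_const _

theorem exists_norm_one_add_pow_le {N : Mat} {p : ℕ} (hN : N ^ (p + 1) = 0) :
    ∃ C : ℝ, 0 < C ∧ ∀ m k : ℕ, m ≤ k → 1 ≤ k → ‖(1 + N) ^ m‖ ≤ C * (k : ℝ) ^ p := by
  refine ⟨∑ i ∈ Finset.range (p + 1), ‖N ^ i‖ + 1, by positivity, fun m k hmk hk => ?_⟩
  have hk' : (1 : ℝ) ≤ k := by exact_mod_cast hk
  rw [one_add_pow_eq_sum hN]
  calc _ ≤ ∑ i ∈ Finset.range (p + 1), ‖N ^ i‖ * (k : ℝ) ^ p := by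
        refine norm_sum_le_of_le _ fun i hi => ?_
        rw [norm_smul, mul_comm, Real.norm_of_nonneg (by positivity)]
        refine mul_le_mul_of_nonneg_left ?_ (norm_nonneg _)
        calc (m.choose i : ℝ) ≤ (m ^ i : ℕ) := by exact_mod_cast Nat.choose_le_pow m i
          _ ≤ (k : ℝ) ^ i := by
            push_cast
            exact pow_le_pow_left₀ (by positivity) (by exact_mod_cast hmk) _
          _ ≤ (k : ℝ) ^ p := pow_le_pow_right₀ hk' (by simpa [Nat.lt_succ_iff] using hi)
    _ ≤ _ := by
        rw [← Finset.sum_mul]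
        exact mul_le_mul_of_nonneg_right (by linarith) (by positivity)

end UnipotentPowers

section Shears

open Set Filter Topology
open scoped Matrix.Norms.Operator Nat

variable {n : ℕ}

local notation "Mat" => Matrix (Fin n) (Fin n) ℝ

theorem isNilpotent_vecMulVec {a b : Fin n → ℝ} (h : b ⬝ᵥ a = 0) :
    IsNilpotent (vecMulVec a b) :=
  ⟨2, by rw [pow_two, vecMulVec_mul_vecMulVec, h, zero_smul, vecMulVec_zero]⟩

/-- The shear `1 + a bᵀ`, for `b` orthogonal to `a`. -/
noncomputable def shear (a b : Fin n → ℝ) : SLR n :=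
  if h : b ⬝ᵥ a = 0 then oneAdd (vecMulVec a b) (isNilpotent_vecMulVec h) else 1

theorem coe_shear {a b : Fin n → ℝ} (h : b ⬝ᵥ a = 0) :
    (shear a b : Mat) = 1 + vecMulVec a b := by
  rw [shear, dif_pos h, coe_oneAdd]

theorem isUnipotent_shear (a b : Fin n → ℝ) : IsUnipotent n (shear a b) := by
  unfold shear
  split_ifs
  · exact isUnipotent_oneAdd _ _
  · exact IsUnipotent.one

theorem eq_shear {a b : Fin n → ℝ} (h : b ⬝ᵥ a = 0) {g : SLR n}
    (hg : (g : Mat) = 1 + vecMulVec a b) : g = shear a b :=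
  Subtype.ext (hg.trans (coe_shear h).symm)

theorem shear_ne_one {a b : Fin n → ℝ} (h : b ⬝ᵥ a = 0) (ha : a ≠ 0) (hb : b ≠ 0) :
    shear a b ≠ 1 := by
  intro h1
  have h2 := coe_shear h
  rw [h1, Matrix.SpecialLinearGroup.coe_one, left_eq_add] at h2
  exact vecMulVec_ne_zero ha hb h2

theorem coe_pow_of_sq_eq_zero {g : SLR n} {B : Mat} (hB : B * B = 0) (hg : (g : Mat) = 1 + B)
    (m : ℕ) : ((g ^ m : SLR n) : Mat) = 1 + (m : ℝ) • B := by
  induction m with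
  | zero => simp
  | succ m ih =>
    rw [pow_succ, Matrix.SpecialLinearGroup.coe_mul, ih, hg, mul_add, add_mul, add_mul _ _ B,
      smul_mul_assoc _ B B, hB]
    push_cast
    simp [add_smul, add_assoc]

theorem coe_inv_of_sq_eq_zero {g : SLR n} {B : Mat} (hB : B * B = 0) (hg : (g : Mat) = 1 + B) :
    ((g⁻¹ : SLR n) : Mat) = 1 - B := by
  have h1 : ((g⁻¹ : SLR n) : Mat) * (g : Mat) = 1 := by
    rw [← Matrix.SpecialLinearGroup.coe_mul, inv_mul_cancel, Matrix.SpecialLinearGroup.coe_one]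
  have h2 : (g : Mat) * (1 - B) = 1 := by
    rw [hg, mul_sub, add_mul _ _ B, hB]; simp
  calc ((g⁻¹ : SLR n) : Mat) = ((g⁻¹ : SLR n) : Mat) * ((g : Mat) * (1 - B)) := by rw [h2, mul_one]
    _ = 1 - B := by rw [← mul_assoc, h1, one_mul]

/-- The limits of conjugates of small elements by long powers of unipotents of `H` lie in `H`. -/
def ShearClosed (H : Set (SLR n)) : Prop :=
  (∀ g ∈ H, ∀ k : ℕ, g ^ k ∈ H) ∧ ∀ u ∈ H, IsUnipotent n u → u ≠ 1 → ∃ V ∈ 𝓝 (1 : SLR n),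
    ∀ (g : ℕ → SLR n) (g₀ : SLR n), Tendsto g atTop (𝓝 1) →
      (∀ k, ∀ m ≤ k, u ^ m * g k * (u ^ m)⁻¹ ∈ V) →
      Tendsto (fun k => u ^ k * g k * (u ^ k)⁻¹) atTop (𝓝 g₀) → g₀ * u = u * g₀ → g₀ ∈ H

theorem ShearClosed.mem_of_tendsto {H : Set (SLR n)} (hH : ShearClosed H) {u : SLR n} (hu : u ∈ H)
    (huu : IsUnipotent n u) (hu1 : u ≠ 1) {A B : Mat} (hA : A * A = 0) (hB : B * B = 0)
    {ε : ℕ → ℝ} (hε : Tendsto ε atTop (𝓝 0)) {C : ℝ}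
    (hC : ∀ k m, m ≤ k → ‖ε k • (((u ^ m : SLR n) : Mat) * A * (((u ^ m)⁻¹ : SLR n) : Mat))‖ ≤ C)
    (hlim : Tendsto (fun k => ε k • (((u ^ k : SLR n) : Mat) * A * (((u ^ k)⁻¹ : SLR n) : Mat)))
      atTop (𝓝 B)) (hBu : Commute B (u : Mat)) {g : SLR n} (hg : (g : Mat) = 1 + B) : g ∈ H := by
  obtain ⟨V, hV, hVH⟩ := hH.2 u hu huu hu1
  obtain ⟨δ, hδ, hδV⟩ := exists_norm_sub_one_lt_subset hV
  obtain ⟨N, hN⟩ := exists_nat_gt (C / δ)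
  have hC0 : 0 ≤ C := (norm_nonneg _).trans (hC 0 0 le_rfl)
  have hNpos : (0 : ℝ) < N := lt_of_le_of_lt (by positivity) hN
  have hAs : ∀ s : ℝ, IsNilpotent (s • A) := fun s => ⟨2, by rw [smul_pow, pow_two A, hA,
      smul_zero]⟩
  have hBs : ∀ s : ℝ, (s • B) * (s • B) = 0 := fun s => by
    rw [smul_mul_smul_comm, hB, smul_zero]
  have hBn : ∀ s : ℝ, IsNilpotent (s • B) := fun s => ⟨2, by rw [pow_two, hBs]⟩
  let a : ℕ → SLR n := fun k => oneAdd (((N : ℝ)⁻¹ * ε k) • A) (hAs _)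
  have hconj : ∀ k m, ((u ^ m * a k * (u ^ m)⁻¹ : SLR n) : Mat) =
      1 + (N : ℝ)⁻¹ • (ε k • (((u ^ m : SLR n) : Mat) * A * (((u ^ m)⁻¹ : SLR n) : Mat))) := by
    intro k m
    have h1 : ((u ^ m : SLR n) : Mat) * (((u ^ m)⁻¹ : SLR n) : Mat) = 1 := by
      rw [← Matrix.SpecialLinearGroup.coe_mul, mul_inv_cancel, Matrix.SpecialLinearGroup.coe_one]
    rw [Matrix.SpecialLinearGroup.coe_mul, Matrix.SpecialLinearGroup.coe_mul, coe_oneAdd, mul_add,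
        mul_one,
      add_mul, h1, mul_smul_comm, smul_mul_assoc, smul_smul]
  have hmem : oneAdd ((N : ℝ)⁻¹ • B) (hBn _) ∈ H := by
    refine hVH a _ ?_ ?_ ?_ ?_
    · rw [tendsto_SLR_iff]
      have : Tendsto (fun k => (1 : Mat) + ((N : ℝ)⁻¹ * ε k) • A) atTop
          (𝓝 (1 + ((N : ℝ)⁻¹ * 0) • A)) :=
        ((hε.const_mul _).smul_const A).const_add 1
      simpa [a, coe_oneAdd] using this
    · intro k m hm
      refine hδV _ ?_
      rw [hconj, add_sub_cancel_left, norm_smul, norm_inv, Real.norm_natCast, inv_mul_lt_iff₀ hNpos]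
      exact (hC k m hm).trans_lt ((div_lt_iff₀ hδ).1 hN)
    · rw [tendsto_SLR_iff]
      simp only [hconj, coe_oneAdd]
      exact (hlim.const_smul _).const_add 1
    · refine (Commute.of_coe_SLR ?_).eq
      rw [coe_oneAdd]
      exact (Commute.one_left _).add_left (hBu.smul_left _)
  have hpow : oneAdd ((N : ℝ)⁻¹ • B) (hBn _) ^ N = g := by
    refine Subtype.ext ?_
    rw [coe_pow_of_sq_eq_zero (hBs _) (coe_oneAdd _ _), hg, smul_smul, mul_inv_cancel₀ hNpos.ne',
      one_smul]
  exact hpow ▸ hH.1 _ hmem N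

theorem vecMulVec_sq {a b : Fin n → ℝ} (h : b ⬝ᵥ a = 0) :
    vecMulVec a b * vecMulVec a b = 0 := by
  rw [vecMulVec_mul_vecMulVec, h, zero_smul, vecMulVec_zero]

theorem coe_shear_pow {a b : Fin n → ℝ} (h : b ⬝ᵥ a = 0) (m : ℕ) :
    ((shear a b ^ m : SLR n) : Mat) = 1 + (m : ℝ) • vecMulVec a b :=
  coe_pow_of_sq_eq_zero (vecMulVec_sq h) (coe_shear h) m

theorem coe_shear_pow_inv {a b : Fin n → ℝ} (h : b ⬝ᵥ a = 0) (m : ℕ) :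
    (((shear a b ^ m)⁻¹ : SLR n) : Mat) = 1 - (m : ℝ) • vecMulVec a b := by
  refine coe_inv_of_sq_eq_zero ?_ (coe_shear_pow h m)
  rw [smul_mul_smul_comm, vecMulVec_sq h, smul_zero]

theorem tendsto_neg_inv_smul_sub (P Q : Mat) :
    Tendsto (fun k : ℕ => (-(k : ℝ)⁻¹) • (P - (k : ℝ) • Q)) atTop (𝓝 Q) := by
  have h1 : Tendsto (fun k : ℕ => (-(k : ℝ)⁻¹) • P + Q) atTop (𝓝 ((-(0 : ℝ)) • P + Q)) :=
    ((tendsto_inv_atTop_nhds_zero_nat.neg).smul_const P).add_const Q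
  rw [neg_zero, zero_smul, zero_add] at h1
  refine h1.congr' ?_
  filter_upwards [eventually_ne_atTop 0] with k hk
  have : (k : ℝ) ≠ 0 := by exact_mod_cast hk
  rw [smul_sub, smul_smul, neg_mul, inv_mul_cancel₀ this]
  simp

theorem norm_neg_inv_smul_sub_le (P Q : Mat) {k m : ℕ} (hm : m ≤ k) :
    ‖(-(k : ℝ)⁻¹) • (P - (m : ℝ) • Q)‖ ≤ ‖P‖ + ‖Q‖ := by
  rcases Nat.eq_zero_or_pos k with rfl | hk
  · simp only [CharP.cast_eq_zero, _root_.inv_zero, neg_zero, zero_smul, norm_zero]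
    positivity
  have hk' : (1 : ℝ) ≤ k := by exact_mod_cast hk
  have hm' : (m : ℝ) ≤ k := by exact_mod_cast hm
  rw [norm_smul, norm_neg, norm_inv, Real.norm_natCast, inv_mul_le_iff₀ (by linarith)]
  calc ‖P - (m : ℝ) • Q‖ ≤ ‖P‖ + ‖(m : ℝ) • Q‖ := norm_sub_le _ _
    _ = ‖P‖ + m * ‖Q‖ := by rw [norm_smul, Real.norm_natCast]
    _ ≤ k * (‖P‖ + ‖Q‖) := by nlinarith [norm_nonneg P, norm_nonneg Q]

theorem ShearClosed.shear_mem_of_dual {H : Set (SLR n)} (hH : ShearClosed H) {a b c e : Fin n → ℝ}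
    (ha : a ≠ 0) (hb : b ≠ 0) (hba : b ⬝ᵥ a = 0) (hbc : b ⬝ᵥ c = 0) (hec : e ⬝ᵥ c = 0)
    (hea : e ⬝ᵥ a = 1) (h : shear a b ∈ H) : shear c b ∈ H := by
  have hconj : ∀ m : ℕ, ((shear a b ^ m : SLR n) : Mat) * vecMulVec c e *
      (((shear a b ^ m)⁻¹ : SLR n) : Mat) = vecMulVec c e - (m : ℝ) • vecMulVec c b := by
    intro m
    rw [coe_shear_pow hba, coe_shear_pow_inv hba, add_mul, one_mul, smul_mul_assoc,
      vecMulVec_mul_vecMulVec, hbc, zero_smul, vecMulVec_zero, smul_zero, add_zero, mul_sub,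
      mul_one, mul_smul_comm, vecMulVec_mul_vecMulVec, hea, one_smul]
  refine hH.mem_of_tendsto (A := vecMulVec c e) (B := vecMulVec c b) h (isUnipotent_shear a b)
    (shear_ne_one hba ha hb) (vecMulVec_sq hec) (vecMulVec_sq hbc)
    (ε := fun k => -(k : ℝ)⁻¹) (by simpa using (tendsto_inv_atTop_nhds_zero_nat (𝕜 := ℝ)).neg)
    (C := ‖vecMulVec c e‖ + ‖vecMulVec c b‖) (fun k m hm => ?_) ?_ ?_ (coe_shear hbc)
  · rw [hconj]
    exact norm_neg_inv_smul_sub_le _ _ hm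
  · simp only [hconj]
    exact tendsto_neg_inv_smul_sub _ _
  · rw [coe_shear hba]
    refine (Commute.one_right _).add_right ?_
    rw [commute_iff_eq, vecMulVec_mul_vecMulVec, vecMulVec_mul_vecMulVec, hba, hbc]
    simp

theorem exists_ne_zero_dotProduct_eq_zero_and (hn : 3 ≤ n) (a b : Fin n → ℝ) :
    ∃ z : Fin n → ℝ, z ≠ 0 ∧ a ⬝ᵥ z = 0 ∧ b ⬝ᵥ z = 0 := by
  have : ∃ z : Fin n → ℝ, (Matrix.of ![a, b]) *ᵥ z = 0 ∧ z ≠ 0 := by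
    have h1 : LinearMap.ker (Matrix.mulVecLin (Matrix.of ![a, b])) ≠ ⊥ :=
      LinearMap.ker_ne_bot_of_finrank_lt (by simp; omega)
    obtain ⟨z, hz, hz0⟩ := Submodule.exists_mem_ne_zero_of_ne_bot h1
    exact ⟨z, by simpa using hz, hz0⟩
  obtain ⟨z, hz, hz0⟩ := this
  refine ⟨z, hz0, ?_, ?_⟩
  · simpa [Matrix.mulVec] using congrFun hz 0
  · simpa [Matrix.mulVec] using congrFun hz 1

theorem ShearClosed.shear_mem_left (hn : 3 ≤ n) {H : Set (SLR n)} (hH : ShearClosed H)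
    {a b c : Fin n → ℝ} (ha : a ≠ 0) (hb : b ≠ 0) (hba : b ⬝ᵥ a = 0)
    (hbc : b ⬝ᵥ c = 0) (h : shear a b ∈ H) : shear c b ∈ H := by
  have hpos : ∀ v : Fin n → ℝ, v ≠ 0 → v ⬝ᵥ v ≠ 0 := fun v hv h0 =>
    hv (dotProduct_self_eq_zero.1 h0)
  by_cases hD : (c ⬝ᵥ c) * (a ⬝ᵥ a) - (a ⬝ᵥ c) * (a ⬝ᵥ c) = 0
  · obtain ⟨z, hz, hbz, haz⟩ := exists_ne_zero_dotProduct_eq_zero_and hn b a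
    have hca : c = ((a ⬝ᵥ c) / (a ⬝ᵥ a)) • a := by
      have hw : (c - ((a ⬝ᵥ c) / (a ⬝ᵥ a)) • a) ⬝ᵥ (c - ((a ⬝ᵥ c) / (a ⬝ᵥ a)) • a) = 0 := by
        simp only [sub_dotProduct, dotProduct_sub, smul_dotProduct, dotProduct_smul, smul_eq_mul,
          dotProduct_comm c a]
        have := hpos a ha
        field_simp
        linarith
      exact sub_eq_zero.1 (dotProduct_self_eq_zero.1 hw)
    have hzc : z ⬝ᵥ c = 0 := by
      rw [hca, dotProduct_smul, dotProduct_comm z a, haz, smul_zero]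
    have h1 : shear z b ∈ H := by
      refine hH.shear_mem_of_dual ha hb hba hbz (e := (a ⬝ᵥ a)⁻¹ • a) ?_ ?_ h
      · rw [smul_dotProduct, haz, smul_zero]
      · rw [smul_dotProduct, smul_eq_mul, inv_mul_cancel₀ (hpos a ha)]
    refine hH.shear_mem_of_dual hz hb hbz hbc (e := (z ⬝ᵥ z)⁻¹ • z) ?_ ?_ h1
    · rw [smul_dotProduct, hzc, smul_zero]
    · rw [smul_dotProduct, smul_eq_mul, inv_mul_cancel₀ (hpos z hz)]
  · refine hH.shear_mem_of_dual ha hb hba hbc (e := ((c ⬝ᵥ c) * (a ⬝ᵥ a) -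
      (a ⬝ᵥ c) * (a ⬝ᵥ c))⁻¹ • ((c ⬝ᵥ c) • a - (a ⬝ᵥ c) • c)) ?_ ?_ h
    · simp only [smul_dotProduct, sub_dotProduct, smul_eq_mul]
      ring
    · simp only [smul_dotProduct, sub_dotProduct, smul_eq_mul, dotProduct_comm c a]
      exact inv_mul_cancel₀ hD


theorem transpose_mul_SLR (g h : SLR n) : (g * h).transpose = h.transpose * g.transpose :=
  Subtype.ext (by simp [Matrix.SpecialLinearGroup.coe_transpose, Matrix.transpose_mul])

theorem inv_transpose_inv_SLR (g : SLR n) : g⁻¹.transpose⁻¹ = g.transpose := by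
  refine inv_eq_of_mul_eq_one_left ?_
  rw [← transpose_mul_SLR, inv_mul_cancel]
  exact Subtype.ext (by simp [Matrix.SpecialLinearGroup.coe_transpose])

/-- The automorphism `g ↦ (gᵀ)⁻¹`. -/
noncomputable def invTranspose (n : ℕ) : SLR n ≃* SLR n where
  toFun g := g⁻¹.transpose
  invFun g := g⁻¹.transpose
  left_inv g := by
    change g⁻¹.transpose⁻¹.transpose = g
    rw [inv_transpose_inv_SLR]
    exact Subtype.ext (by simp [Matrix.SpecialLinearGroup.coe_transpose])
  right_inv g := by
    change g⁻¹.transpose⁻¹.transpose = g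
    rw [inv_transpose_inv_SLR]
    exact Subtype.ext (by simp [Matrix.SpecialLinearGroup.coe_transpose])
  map_mul' g h := by rw [_root_.mul_inv_rev, transpose_mul_SLR]

theorem coe_invTranspose (g : SLR n) : (invTranspose n g : Mat) = ((g⁻¹ : SLR n) : Mat)ᵀ := rfl

theorem invTranspose_invTranspose (g : SLR n) : invTranspose n (invTranspose n g) = g :=
  (invTranspose n).left_inv g

theorem continuous_invTranspose : Continuous (invTranspose n) :=
  continuous_induced_rng.2 (continuous_coe_SLR.comp continuous_inv).matrix_transpose

theorem invTranspose_shear {a b : Fin n → ℝ} (h : b ⬝ᵥ a = 0) :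
    invTranspose n (shear a b) = shear b (-a) := by
  refine eq_shear (by rw [neg_dotProduct, dotProduct_comm, h, neg_zero]) ?_
  rw [coe_invTranspose, coe_inv_of_sq_eq_zero (vecMulVec_sq h) (coe_shear h), transpose_sub,
    transpose_one, transpose_vecMulVec, vecMulVec_neg, sub_eq_add_neg]

theorem IsUnipotent.invTranspose {u : SLR n} (hu : IsUnipotent n u) :
    IsUnipotent n (invTranspose n u) := by
  have h := hu.inv
  unfold IsUnipotent at *
  rw [coe_invTranspose, ← transpose_one, ← transpose_sub, ← transpose_pow, h, transpose_zero]

theorem ShearClosed.preimage_invTranspose {H : Set (SLR n)} (hH : ShearClosed H) :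
    ShearClosed (invTranspose n ⁻¹' H) := by
  refine ⟨fun g hg k => ?_, fun u hu huu hu1 => ?_⟩
  · rw [mem_preimage, map_pow]
    exact hH.1 _ hg k
  · obtain ⟨V, hV, h⟩ := hH.2 _ hu huu.invTranspose (by simpa using hu1)
    have hc := continuous_invTranspose (n := n)
    refine ⟨invTranspose n ⁻¹' V, hc.continuousAt.preimage_mem_nhds (by simpa using hV),
      fun g g₀ hg hgV hlim hcomm => h (fun k => invTranspose n (g k)) _ ?_ ?_ ?_ ?_⟩
    · simpa [Function.comp_def] using (hc.tendsto 1).comp hg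
    · intro k m hm
      simpa using hgV k m hm
    · simpa [Function.comp_def] using (hc.tendsto g₀).comp hlim
    · rw [← map_mul, hcomm, map_mul]

theorem ShearClosed.shear_mem_right (hn : 3 ≤ n) {H : Set (SLR n)} (hH : ShearClosed H)
    {a b c : Fin n → ℝ} (ha : a ≠ 0) (hb : b ≠ 0) (hba : b ⬝ᵥ a = 0)
    (hca : c ⬝ᵥ a = 0) (h : shear a b ∈ H) : shear a c ∈ H := by
  have hab : (-a) ⬝ᵥ b = 0 := by rw [neg_dotProduct, dotProduct_comm, hba, neg_zero]
  have hac : (-a) ⬝ᵥ c = 0 := by rw [neg_dotProduct, dotProduct_comm, hca, neg_zero]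
  have h1 := hH.preimage_invTranspose.shear_mem_left hn (a := b) (b := -a) (c := c) hb
    (neg_ne_zero.2 ha) hab hac
    (by rwa [mem_preimage, ← invTranspose_shear hba, invTranspose_invTranspose])
  rwa [mem_preimage, ← invTranspose_shear hca, invTranspose_invTranspose] at h1

theorem ShearClosed.shear_mem_of_shear_mem (hn : 3 ≤ n) {H : Set (SLR n)} (hH : ShearClosed H)
    {a b : Fin n → ℝ} (ha : a ≠ 0) (hb : b ≠ 0) (hba : b ⬝ᵥ a = 0) (h : shear a b ∈ H)
    {x y : Fin n → ℝ} (hx : x ≠ 0) (hyx : y ⬝ᵥ x = 0) : shear x y ∈ H := by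
  obtain ⟨z, hz, haz, hxz⟩ := exists_ne_zero_dotProduct_eq_zero_and hn a x
  rw [dotProduct_comm] at haz hxz
  exact hH.shear_mem_right hn hx hz hxz hyx <| hH.shear_mem_left hn ha hz haz hxz <|
    hH.shear_mem_right hn ha hb hba haz h

theorem exists_pow_ne_zero_pow_succ_eq_zero {N : Mat} (hN : IsNilpotent N) (hN0 : N ≠ 0) :
    ∃ p, 1 ≤ p ∧ N ^ p ≠ 0 ∧ N ^ (p + 1) = 0 := by
  classical
  have hN' : ∃ k, N ^ k = 0 := hN
  have h2 : 2 ≤ Nat.find hN' := by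
    rw [Nat.le_find_iff]
    intro m hm h0
    interval_cases m
    · rw [pow_zero] at h0
      exact hN0 (by rw [← one_mul N, h0, zero_mul])
    · exact hN0 (by simpa using h0)
  refine ⟨Nat.find hN' - 1, by omega, Nat.find_min hN' (by omega), ?_⟩
  rw [Nat.sub_add_cancel (by omega)]
  exact Nat.find_spec hN'

/-- The asymptotics of conjugation by large powers of a unipotent matrix. -/
theorem conj_pow_asymptotics {u : SLR n} {N : Mat} (hu : (u : Mat) = 1 + N) {p : ℕ}
    (hN : N ^ (p + 1) = 0) :
    (∃ C : ℝ, 0 < C ∧ ∀ k m : ℕ, m ≤ k → 1 ≤ k → ‖((u ^ m : SLR n) : Mat)‖ ≤ C * k ^ p ∧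
      ‖(((u ^ m)⁻¹ : SLR n) : Mat)‖ ≤ C * k ^ p) ∧
    Tendsto (fun k : ℕ => ((k : ℝ) ^ p)⁻¹ • ((u ^ k : SLR n) : Mat)) atTop
      (𝓝 ((p ! : ℝ)⁻¹ • N ^ p)) ∧
    Tendsto (fun k : ℕ => ((k : ℝ) ^ p)⁻¹ • (((u ^ k)⁻¹ : SLR n) : Mat)) atTop
      (𝓝 (((-1) ^ p * (p ! : ℝ)⁻¹) • N ^ p)) := by
  set w : Mat := ((u⁻¹ : SLR n) : Mat) with hw
  have hwu : w * (1 + N) = 1 := by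
    rw [hw, ← hu, ← Matrix.SpecialLinearGroup.coe_mul, inv_mul_cancel,
      Matrix.SpecialLinearGroup.coe_one]
  have huw : (1 + N) * w = 1 := by
    rw [hw, ← hu, ← Matrix.SpecialLinearGroup.coe_mul, mul_inv_cancel,
      Matrix.SpecialLinearGroup.coe_one]
  have hc : Commute w N := by
    have : w * N = N * w := by
      have h1 : w + w * N = 1 := by rw [← hwu]; noncomm_ring
      have h2 : w + N * w = 1 := by rw [← huw]; noncomm_ring
      exact add_left_cancel (h1.trans h2.symm)
    exact this
  have hw1 : w = 1 + (-(w * N)) := by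
    rw [← hwu]; noncomm_ring
  have hwN : (-(w * N)) ^ (p + 1) = 0 := by
    rw [neg_pow, hc.mul_pow, hN, mul_zero, mul_zero]
  have hwp : (-(w * N)) ^ p = (-1) ^ p * N ^ p := by
    rw [neg_pow, hc.mul_pow]
    have h1 : w * N ^ p = N ^ p := by
      have : N * N ^ p = 0 := by rw [← pow_succ', hN]
      calc w * N ^ p = w * ((1 + N) * N ^ p) := by rw [add_mul, this, one_mul, add_zero]
        _ = N ^ p := by rw [← mul_assoc, hwu, one_mul]
    have h2 : ∀ j : ℕ, w ^ j * N ^ p = N ^ p := fun j => by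
      induction j with
      | zero => simp
      | succ j ih => rw [pow_succ, mul_assoc, h1, ih]
    rw [h2]
  have hupow : ∀ m : ℕ, ((u ^ m : SLR n) : Mat) = (1 + N) ^ m := fun m => by
    rw [Matrix.SpecialLinearGroup.coe_pow, hu]
  have hwpow : ∀ m : ℕ, (((u ^ m)⁻¹ : SLR n) : Mat) = (1 + (-(w * N))) ^ m := fun m => by
    rw [← inv_pow, Matrix.SpecialLinearGroup.coe_pow, ← hw1]
  refine ⟨?_, ?_, ?_⟩
  · obtain ⟨C, hC, h1⟩ := exists_norm_one_add_pow_le hN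
    obtain ⟨C', hC', h2⟩ := exists_norm_one_add_pow_le hwN
    refine ⟨max C C', lt_max_of_lt_left hC, fun k m hm hk => ⟨?_, ?_⟩⟩
    · rw [hupow]
      exact (h1 m k hm hk).trans (by gcongr; exact le_max_left _ _)
    · rw [hwpow]
      exact (h2 m k hm hk).trans (by gcongr; exact le_max_right _ _)
  · simp only [hupow]
    exact tendsto_smul_one_add_pow hN
  · simp only [hwpow]
    have h3 := tendsto_smul_one_add_pow hwN
    rw [hwp] at h3
    convert h3 using 2
    rcases neg_one_pow_eq_or ℝ p with h | h <;> rcases neg_one_pow_eq_or Mat p with h' | h' <;>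
      rcases Nat.even_or_odd p with hp | hp <;> simp [hp.neg_one_pow]

theorem mulVec_vecMulVec_vecMul (M M' : Mat) (a b : Fin n → ℝ) :
    M * vecMulVec a b * M' = vecMulVec (M *ᵥ a) (b ᵥ* M') := by
  rw [mul_vecMulVec, vecMulVec_mul]

theorem ShearClosed.exists_shear_mem {H : Set (SLR n)} (hH : ShearClosed H) {u : SLR n}
    (hu : u ∈ H) (huu : IsUnipotent n u) (hu1 : u ≠ 1) :
    ∃ a b : Fin n → ℝ, a ≠ 0 ∧ b ≠ 0 ∧ b ⬝ᵥ a = 0 ∧ shear a b ∈ H := by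
  obtain ⟨N, hN⟩ : ∃ N : Mat, N = (u : Mat) - 1 := ⟨_, rfl⟩
  have huN : (u : Mat) = 1 + N := by rw [hN]; abel
  have hN0 : N ≠ 0 := by
    rintro rfl
    exact hu1 (Subtype.ext (by rw [huN, add_zero, Matrix.SpecialLinearGroup.coe_one]))
  obtain ⟨p, hp, hNp, hNp1⟩ := exists_pow_ne_zero_pow_succ_eq_zero
    (hN ▸ isUnipotent_iff.1 huu) hN0
  obtain ⟨⟨C, hC, hbd⟩, hlim1, hlim2⟩ := conj_pow_asymptotics huN hNp1
  have h2p : N ^ p * N ^ p = 0 := by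
    rw [← pow_add]
    exact pow_eq_zero_of_le (by omega) hNp1
  obtain ⟨i, j, hij⟩ : ∃ i j, (N ^ p) i j ≠ 0 := by
    by_contra! h
    exact hNp (Matrix.ext h)
  obtain ⟨b, hb⟩ : ∃ b : Fin n → ℝ, b = Pi.single i 1 := ⟨_, rfl⟩
  obtain ⟨a₀, ha₀⟩ : ∃ a₀ : Fin n → ℝ, a₀ = Pi.single j 1 := ⟨_, rfl⟩
  have hpair : b ⬝ᵥ (N ^ p *ᵥ a₀) ≠ 0 := by
    rw [hb, ha₀]
    simpa using hij
  set a := a₀ - ((b ⬝ᵥ a₀) / (b ⬝ᵥ (N ^ p *ᵥ a₀))) • (N ^ p *ᵥ a₀) with ha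
  have hba : b ⬝ᵥ a = 0 := by
    rw [ha, dotProduct_sub, dotProduct_smul, smul_eq_mul, div_mul_cancel₀ _ hpair, sub_self]
  have hNa : N ^ p *ᵥ a = N ^ p *ᵥ a₀ := by
    rw [ha, mulVec_sub, mulVec_smul, mulVec_mulVec, h2p, zero_mulVec, smul_zero, sub_zero]
  obtain ⟨κ, hκ⟩ : ∃ κ : ℝ, κ = (p ! : ℝ)⁻¹ * ((-1) ^ p * (p ! : ℝ)⁻¹) := ⟨_, rfl⟩
  have hκ0 : κ ≠ 0 := by
    rw [hκ]
    have : (p ! : ℝ) ≠ 0 := by exact_mod_cast p.factorial_ne_zero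
    positivity
  have hc : b ᵥ* N ^ p ⬝ᵥ κ • (N ^ p *ᵥ a) = 0 := by
    rw [dotProduct_smul, ← dotProduct_mulVec, mulVec_mulVec, h2p, zero_mulVec, dotProduct_zero,
      smul_zero]
  refine ⟨κ • (N ^ p *ᵥ a), b ᵥ* N ^ p, ?_, ?_, hc, ?_⟩
  · refine smul_ne_zero hκ0 fun h => hpair ?_
    rw [← hNa, h, dotProduct_zero]
  · intro h
    rw [dotProduct_mulVec, h, zero_dotProduct] at hpair
    exact hpair rfl
  have hlimM : κ • (N ^ p * vecMulVec a b * N ^ p) =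
      vecMulVec (κ • (N ^ p *ᵥ a)) (b ᵥ* N ^ p) := by
    rw [mulVec_vecMulVec_vecMul, smul_vecMulVec]
  refine hH.mem_of_tendsto (A := vecMulVec a b) hu huu hu1 (vecMulVec_sq hba)
    (vecMulVec_sq hc)
    (ε := fun k => ((k : ℝ) ^ p)⁻¹ * ((k : ℝ) ^ p)⁻¹) (C := C * ‖vecMulVec a b‖ * C)
    ?_ (fun k m hm => ?_) ?_ ?_ (coe_shear hc)
  · have : Tendsto (fun k : ℕ => ((k : ℝ) ^ p)⁻¹) atTop (𝓝 0) :=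
      tendsto_inv_atTop_zero.comp
        ((tendsto_pow_atTop (by omega)).comp tendsto_natCast_atTop_atTop)
    simpa using this.mul this
  · rcases Nat.eq_zero_or_pos k with rfl | hk
    · have : ((0 : ℕ) : ℝ) ^ p = 0 := by simp; omega
      rw [this, _root_.inv_zero, zero_mul, zero_smul, norm_zero]
      positivity
    obtain ⟨h1, h2⟩ := hbd k m hm hk
    have hkp : (0 : ℝ) < (k : ℝ) ^ p := by positivity
    rw [norm_smul, Real.norm_of_nonneg (by positivity)]
    calc ((k : ℝ) ^ p)⁻¹ * ((k : ℝ) ^ p)⁻¹ *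
          ‖((u ^ m : SLR n) : Mat) * vecMulVec a b * (((u ^ m)⁻¹ : SLR n) : Mat)‖
        ≤ ((k : ℝ) ^ p)⁻¹ * ((k : ℝ) ^ p)⁻¹ *
          ((C * k ^ p) * ‖vecMulVec a b‖ * (C * k ^ p)) := by
          gcongr
          refine (norm_mul_le _ _).trans ?_
          gcongr
          exact (norm_mul_le _ _).trans (by gcongr)
      _ = C * ‖vecMulVec a b‖ * C := by field_simp
  · rw [← hlimM, hκ]
    have h1 := (hlim1.mul (tendsto_const_nhds (x := vecMulVec a b))).mul hlim2
    simp only [smul_mul_assoc, mul_smul_comm, smul_smul] at h1 ⊢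
    simpa only [mul_comm] using h1
  · rw [← hlimM, huN]
    refine ((Commute.one_right _).add_right ?_).smul_left _
    have h1 : N ^ p * N = 0 := by rw [← pow_succ, hNp1]
    have h2 : N * N ^ p = 0 := by rw [← pow_succ', hNp1]
    rw [commute_iff_eq, mul_assoc, h1, mul_zero, ← mul_assoc, ← mul_assoc, h2, zero_mul, zero_mul]

theorem ShearClosed.shear_mem (hn : 3 ≤ n) {H : Set (SLR n)} (hH : ShearClosed H) {u : SLR n}
    (hu : u ∈ H) (huu : IsUnipotent n u) (hu1 : u ≠ 1) {x y : Fin n → ℝ} (hx : x ≠ 0)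
    (hyx : y ⬝ᵥ x = 0) : shear x y ∈ H := by
  obtain ⟨a, b, ha, hb, hba, h⟩ := hH.exists_shear_mem hu huu hu1
  exact hH.shear_mem_of_shear_mem hn ha hb hba h hx hyx

end Shears

section Mautner

open Set Filter Topology
open scoped Matrix.Norms.Operator ENNReal

variable {n : ℕ}

local notation "Mat" => Matrix (Fin n) (Fin n) ℝ

theorem transvection_mul_transvection_mul_transvection {i j : Fin n} (hij : i ≠ j) {a : ℝ}
    (ha : a ≠ 0) :
    (1 + single i j a) * (1 + single j i (-a⁻¹)) * (1 + single i j a) =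
      (1 - single i i 1 - single j j 1 + single i j a - single j i a⁻¹ : Mat) := by
  have hneg : ∀ (k l : Fin n) (x : ℝ), single k l (-x) = -single k l x := fun k l x => by
    ext a b; by_cases h : k = a ∧ l = b <;> simp [Matrix.single, h]
  simp only [mul_add, add_mul, mul_one, one_mul, single_mul_single_same,
    single_mul_single_of_ne _ _ _ _ hij.symm, mul_neg, neg_mul, mul_inv_cancel₀ ha,
    inv_mul_cancel₀ ha, hneg]
  abel

theorem coe_diag2n_eq {i j : Fin n} (hij : i ≠ j) {a : ℝ} (ha : a ≠ 0) :
    (Matrix.SpecialLinearGroup.diag2n hij a ha : Mat) =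
      (1 + single i j a) * (1 + single j i (-a⁻¹)) * (1 + single i j a) *
      ((1 + single i j (-1)) * (1 + single j i (-(-1)⁻¹)) * (1 + single i j (-1))) := by
  rw [transvection_mul_transvection_mul_transvection hij ha,
    transvection_mul_transvection_mul_transvection hij (by norm_num : (-1 : ℝ) ≠ 0)]
  have h1 : (Matrix.SpecialLinearGroup.diag2n hij a ha : Mat) =
      1 - single i i 1 - single j j 1 + single i i a + single j j a⁻¹ := by
    rw [Matrix.SpecialLinearGroup.diag2n_coe]
    ext k l
    by_cases hkl : k = l
    · subst hkl
      by_cases hki : k = i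
      · subst hki
        simp [hij.symm, Matrix.single]
      · by_cases hkj : k = j
        · subst hkj
          simp [hij, hij.symm, Matrix.single]
        · simp [hki, hkj, Ne.symm hki, Ne.symm hkj, Matrix.single]
    · simp [hkl, Matrix.single]
      grind
  rw [h1]
  have hneg : ∀ (k l : Fin n) (x : ℝ), single k l (-x) = -single k l x := fun k l x => by
    ext a b; by_cases h : k = a ∧ l = b <;> simp [Matrix.single, h]
  simp only [mul_add, add_mul, mul_sub, sub_mul, mul_one, one_mul, single_mul_single_same,
    single_mul_single_of_ne _ _ _ _ hij, single_mul_single_of_ne _ _ _ _ hij.symm, mul_neg,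
    _root_.inv_neg, _root_.inv_one, hneg]
  abel

theorem subgroup_eq_top_of_transvection_mem (hn : 2 ≤ n) {H : Subgroup (SLR n)}
    (h : ∀ (i j : Fin n) (hij : i ≠ j) (t : ℝ),
      Matrix.SpecialLinearGroup.transvection hij t ∈ H) : H = ⊤ := by
  have : Nontrivial (Fin n) := Fin.nontrivial_iff_two_le.2 hn
  refine (Subgroup.eq_top_iff' H).2 fun g => ?_
  refine Matrix.SpecialLinearGroup.diagonal_transvection_induction' (fun g => g ∈ H) g
    (fun i j hij c hc => ?_) (fun i j hij a => h i j hij a) (fun a b => H.mul_mem)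
  set T := fun (x : ℝ) => Matrix.SpecialLinearGroup.transvection hij x
  set T' := fun (x : ℝ) => Matrix.SpecialLinearGroup.transvection hij.symm x
  have h1 : Matrix.SpecialLinearGroup.diag2n hij c hc =
      T c * T' (-c⁻¹) * T c * (T (-1) * T' (-(-1)⁻¹) * T (-1)) := by
    refine Subtype.ext ((coe_diag2n_eq hij hc).trans ?_)
    simp only [Matrix.SpecialLinearGroup.coe_mul, T, T',
      Matrix.SpecialLinearGroup.transvection_coe]
  rw [h1]
  have hT : ∀ x, T x ∈ H := fun x => h i j hij x
  have hT' : ∀ x, T' x ∈ H := fun x => h j i hij.symm x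
  exact H.mul_mem (H.mul_mem (H.mul_mem (hT _) (hT' _)) (hT _))
    (H.mul_mem (H.mul_mem (hT _) (hT' _)) (hT _))

theorem transvection_eq_shear {i j : Fin n} (hij : i ≠ j) (t : ℝ) :
    Matrix.SpecialLinearGroup.transvection hij t =
      shear (Pi.single i t) (Pi.single j 1) := by
  refine eq_shear (by simp [hij.symm]) ?_
  rw [Matrix.SpecialLinearGroup.transvection_coe]
  congr 1
  ext k l
  simp [vecMulVec_apply, Matrix.single, Pi.single_apply]
  grind

/-! ### The group `SL(2,ℝ)` -/

/-- The upper triangular unipotent matrices in `SL(2,ℝ)`. -/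
noncomputable def upperUni (t : ℝ) : SLR 2 := ⟨!![1, t; 0, 1], by simp⟩

/-- The lower triangular unipotent matrices in `SL(2,ℝ)`. -/
noncomputable def lowerUni (t : ℝ) : SLR 2 := ⟨!![1, 0; t, 1], by simp⟩

/-- The diagonal matrices with positive entries in `SL(2,ℝ)`. -/
noncomputable def expDiag (s : ℝ) : SLR 2 :=
  ⟨!![Real.exp s, 0; 0, Real.exp (-s)], by simp [← Real.exp_add]⟩

theorem coe_upperUni (t : ℝ) : (upperUni t : Matrix (Fin 2) (Fin 2) ℝ) = !![1, t; 0, 1] := rfl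

theorem coe_lowerUni (t : ℝ) : (lowerUni t : Matrix (Fin 2) (Fin 2) ℝ) = !![1, 0; t, 1] := rfl

theorem coe_expDiag (s : ℝ) :
    (expDiag s : Matrix (Fin 2) (Fin 2) ℝ) = !![Real.exp s, 0; 0, Real.exp (-s)] := rfl

theorem upperUni_mul (s t : ℝ) : upperUni s * upperUni t = upperUni (s + t) :=
  Subtype.ext (by simp [Matrix.SpecialLinearGroup.coe_mul, coe_upperUni, add_comm])

theorem lowerUni_mul (s t : ℝ) : lowerUni s * lowerUni t = lowerUni (s + t) :=
  Subtype.ext (by simp [Matrix.SpecialLinearGroup.coe_mul, coe_lowerUni])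

theorem expDiag_mul (s t : ℝ) : expDiag s * expDiag t = expDiag (s + t) :=
  Subtype.ext (by
    simp [Matrix.SpecialLinearGroup.coe_mul, coe_expDiag, ← Real.exp_add, add_comm])

theorem upperUni_zero : upperUni 0 = 1 := Subtype.ext (by simp [coe_upperUni, one_fin_two])

theorem lowerUni_zero : lowerUni 0 = 1 := Subtype.ext (by simp [coe_lowerUni, one_fin_two])

theorem expDiag_zero : expDiag 0 = 1 := Subtype.ext (by simp [coe_expDiag, one_fin_two])

theorem upperUni_inv (t : ℝ) : (upperUni t)⁻¹ = upperUni (-t) :=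
  inv_eq_of_mul_eq_one_right (by rw [upperUni_mul, add_neg_cancel, upperUni_zero])

theorem lowerUni_inv (t : ℝ) : (lowerUni t)⁻¹ = lowerUni (-t) :=
  inv_eq_of_mul_eq_one_right (by rw [lowerUni_mul, add_neg_cancel, lowerUni_zero])

theorem expDiag_inv (t : ℝ) : (expDiag t)⁻¹ = expDiag (-t) :=
  inv_eq_of_mul_eq_one_right (by rw [expDiag_mul, add_neg_cancel, expDiag_zero])

theorem upperUni_pow (t : ℝ) (k : ℕ) : upperUni t ^ k = upperUni (k * t) := by
  induction k with
  | zero => simp [upperUni_zero]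
  | succ k ih => rw [pow_succ, ih, upperUni_mul]; push_cast; ring_nf

theorem expDiag_pow (t : ℝ) (k : ℕ) : expDiag t ^ k = expDiag (k * t) := by
  induction k with
  | zero => simp [expDiag_zero]
  | succ k ih => rw [pow_succ, ih, expDiag_mul]; push_cast; ring_nf

theorem expDiag_mul_upperUni (s t : ℝ) :
    expDiag s * upperUni t * (expDiag s)⁻¹ = upperUni (Real.exp (2 * s) * t) := by
  rw [expDiag_inv]
  refine Subtype.ext ?_
  simp only [Matrix.SpecialLinearGroup.coe_mul, coe_expDiag, coe_upperUni]
  simp [← Real.exp_add, two_mul]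
  rw [mul_right_comm, ← Real.exp_add]

theorem expDiag_mul_lowerUni (s t : ℝ) :
    expDiag s * lowerUni t * (expDiag s)⁻¹ = lowerUni (Real.exp (-(2 * s)) * t) := by
  rw [expDiag_inv]
  refine Subtype.ext ?_
  simp only [Matrix.SpecialLinearGroup.coe_mul, coe_expDiag, coe_lowerUni]
  simp [← Real.exp_add, two_mul]
  rw [mul_right_comm, ← Real.exp_add]

theorem continuous_upperUni : Continuous upperUni :=
  continuous_induced_rng.2 (by
    change Continuous fun t : ℝ => (!![1, t; 0, 1] : Matrix (Fin 2) (Fin 2) ℝ)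
    fun_prop)

theorem continuous_lowerUni : Continuous lowerUni :=
  continuous_induced_rng.2 (by
    change Continuous fun t : ℝ => (!![1, 0; t, 1] : Matrix (Fin 2) (Fin 2) ℝ)
    fun_prop)

theorem continuous_expDiag : Continuous expDiag :=
  continuous_induced_rng.2 (by
    change Continuous fun s : ℝ =>
      (!![Real.exp s, 0; 0, Real.exp (-s)] : Matrix (Fin 2) (Fin 2) ℝ)
    fun_prop)

theorem isUnipotent_upperUni (t : ℝ) : IsUnipotent 2 (upperUni t) := by
  unfold IsUnipotent
  rw [coe_upperUni, one_fin_two, pow_two]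
  ext i j
  fin_cases i <;> fin_cases j <;> simp

theorem subgroup_eq_top_of_upperUni_lowerUni {H : Subgroup (SLR 2)} (hu : ∀ t, upperUni t ∈ H)
    (hl : ∀ t, lowerUni t ∈ H) : H = ⊤ := by
  refine subgroup_eq_top_of_transvection_mem le_rfl fun i j hij t => ?_
  fin_cases i <;> fin_cases j
  · exact absurd rfl hij
  · convert hu t using 1
    refine Subtype.ext ?_
    rw [Matrix.SpecialLinearGroup.transvection_coe, coe_upperUni]
    ext k l
    fin_cases k <;> fin_cases l <;> simp [Matrix.single]
  · convert hl t using 1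
    refine Subtype.ext ?_
    rw [Matrix.SpecialLinearGroup.transvection_coe, coe_lowerUni]
    ext k l
    fin_cases k <;> fin_cases l <;> simp [Matrix.single]
  · exact absurd rfl hij

theorem exists_conj_eq_upperUni {u : SLR 2} (hu : IsUnipotent 2 u) (hu1 : u ≠ 1) :
    ∃ (g : SLR 2) (τ : ℝ), τ ≠ 0 ∧ g * u * g⁻¹ = upperUni τ := by
  obtain ⟨p, q, r, s, h⟩ : ∃ p q r s, (u : Matrix (Fin 2) (Fin 2) ℝ) = !![1 + p, q; r, 1 + s] :=
    ⟨(u : Matrix (Fin 2) (Fin 2) ℝ) 0 0 - 1, (u : Matrix (Fin 2) (Fin 2) ℝ) 0 1,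
      (u : Matrix (Fin 2) (Fin 2) ℝ) 1 0, (u : Matrix (Fin 2) (Fin 2) ℝ) 1 1 - 1, by
      ext i j
      fin_cases i <;> fin_cases j <;> simp⟩
  have htr := hu.trace
  have hdet := u.2
  rw [h] at htr hdet
  simp [det_fin_two] at htr hdet
  obtain rfl : s = -p := by linarith
  by_cases hr : r = 0
  · subst hr
    obtain rfl : p = 0 := by nlinarith
    have hq : u = upperUni q := Subtype.ext (by rw [h, coe_upperUni]; simp)
    exact ⟨1, q, fun h0 => hu1 (by rw [hq, h0, upperUni_zero]), by simp [hq]⟩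
  · obtain ⟨g, hg⟩ : ∃ g : SLR 2, (g : Matrix (Fin 2) (Fin 2) ℝ) = !![0, 1; -1, p / r] :=
      ⟨⟨!![0, 1; -1, p / r], by simp⟩, rfl⟩
    refine ⟨g, -r, neg_ne_zero.2 hr, ?_⟩
    rw [mul_inv_eq_iff_eq_mul]
    refine Subtype.ext ?_
    simp only [Matrix.SpecialLinearGroup.coe_mul, coe_upperUni, h, hg]
    ext i j
    fin_cases i <;> fin_cases j <;> simp <;> field_simp <;> linarith

/-! ### The Mautner phenomenon -/

/-- The zero set of a subadditive symmetric function, as a subgroup. -/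
def zeroSubgroup {G : Type*} [Group G] (d : G → ℝ≥0∞) (h1 : d 1 = 0)
    (hmul : ∀ g h, d (g * h) ≤ d g + d h) (hinv : ∀ g, d g⁻¹ = d g) : Subgroup G where
  carrier := {g | d g = 0}
  one_mem' := h1
  mul_mem' {a b} ha hb := le_antisymm ((hmul a b).trans
    (by rw [show d a = 0 from ha, show d b = 0 from hb, add_zero])) (zero_le)
  inv_mem' {a} ha := (hinv a).trans ha

theorem mem_zeroSubgroup_of_tendsto {G : Type*} [Group G] [TopologicalSpace G]
    [IsTopologicalGroup G] {d : G → ℝ≥0∞} {h1 : d 1 = 0}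
    {hmul : ∀ g h, d (g * h) ≤ d g + d h} {hinv : ∀ g, d g⁻¹ = d g}
    (hd : Tendsto d (𝓝 1) (𝓝 0)) {a g b : ℕ → G} {g₀ : G}
    (ha : ∀ k, a k ∈ zeroSubgroup d h1 hmul hinv) (hb : ∀ k, b k ∈ zeroSubgroup d h1 hmul hinv)
    (hg : Tendsto g atTop (𝓝 1)) (hlim : Tendsto (fun k => a k * g k * b k) atTop (𝓝 g₀)) :
    g₀ ∈ zeroSubgroup d h1 hmul hinv := by
  have h2 : Tendsto (fun k => d (g k) + d ((a k * g k * b k)⁻¹ * g₀)) atTop (𝓝 (0 + 0)) := by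
    refine (hd.comp hg).add (hd.comp ?_)
    simpa using hlim.inv.mul_const g₀
  rw [add_zero] at h2
  refine le_antisymm (ge_of_tendsto' h2 fun k => ?_) zero_le
  have h3 : d (a k * g k * b k) ≤ d (g k) :=
    calc d (a k * g k * b k) ≤ d (a k * g k) + d (b k) := hmul _ _
      _ ≤ (d (a k) + d (g k)) + d (b k) := by gcongr; exact hmul _ _
      _ = d (g k) := by rw [show d (a k) = 0 from ha k, show d (b k) = 0 from hb k]; simp
  calc d g₀ = d (a k * g k * b k * ((a k * g k * b k)⁻¹ * g₀)) := by rw [mul_inv_cancel_left]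
    _ ≤ _ := (hmul _ _).trans (by gcongr)

theorem eq_zero_of_isUnipotent (hn : 2 ≤ n) {u : SLR n} (hu : IsUnipotent n u) (hu1 : u ≠ 1)
    (d : SLR n → ℝ≥0∞) (h1 : d 1 = 0) (hmul : ∀ g h, d (g * h) ≤ d g + d h)
    (hinv : ∀ g, d g⁻¹ = d g) (hd : Tendsto d (𝓝 1) (𝓝 0)) (hdu : d u = 0) (g : SLR n) :
    d g = 0 := by
  suffices h : zeroSubgroup d h1 hmul hinv = ⊤ from
    show g ∈ zeroSubgroup d h1 hmul hinv from h ▸ Subgroup.mem_top g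
  have huH : u ∈ zeroSubgroup d h1 hmul hinv := hdu
  rcases hn.lt_or_eq with hn | rfl
  · have hH : ShearClosed (zeroSubgroup d h1 hmul hinv : Set (SLR n)) := by
      refine ⟨fun g hg k => Subgroup.pow_mem _ hg k, fun u hu _ _ => ⟨univ, univ_mem,
        fun g g₀ hg _ hlim _ => ?_⟩⟩
      exact mem_zeroSubgroup_of_tendsto hd (fun k => Subgroup.pow_mem _ hu k)
        (fun k => Subgroup.inv_mem _ (Subgroup.pow_mem _ hu k)) hg hlim
    refine subgroup_eq_top_of_transvection_mem (by omega) fun i j hij t => ?_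
    rw [← neg_neg t, ← Matrix.SpecialLinearGroup.transvection_inv, transvection_eq_shear]
    refine Subgroup.inv_mem _ ?_
    rcases eq_or_ne t 0 with rfl | ht
    · rw [← transvection_eq_shear hij, neg_zero, Matrix.SpecialLinearGroup.transvection_coeff_zero]
      exact Subgroup.one_mem _
    · exact hH.shear_mem hn huH hu hu1 (by simpa using ht) (by simp [hij.symm])
  · obtain ⟨c, τ, hτ, hc⟩ := exists_conj_eq_upperUni hu hu1
    set H := (zeroSubgroup d h1 hmul hinv).comap (MulAut.conj c⁻¹).toMonoidHom with hH
    have hmem : ∀ g, g ∈ H ↔ c⁻¹ * g * c ∈ zeroSubgroup d h1 hmul hinv := fun g => by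
      simp [hH]
    have hlimH : ∀ {a g b : ℕ → SLR 2} {g₀ : SLR 2}, (∀ k, a k ∈ H) → (∀ k, b k ∈ H) →
        Tendsto g atTop (𝓝 1) → Tendsto (fun k => a k * g k * b k) atTop (𝓝 g₀) → g₀ ∈ H := by
      intro a g b g₀ ha hb hg hlim
      refine (hmem _).2 (mem_zeroSubgroup_of_tendsto hd (fun k => (hmem _).1 (ha k))
        (fun k => (hmem _).1 (hb k)) (g := fun k => c⁻¹ * g k * c) ?_ ?_)
      · simpa using (hg.const_mul c⁻¹).mul_const c
      · simpa [mul_assoc] using (hlim.const_mul c⁻¹).mul_const c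
    have huτ : upperUni τ ∈ H := by
      rw [hmem, ← hc]
      simpa [mul_assoc] using huH
    have hdiag : expDiag (Real.log 2) ∈ H := by
      refine hlimH (a := fun k : ℕ => upperUni τ ^ (2 * (k + 1)))
        (b := fun k : ℕ => (upperUni τ ^ (k + 1))⁻¹)
        (g := fun k : ℕ => lowerUni ((2 * τ)⁻¹ * (1 / ((k : ℝ) + 1))))
        (fun k => Subgroup.pow_mem _ huτ _)
        (fun k => Subgroup.inv_mem _ (Subgroup.pow_mem _ huτ _)) ?_ ?_
      · have := (continuous_lowerUni.tendsto ((2 * τ)⁻¹ * 0)).comp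
          ((tendsto_one_div_add_atTop_nhds_zero_nat (𝕜 := ℝ)).const_mul (2 * τ)⁻¹)
        rw [mul_zero, lowerUni_zero] at this
        exact this
      · rw [tendsto_SLR_iff]
        have h3 : ∀ k : ℕ, ((upperUni τ ^ (2 * (k + 1)) *
            lowerUni ((2 * τ)⁻¹ * (1 / ((k : ℝ) + 1))) * (upperUni τ ^ (k + 1))⁻¹ : SLR 2) :
              Matrix (Fin 2) (Fin 2) ℝ) =
            !![2, 0; (2 * τ)⁻¹ * (1 / ((k : ℝ) + 1)), 1 / 2] := by
          intro k
          rw [upperUni_pow, upperUni_pow, upperUni_inv]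
          simp only [Matrix.SpecialLinearGroup.coe_mul, coe_upperUni, coe_lowerUni]
          have hk : (k : ℝ) + 1 ≠ 0 := by positivity
          ext i j
          fin_cases i <;> fin_cases j <;> simp <;> field_simp <;> norm_num
        simp only [h3]
        have h4 : Continuous fun t : ℝ => (!![2, 0; t, 1 / 2] : Matrix (Fin 2) (Fin 2) ℝ) := by
          fun_prop
        have h5 := (h4.tendsto ((2 * τ)⁻¹ * 0)).comp
          ((tendsto_one_div_add_atTop_nhds_zero_nat (𝕜 := ℝ)).const_mul (2 * τ)⁻¹)
        refine Eq.subst (motive := fun M => Tendsto _ atTop (𝓝 M)) ?_ h5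
        rw [mul_zero, coe_expDiag, Real.exp_neg, Real.exp_log two_pos]
        simp
    have hpow : Tendsto (fun k : ℕ => Real.exp (-(2 * (k * Real.log 2)))) atTop (𝓝 0) := by
      have : 0 < Real.log 2 := Real.log_pos one_lt_two
      refine Real.tendsto_exp_neg_atTop_nhds_zero.comp ?_
      exact (tendsto_natCast_atTop_atTop.atTop_mul_const this).const_mul_atTop two_pos
    have htop : H = ⊤ := by
      refine subgroup_eq_top_of_upperUni_lowerUni (fun t => ?_) fun t => ?_
      · refine hlimH (a := fun k => expDiag (Real.log 2) ^ k)
          (b := fun k => (expDiag (Real.log 2) ^ k)⁻¹)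
          (g := fun k => upperUni (Real.exp (-(2 * (k * Real.log 2))) * t))
          (fun k => Subgroup.pow_mem _ hdiag _)
          (fun k => Subgroup.inv_mem _ (Subgroup.pow_mem _ hdiag _)) ?_ ?_
        · have := (continuous_upperUni.tendsto (0 * t)).comp (hpow.mul_const t)
          rw [zero_mul, upperUni_zero] at this
          exact this
        · refine tendsto_const_nhds.congr fun k => ?_
          rw [expDiag_pow, expDiag_mul_upperUni, ← mul_assoc, ← Real.exp_add, add_neg_cancel,
            Real.exp_zero, one_mul]
      · refine hlimH (a := fun k => (expDiag (Real.log 2) ^ k)⁻¹)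
          (b := fun k => expDiag (Real.log 2) ^ k)
          (g := fun k => lowerUni (Real.exp (-(2 * (k * Real.log 2))) * t))
          (fun k => Subgroup.inv_mem _ (Subgroup.pow_mem _ hdiag _))
          (fun k => Subgroup.pow_mem _ hdiag _) ?_ ?_
        · have := (continuous_lowerUni.tendsto (0 * t)).comp (hpow.mul_const t)
          rw [zero_mul, lowerUni_zero] at this
          exact this
        · refine tendsto_const_nhds.congr fun k => ?_
          rw [expDiag_pow, ← expDiag_mul_lowerUni]
          group
    refine (Subgroup.eq_top_iff' _).2 fun g => ?_
    have := (hmem (c * g * c⁻¹)).1 (htop ▸ Subgroup.mem_top _)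
    simpa [mul_assoc] using this

end Mautner

section Polynomial

open Set Filter Topology

theorem card_filter_lt_of_dense {p q : ℕ → Prop} {c M : ℕ}
    (hp : 4 * c * {m | m < M ∧ ¬ p m}.ncard < M) (hq : 4 * c * {m | m < M ∧ ¬ q m}.ncard < M) :
    2 * c * {m | m < M ∧ ¬ (p m ∧ q m)}.ncard < M := by
  have h1 : {m | m < M ∧ ¬ (p m ∧ q m)} = {m | m < M ∧ ¬ p m} ∪ {m | m < M ∧ ¬ q m} := by
    ext m
    simp only [mem_ofPred_eq, mem_union]
    tauto
  have h2 := ncard_union_le {m | m < M ∧ ¬ p m} {m | m < M ∧ ¬ q m}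
  rw [← h1] at h2
  nlinarith

/-- A sequence with the growth of a polynomial of degree less than `d`, which is small
whenever it is known to be fairly small at a good time, stays small if most times are good. -/
theorem lt_of_gap {f : ℕ → ℝ} {d L : ℕ} {C δ δ' : ℝ} {good : ℕ → Prop} (hd : 1 ≤ d) (hC : 0 ≤ C)
    (hrec : ∀ M t b, 1 ≤ t → d * t ≤ M → (∀ j, 1 ≤ j → j ≤ d → f (M - j * t) ≤ b) →
      f M ≤ 2 ^ d * b)
    (hstep : ∀ m, f (m + 1) ≤ C * f m)
    (hgap : ∀ m ≤ L, good m → f m < δ → f m ≤ δ') (h1 : 2 ^ d * δ' < δ) (h2 : C * δ' < δ)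
    (h0 : f 0 < δ)
    (hgood : ∀ M, 1 ≤ M → 2 * d ^ 2 * {m | m < M ∧ ¬ good m}.ncard < M) :
    ∀ m ≤ L, f m < δ := by
  intro M
  induction M using Nat.strong_induction_on with
  | _ M ih =>
    intro hML
    have hfin : {m | m < M ∧ ¬ good m}.Finite := (finite_lt_nat M).subset fun m hm => hm.1
    rcases Nat.eq_zero_or_pos M with rfl | hM
    · exact h0
    have key : ∀ m < M, good m → f m ≤ δ' := fun m hm hg =>
      hgap m (by omega) hg (ih m hm (by omega))
    rcases lt_or_ge M d with hMd | hMd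
    · have hb : {m | m < M ∧ ¬ good m}.ncard = 0 := by
        by_contra hne
        have := hgood M hM
        have h3 : 1 ≤ {m | m < M ∧ ¬ good m}.ncard := Nat.one_le_iff_ne_zero.2 hne
        nlinarith
      rw [ncard_eq_zero hfin] at hb
      have hg : good (M - 1) := by
        by_contra hng
        have : M - 1 ∈ {m | m < M ∧ ¬ good m} := ⟨by omega, hng⟩
        rw [hb] at this
        exact this
      calc f M = f (M - 1 + 1) := by rw [Nat.sub_add_cancel hM]
        _ ≤ C * f (M - 1) := hstep _
        _ ≤ C * δ' := by gcongr; exact key _ (by omega) hg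
        _ < δ := h2
    · by_cases hex : ∃ t, 1 ≤ t ∧ d * t ≤ M ∧ ∀ j, 1 ≤ j → j ≤ d → good (M - j * t)
      · obtain ⟨t, ht, htM, hg⟩ := hex
        refine (hrec M t δ' ht htM fun j hj hjd => key _ ?_ (hg j hj hjd)).trans_lt h1
        have : 1 ≤ j * t := Nat.one_le_iff_ne_zero.2 (Nat.mul_ne_zero (by omega) (by omega))
        omega
      · push Not at hex
        exfalso
        have hT : ∀ t ∈ Finset.Icc 1 (M / d), ∃ j, 1 ≤ j ∧ j ≤ d ∧ ¬ good (M - j * t) := by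
          intro t ht
          rw [Finset.mem_Icc] at ht
          exact hex t ht.1 ((Nat.mul_le_mul_left d ht.2).trans (Nat.mul_div_le M d))
        choose! J hJ1 hJd hJb using hT
        have hJt : ∀ t ∈ Finset.Icc 1 (M / d), 1 ≤ J t * t ∧ J t * t ≤ M := by
          intro t ht
          have h1 := hJ1 t ht
          have h2 := hJd t ht
          rw [Finset.mem_Icc] at ht
          refine ⟨Nat.one_le_iff_ne_zero.2 (Nat.mul_ne_zero (by omega) (by omega)), ?_⟩
          exact (Nat.mul_le_mul h2 ht.2).trans (Nat.mul_div_le M d)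
        have hcard : (Finset.Icc 1 (M / d)).card ≤
            (Finset.Icc 1 d ×ˢ hfin.toFinset).card := by
          refine Finset.card_le_card_of_injOn (fun t => (J t, M - J t * t)) (fun t ht => ?_)
            fun t ht t' ht' h => ?_
          · have h3 := hJt t ht
            simp only [Finset.coe_product, mem_prod, Finset.mem_coe, Finset.mem_Icc,
              Finite.mem_toFinset]
            exact ⟨⟨hJ1 t ht, hJd t ht⟩, by omega, hJb t ht⟩
          · simp only [Prod.mk.injEq] at h
            have h3 := hJt t ht
            have h4 := hJt t' ht'
            have h5 := hJ1 t ht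
            have h6 : J t * t = J t' * t' := by omega
            rw [← h.1] at h6
            exact Nat.eq_of_mul_eq_mul_left (by omega) h6
        rw [Finset.card_product, Nat.card_Icc, Nat.card_Icc,
          ← ncard_eq_toFinset_card _ hfin] at hcard
        have h3 := hgood M hM
        have h4 : M < d * (M / d + 1) := Nat.lt_mul_div_succ M (by omega)
        have h5 : 1 ≤ M / d := (Nat.one_le_div_iff (by omega)).2 hMd
        simp only [Nat.add_sub_cancel] at hcard
        have h6 : d * (M / d + 1) ≤ 2 * d ^ 2 * {m | m < M ∧ ¬ good m}.ncard := by
          calc d * (M / d + 1) ≤ d * (2 * (M / d)) := by gcongr; omega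
            _ ≤ d * (2 * (d * {m | m < M ∧ ¬ good m}.ncard)) := by gcongr
            _ = _ := by ring
        omega

variable {E : Type*} [NormedAddCommGroup E] [NormedSpace ℝ E]

theorem norm_pow_apply_le_of_sub_one_pow_eq_zero {T : Module.End ℝ E} {d : ℕ}
    (hT : (T - 1) ^ d = 0) {x : E} {b : ℝ} (hb : ∀ i < d, ‖(T ^ i) x‖ ≤ b) (hd : 1 ≤ d) :
    ‖(T ^ d) x‖ ≤ 2 ^ d * b := by
  have hb0 : 0 ≤ b := (norm_nonneg _).trans (hb 0 hd)
  have h1 : (T - 1) ^ d = ∑ m ∈ Finset.range (d + 1),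
      ((-1 : ℝ) ^ (d - m) * d.choose m) • T ^ m := by
    rw [sub_eq_add_neg, ((Commute.one_right T).neg_right).add_pow]
    refine Finset.sum_congr rfl fun m _ => ?_
    have h2 : (-1 : Module.End ℝ E) = algebraMap ℝ _ (-1) := by simp
    have h3 : (d.choose m : Module.End ℝ E) = algebraMap ℝ _ (d.choose m) := by simp
    rw [h2, h3, ← map_pow, mul_assoc, ← map_mul, ← Algebra.commutes, Algebra.smul_def]
  rw [hT, Finset.sum_range_succ, Nat.choose_self, Nat.sub_self, pow_zero,
    Nat.cast_one, mul_one, one_smul] at h1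
  have h2 : (T ^ d) x = -∑ m ∈ Finset.range d, ((-1 : ℝ) ^ (d - m) * d.choose m) • (T ^ m) x := by
    have := congrArg (fun S : Module.End ℝ E => S x) h1.symm
    simp only [LinearMap.add_apply, LinearMap.zero_apply, LinearMap.sum_apply,
      LinearMap.smul_apply] at this
    rw [add_comm] at this
    exact eq_neg_of_add_eq_zero_left this
  rw [h2, norm_neg]
  calc ‖∑ m ∈ Finset.range d, ((-1 : ℝ) ^ (d - m) * d.choose m) • (T ^ m) x‖
      ≤ ∑ m ∈ Finset.range d, (d.choose m : ℝ) * b := by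
        refine norm_sum_le_of_le _ fun m hm => ?_
        rw [norm_smul, norm_mul, norm_pow, norm_neg, norm_one, one_pow, one_mul,
          Real.norm_natCast]
        gcongr
        exact hb m (Finset.mem_range.1 hm)
    _ ≤ ∑ m ∈ Finset.range (d + 1), (d.choose m : ℝ) * b := by
        refine Finset.sum_le_sum_of_subset_of_nonneg (Finset.range_mono (Nat.le_succ d))
          fun m _ _ => by positivity
    _ = 2 ^ d * b := by
        rw [← Finset.sum_mul, ← Nat.cast_sum, Nat.sum_range_choose]
        push_cast
        rfl

theorem pow_apply_eq_add_smul {T : Module.End ℝ E} {y : E} (h : (T - 1) ((T - 1) y) = 0) (m : ℕ) :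
    (T ^ m) y = y + (m : ℝ) • (T - 1) y := by
  have hT : T ((T - 1) y) = (T - 1) y := by
    simpa [sub_eq_zero] using h
  induction m with
  | zero => simp
  | succ m ih =>
    rw [pow_succ', Module.End.mul_apply, ih, map_add, map_smul, hT]
    have : T y = y + (T - 1) y := by simp
    rw [this]
    push_cast
    rw [add_smul, one_smul]
    abel

theorem apply_eq_self_of_bounded [FiniteDimensional ℝ E] {T : Module.End ℝ E} {d : ℕ}
    (hT : (T - 1) ^ d = 0) {x : E} {C : ℝ} (hC : ∀ m : ℕ, ‖(T ^ m) x‖ ≤ C) : T x = x := by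
  have key : ∀ k : ℕ, ((T - 1) ^ (k + 1)) x = 0 := by
    intro k
    by_cases hk : d ≤ k + 1
    · rw [pow_eq_zero_of_le hk hT, LinearMap.zero_apply]
    · refine Nat.decreasingInduction' (P := fun k => ((T - 1) ^ (k + 1)) x = 0) (m := k) (n := d)
        (fun j _ _ hj => ?_) (by omega) ?_
      · set y := ((T - 1) ^ j) x with hy
        have h1 : (T - 1) ((T - 1) y) = 0 := by
          rw [hy, ← Module.End.mul_apply, ← Module.End.mul_apply, mul_assoc, ← pow_succ',
              ← pow_succ', hj]
        have h2 : ∀ m : ℕ, ‖y + (m : ℝ) • (T - 1) y‖ ≤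
            ‖LinearMap.toContinuousLinearMap ((T - 1) ^ j)‖ * C := by
          intro m
          rw [← pow_apply_eq_add_smul h1, hy, ← Module.End.mul_apply]
          have hc : Commute (T ^ m) ((T - 1) ^ j) :=
            ((Commute.refl T).sub_right (Commute.one_right T)).pow_pow _ _
          rw [hc.eq, Module.End.mul_apply]
          exact ((LinearMap.toContinuousLinearMap ((T - 1) ^ j)).le_opNorm _).trans
            (by gcongr; exact hC m)
        rw [pow_succ', Module.End.mul_apply, ← hy]
        by_contra hne
        have hpos : 0 < ‖(T - 1) y‖ := norm_pos_iff.2 hne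
        obtain ⟨m, hm⟩ := exists_nat_gt
          ((‖LinearMap.toContinuousLinearMap ((T - 1) ^ j)‖ * C + ‖y‖) / ‖(T - 1) y‖)
        rw [div_lt_iff₀ hpos] at hm
        have h3 := h2 m
        have h4 : ‖(m : ℝ) • (T - 1) y‖ ≤ ‖y + (m : ℝ) • (T - 1) y‖ + ‖y‖ := by
          have := norm_sub_le (y + (m : ℝ) • (T - 1) y) y
          rwa [add_sub_cancel_left] at this
        rw [norm_smul, Real.norm_natCast] at h4
        linarith
      · rw [pow_succ', hT, mul_zero, LinearMap.zero_apply]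
  have := key 0
  simpa [sub_eq_zero] using this

end Polynomial

section Conjugation

open Set Filter Topology
open scoped Matrix.Norms.Operator

variable {n : ℕ}

local notation "Mat" => Matrix (Fin n) (Fin n) ℝ

/-- The conjugation representation of `SL(n,ℝ)` on matrices. -/
noncomputable def conjEnd (n : ℕ) : SLR n →* Module.End ℝ (Matrix (Fin n) (Fin n) ℝ) where
  toFun w := LinearMap.mulLeft ℝ (w : Matrix (Fin n) (Fin n) ℝ) *
    LinearMap.mulRight ℝ ((w⁻¹ : SLR n) : Matrix (Fin n) (Fin n) ℝ)
  map_one' := by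
    ext X : 1
    simp
  map_mul' a b := by
    ext X : 1
    rw [_root_.mul_inv_rev, Matrix.SpecialLinearGroup.coe_mul, Matrix.SpecialLinearGroup.coe_mul]
    simp only [Module.End.mul_apply, LinearMap.mulLeft_apply, LinearMap.mulRight_apply, mul_assoc]

theorem conjEnd_apply (w : SLR n) (X : Mat) :
    conjEnd n w X = (w : Mat) * X * ((w⁻¹ : SLR n) : Mat) := by
  rw [mul_assoc]
  rfl

theorem conjEnd_sub_one (w h : SLR n) :
    conjEnd n w ((h : Mat) - 1) = ((w * h * w⁻¹ : SLR n) : Mat) - 1 := by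
  have h1 : (w : Mat) * ((w⁻¹ : SLR n) : Mat) = 1 := by
    rw [← Matrix.SpecialLinearGroup.coe_mul, mul_inv_cancel, Matrix.SpecialLinearGroup.coe_one]
  rw [conjEnd_apply, mul_sub, sub_mul, mul_one, h1, Matrix.SpecialLinearGroup.coe_mul,
    Matrix.SpecialLinearGroup.coe_mul]

theorem conjEnd_sub_one_pow {w : SLR n} (hw : IsUnipotent n w) :
    (conjEnd n w - 1) ^ (2 * n) = 0 := by
  set A := LinearMap.mulLeft ℝ (w : Mat)
  set B := LinearMap.mulRight ℝ ((w⁻¹ : SLR n) : Mat)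
  have hAB : Commute A B := LinearMap.commute_mulLeft_right _ _
  have hA : (A - 1) ^ n = 0 := by
    have : A - 1 = LinearMap.mulLeft ℝ ((w : Mat) - 1) := by
      ext X : 1
      simp [A, sub_mul]
    rw [this, LinearMap.pow_mulLeft, hw, LinearMap.mulLeft_zero_eq_zero]
  have hB : (B - 1) ^ n = 0 := by
    have : B - 1 = LinearMap.mulRight ℝ (((w⁻¹ : SLR n) : Mat) - 1) := by
      ext X : 1
      simp [B, mul_sub]
    rw [this, LinearMap.pow_mulRight, hw.inv, LinearMap.mulRight_zero_eq_zero]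
  have h1 : conjEnd n w - 1 = (A - 1) * B + (B - 1) := by
    change A * B - 1 = _
    rw [sub_mul, one_mul]
    abel
  have hA1 : Commute (A - 1) B := hAB.sub_left (Commute.one_left _)
  have hc : Commute ((A - 1) * B) (B - 1) :=
    ((hA1.sub_right (Commute.one_right _))).mul_left
      ((Commute.refl B).sub_right (Commute.one_right _))
  rw [h1]
  refine hc.add_pow_eq_zero_of_add_le_succ_of_pow_eq_zero (m := n) (n := n) ?_ hB (by omega)
  rw [hA1.mul_pow, hA, zero_mul]

theorem Commute.of_bounded_conj {w h : SLR n} (hw : IsUnipotent n w) {C : ℝ}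
    (hC : ∀ m : ℕ, ‖((w ^ m * h * (w ^ m)⁻¹ : SLR n) : Mat) - 1‖ ≤ C) : w * h = h * w := by
  have h1 : conjEnd n w ((h : Mat) - 1) = (h : Mat) - 1 := by
    refine apply_eq_self_of_bounded (conjEnd_sub_one_pow hw) (C := C) fun m => ?_
    rw [← map_pow, conjEnd_sub_one]
    exact hC m
  rw [conjEnd_sub_one, sub_left_inj] at h1
  exact mul_inv_eq_iff_eq_mul.1 (Subtype.ext h1)

end Conjugation

section Injectivity

open Set Filter Topology

variable {G : Type*} [Group G] [TopologicalSpace G] [IsTopologicalGroup G]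
  [LocallyCompactSpace G] [PolishSpace G] [MeasurableSpace G] [BorelSpace G] {Γ : Subgroup G}
  [DiscreteTopology Γ]

set_option linter.unusedSectionVars false

theorem exists_nhds_inv_mul_smul_eq_imp {K : Set (G ⧸ Γ)} (hK : IsCompact K) :
    ∃ W ∈ 𝓝 (1 : G), ∀ a ∈ W, ∀ b ∈ W, ∀ p ∈ K, (a⁻¹ * b) • p = p → a⁻¹ * b = 1 := by
  obtain ⟨O, hO, hOK⟩ := (eventually_smul_eq_self_imp hK).exists_mem
  have hdiv : Tendsto (fun q : G × G => q.1⁻¹ * q.2) (𝓝 1 ×ˢ 𝓝 1) (𝓝 1) := by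
    have : Continuous (fun q : G × G => q.1⁻¹ * q.2) := by fun_prop
    simpa [nhds_prod_eq] using this.tendsto (1, 1)
  obtain ⟨B₁, hB₁, B₂, hB₂, hBB⟩ := Filter.mem_prod_iff.1 (hdiv hO)
  refine ⟨B₁ ∩ B₂, Filter.inter_mem hB₁ hB₂, fun a ha b hb => hOK _ ?_⟩
  have hab : (a, b) ∈ B₁ ×ˢ B₂ := ⟨ha.1, hb.2⟩
  exact hBB hab

end Injectivity

section Shadow

open Set Filter Topology
open scoped Matrix.Norms.Operator ENNReal

set_option linter.unusedSectionVars false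

attribute [local instance] t2Space_quotient_of_discrete

variable {n : ℕ}

local notation "Mat" => Matrix (Fin n) (Fin n) ℝ

theorem exists_lt_of_gap_conj {w : SLR n} (hw : IsUnipotent n w) {δ : ℝ} (hδ : 0 < δ) :
    ∃ δ' > 0, δ' < δ ∧ ∀ (L : ℕ) (h : SLR n) (good : ℕ → Prop),
      (∀ m ≤ L, good m → ‖((w ^ m * h * (w ^ m)⁻¹ : SLR n) : Mat) - 1‖ < δ →
        ‖((w ^ m * h * (w ^ m)⁻¹ : SLR n) : Mat) - 1‖ ≤ δ') →
      ‖(h : Mat) - 1‖ < δ →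
      (∀ M, 1 ≤ M → 2 * (2 * n + 1) ^ 2 * {m | m < M ∧ ¬ good m}.ncard < M) →
      ∀ m ≤ L, ‖((w ^ m * h * (w ^ m)⁻¹ : SLR n) : Mat) - 1‖ < δ := by
  set d := 2 * n + 1
  set C := ‖(w : Mat)‖ * ‖((w⁻¹ : SLR n) : Mat)‖
  have hC : 0 ≤ C := by positivity
  have hD : 0 < 2 ^ d + C + 1 := by positivity
  have hmul : δ / (2 ^ d + C + 1) * (2 ^ d + C + 1) = δ := div_mul_cancel₀ _ hD.ne'
  have hδ' : 0 < δ / (2 ^ d + C + 1) := by positivity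
  have h2d : (1 : ℝ) ≤ 2 ^ d := one_le_pow₀ (by norm_num)
  refine ⟨δ / (2 ^ d + C + 1), hδ', by nlinarith, fun L h good hgap h0 hgood => ?_⟩
  have hX : ∀ m, ((w ^ m * h * (w ^ m)⁻¹ : SLR n) : Mat) - 1 = conjEnd n w ^ m •
      ((h : Mat) - 1) := by
    intro m
    rw [← conjEnd_sub_one, map_pow, Module.End.smul_def]
  simp only [hX] at hgap ⊢
  refine lt_of_gap (d := d) (C := C) (by omega) hC (fun M t b ht hdt hb => ?_) (fun m => ?_) hgap
    (by nlinarith) (by nlinarith) (by simpa using h0) hgood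
  · have hT : (conjEnd n w ^ t - 1) ^ d = 0 := by
      rw [← map_pow]
      exact pow_eq_zero_of_le (by omega) (conjEnd_sub_one_pow (hw.pow t))
    have := norm_pow_apply_le_of_sub_one_pow_eq_zero hT
      (x := conjEnd n w ^ (M - d * t) • ((h : Mat) - 1)) (b := b) (fun i hi => ?_) (by omega)
    · rw [← Module.End.smul_def, smul_smul, ← pow_mul, ← pow_add] at this
      rwa [show t * d + (M - d * t) = M by rw [mul_comm t d]; omega] at this
    · rw [← Module.End.smul_def, smul_smul, ← pow_mul, ← pow_add]
      have := hb (d - i) (by omega) (by omega)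
      rwa [show M - (d - i) * t = t * i + (M - d * t) by
        rw [Nat.sub_mul, mul_comm t i]
        have : i * t ≤ d * t := by gcongr
        omega] at this
  · rw [pow_succ', mul_smul, Module.End.smul_def (conjEnd n w), conjEnd_apply]
    calc _ ≤ ‖(w : Mat)‖ * ‖conjEnd n w ^ m • ((h : Mat) - 1)‖ * ‖((w⁻¹ : SLR n) : Mat)‖ :=
          (norm_mul_le _ _).trans (by gcongr; exact norm_mul_le _ _)
      _ = _ := by simp only [C]; ring

variable {Λ : Subgroup (SLR n)} [DiscreteTopology Λ] {μ : Measure (SLR n ⧸ Λ)}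
  [IsProbabilityMeasure μ] [SMulInvariantMeasure (SLR n) (SLR n ⧸ Λ) μ]
  {φ : SLR n ⧸ Λ → SLR n ⧸ Λ}

theorem apply_zero_of_dense {p : ℕ → Prop} {q : ℕ} (hq : 0 < q)
    (h : ∀ M, 1 ≤ M → q * {m | m < M ∧ ¬ p m}.ncard < M) : p 0 := by
  by_contra h0
  have h1 := h 1 le_rfl
  have h2 : {m | m < 1 ∧ ¬ p m} = {0} := by
    ext m
    simp only [mem_ofPred_eq, mem_singleton_iff]
    exact ⟨fun hm => by omega, fun hm => by subst hm; exact ⟨one_pos, h0⟩⟩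
  rw [h2, ncard_singleton] at h1
  omega

/-- If the `w`-orbits of `y` and `h • y` are close at most times, then the conjugates of `h`
by powers of `w` stay small. -/
theorem exists_forall_norm_conj_lt {w : SLR n} (hw : IsUnipotent n w) {K : Set (SLR n ⧸ Λ)}
    (hK : IsCompact K) {δ : ℝ} (hδ : 0 < δ) :
    ∃ δ' > 0, ∀ (L : ℕ) (h : SLR n) (y : SLR n ⧸ Λ) (good : ℕ → Prop), ‖(h : Mat) - 1‖ < δ' →
      (∀ m ≤ L, good m → w ^ m • y ∈ K ∧ ∃ h₂ : SLR n, ‖(h₂ : Mat) - 1‖ < δ' ∧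
        w ^ m • h • y = h₂ • w ^ m • y) →
      (∀ M, 1 ≤ M → 2 * (2 * n + 1) ^ 2 * {m | m < M ∧ ¬ good m}.ncard < M) →
      ∀ m ≤ L, ‖((w ^ m * h * (w ^ m)⁻¹ : SLR n) : Mat) - 1‖ < δ := by
  obtain ⟨W, hW, hWK⟩ := exists_nhds_inv_mul_smul_eq_imp hK
  obtain ⟨δW, hδW, hWδ⟩ := exists_norm_sub_one_lt_subset hW
  obtain ⟨δ', hδ', hδδ', hcore⟩ := exists_lt_of_gap_conj hw (lt_min hδ hδW)
  refine ⟨δ', hδ', fun L h y good hh hgood hdense m hm =>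
    (hcore L h good (fun m hm hg hmδ => ?_) (hh.trans hδδ') hdense m hm).trans_le
      (min_le_left _ _)⟩
  obtain ⟨hyK, h₂, hh₂, heq⟩ := hgood m hm hg
  have h3 : (h₂⁻¹ * (w ^ m * h * (w ^ m)⁻¹)) • w ^ m • y = w ^ m • y := by
    rw [mul_smul, mul_smul, mul_smul, inv_smul_smul, heq, inv_smul_smul]
  have h4 := hWK h₂ (hWδ _ (hh₂.trans (hδδ'.trans_le (min_le_right _ _)))) _
    (hWδ _ (hmδ.trans_le (min_le_right _ _))) _ hyK h3
  rw [← inv_mul_eq_one.1 h4]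
  exact hh₂.le

/-- If `φ` intertwines `u` with a unipotent `w`, then for most `x` a point near `x` whose
`u`-orbit follows that of `x` is sent to a point whose `w`-orbit follows that of `φ x`. -/
theorem exists_shadow (hφ : Measurable φ) {u w : SLR n} (H : Intertwines μ φ u w)
    (hw : IsUnipotent n w) {ε : ℝ≥0∞} (hε : ε ≠ 0) {δ : ℝ} (hδ : 0 < δ) :
    ∃ V ∈ 𝓝 (1 : SLR n), ∀ δ'' : ℝ, 0 < δ'' → ∀ᶠ g in 𝓝 (1 : SLR n), ∀ L : ℕ,
      (∀ m ≤ L, u ^ m * g * (u ^ m)⁻¹ ∈ V) → ∃ E : Set (SLR n ⧸ Λ), μ Eᶜ ≤ ε ∧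
      ∀ x ∈ E, ∃ h : SLR n, φ (g • x) = h • φ x ∧ ‖(h : Mat) - 1‖ < δ'' ∧
        ∀ m ≤ L, ‖((w ^ m * h * (w ^ m)⁻¹ : SLR n) : Mat) - 1‖ < δ := by
  obtain ⟨K, hK, hφK, hgood⟩ := exists_good_set μ hφ (4 * (2 * n + 1) ^ 2)
    (ENNReal.half_pos hε).ne'
  obtain ⟨E, hE, hμE, hEK⟩ := hgood u
  obtain ⟨δ', hδ', hcore⟩ := exists_forall_norm_conj_lt hw (hK.image_of_continuousOn hφK) hδ
  refine ⟨_, eventually_exists_smul_eq hK hφK (eventually_norm_sub_one_lt hδ'), fun δ'' hδ'' => ?_⟩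
  filter_upwards [eventually_exists_smul_eq hK hφK
    (eventually_norm_sub_one_lt (lt_min hδ'' hδ'))] with g hg L hV
  have hpow : ∀ᵐ x ∂μ, ∀ m : ℕ, φ (u ^ m • x) = w ^ m • φ x := ae_all_iff.2 fun m => H.pow m
  have hpowg := ae_smul μ hpow g
  have hpos : 0 < 4 * (2 * n + 1) ^ 2 := by positivity
  have hmem : ∀ x ∈ E, x ∈ K := fun x hx => by
    simpa using apply_zero_of_dense (p := fun m => u ^ m • x ∈ K) hpos (hEK x hx)
  refine ⟨E ∩ (fun x => g • x) ⁻¹' E ∩ {x | (∀ m : ℕ, φ (u ^ m • x) = w ^ m • φ x) ∧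
    ∀ m : ℕ, φ (u ^ m • g • x) = w ^ m • φ (g • x)}, ?_, ?_⟩
  · rw [compl_inter, compl_inter, ← preimage_compl]
    refine (measure_union_le _ _).trans ?_
    rw [show μ {x | (∀ m : ℕ, φ (u ^ m • x) = w ^ m • φ x) ∧
      ∀ m : ℕ, φ (u ^ m • g • x) = w ^ m • φ (g • x)}ᶜ = 0 from
      mem_ae_iff.1 (hpow.and hpowg), add_zero]
    refine (measure_union_le _ _).trans ?_
    rw [(measurePreserving_smul g μ).measure_preimage hE.compl.nullMeasurableSet]
    exact (add_le_add hμE hμE).trans (ENNReal.add_halves ε).le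
  · rintro x ⟨⟨hx, hgx⟩, hx1, hx2⟩
    obtain ⟨h, hh, hφh⟩ := hg x (hmem x hx) (hmem _ hgx)
    have hh' : ‖(h : Mat) - 1‖ < min δ'' δ' := hh
    refine ⟨h, hφh, hh'.trans_le (min_le_left _ _), ?_⟩
    refine hcore L h (φ x) (fun m => u ^ m • x ∈ K ∧ u ^ m • g • x ∈ K)
      (hh'.trans_le (min_le_right _ _)) (fun m hm hgood => ?_) (fun M hM => ?_)
    · have hgood2 : (u ^ m * g * (u ^ m)⁻¹) • u ^ m • x ∈ K := by
        rw [smul_smul, inv_mul_cancel_right, mul_smul]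
        exact hgood.2
      obtain ⟨h₂, hh₂, heq⟩ := hV m hm _ hgood.1 hgood2
      rw [smul_smul, inv_mul_cancel_right, mul_smul, hx2, hφh] at heq
      rw [← hx1 m]
      exact ⟨mem_image_of_mem φ hgood.1, h₂, hh₂, heq⟩
    · exact card_filter_lt_of_dense (hEK x hx M hM) (hEK _ hgx M hM)

end Shadow

section Shear

open Set Filter Topology
open scoped Matrix.Norms.Operator ENNReal

set_option linter.unusedSectionVars false

attribute [local instance] t2Space_quotient_of_discrete

variable {n : ℕ}

local notation "Mat" => Matrix (Fin n) (Fin n) ℝ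

theorem IsUnipotent.of_tendsto_conj {a h : ℕ → SLR n} {h₀ : SLR n} (hh : Tendsto h atTop (𝓝 1))
    (hlim : Tendsto (fun j => a j * h j * (a j)⁻¹) atTop (𝓝 h₀)) : IsUnipotent n h₀ := by
  rw [isUnipotent_iff_det]
  intro z
  have hc : Continuous fun X : Mat => (1 + z • (X - 1)).det := by fun_prop
  have h1 := (hc.tendsto _).comp (tendsto_SLR_iff.1 hlim)
  have h2 := (hc.tendsto _).comp (tendsto_SLR_iff.1 hh)
  have h3 : ∀ j, (1 + z • (((a j * h j * (a j)⁻¹ : SLR n) : Mat) - 1)).det =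
      (1 + z • ((h j : Mat) - 1)).det := by
    intro j
    have h4 : ((a j : SLR n) : Mat) * (((a j)⁻¹ : SLR n) : Mat) = 1 := by
      rw [← Matrix.SpecialLinearGroup.coe_mul, mul_inv_cancel, Matrix.SpecialLinearGroup.coe_one]
    have h5 : 1 + z • (((a j * h j * (a j)⁻¹ : SLR n) : Mat) - 1) =
        (a j : Mat) * (1 + z • ((h j : Mat) - 1)) * (((a j)⁻¹ : SLR n) : Mat) := by
      rw [mul_add, add_mul, mul_one, h4, mul_smul_comm, smul_mul_assoc, mul_sub, sub_mul, mul_one,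
        h4, Matrix.SpecialLinearGroup.coe_mul, Matrix.SpecialLinearGroup.coe_mul]
    rw [h5, det_mul, det_mul, mul_right_comm, ← det_mul, h4, det_one, one_mul]
  have h6 : (fun X : Mat => (1 + z • (X - 1)).det) ∘ (fun j => ((a j * h j * (a j)⁻¹ : SLR n) : Mat))
      = (fun X : Mat => (1 + z • (X - 1)).det) ∘ fun j => ((h j : SLR n) : Mat) := funext h3
  rw [h6] at h1
  simpa using tendsto_nhds_unique h1 h2

theorem tendsto_one_of_norm_sub_one_le {h : ℕ → SLR n} {b : ℕ → ℝ}
    (hb : ∀ j, ‖(h j : Mat) - 1‖ ≤ b j) (hlim : Tendsto b atTop (𝓝 0)) :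
    Tendsto h atTop (𝓝 1) := by
  intro V hV
  obtain ⟨δ, hδ, hδV⟩ := exists_norm_sub_one_lt_subset hV
  rw [mem_map]
  filter_upwards [hlim.eventually_lt_const hδ] with j hj
  exact hδV _ ((hb j).trans_lt hj)

variable {Λ : Subgroup (SLR n)} [DiscreteTopology Λ] {μ : Measure (SLR n ⧸ Λ)}
  [IsProbabilityMeasure μ] [SMulInvariantMeasure (SLR n) (SLR n ⧸ Λ) μ]
  {φ : SLR n ⧸ Λ → SLR n ⧸ Λ}

theorem measure_eq_zero_or_compl_of_isUnipotent (hn : 2 ≤ n) {u : SLR n} (hu : IsUnipotent n u)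
    (hu1 : u ≠ 1) {s : Set (SLR n ⧸ Λ)} (hs : MeasurableSet s)
    (hus : ∀ᵐ x ∂μ, (u • x ∈ s ↔ x ∈ s)) : μ s = 0 ∨ μ sᶜ = 0 :=
  measure_eq_zero_or_compl_of_smul_invariant
    (fun d h1 hmul hinv hd hdu => eq_zero_of_isUnipotent hn hu hu1 d h1 hmul hinv hd hdu) hs hus

theorem exists_intertwines_of_shear (hn : 2 ≤ n) (hφ : Measurable φ) {u w : SLR n}
    (hu : IsUnipotent n u) (hu1 : u ≠ 1) (hw : IsUnipotent n w) (H : Intertwines μ φ u w) :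
    ∃ V ∈ 𝓝 (1 : SLR n), ∀ (g : ℕ → SLR n) (g₀ : SLR n), Tendsto g atTop (𝓝 1) →
      (∀ k, ∀ m ≤ k, u ^ m * g k * (u ^ m)⁻¹ ∈ V) →
      Tendsto (fun k => u ^ k * g k * (u ^ k)⁻¹) atTop (𝓝 g₀) → g₀ * u = u * g₀ →
      ∃ h, IsUnipotent n h ∧ Intertwines μ φ g₀ h := by
  obtain ⟨V, hV, hshadow⟩ := exists_shadow hφ H hw (ε := 4⁻¹) (by simp) one_pos
  refine ⟨V, hV, fun g g₀ hg hgV hlim hcomm => ?_⟩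
  have hsub : ∀ j : ℕ, ∃ k, j ≤ k ∧ ∃ E : Set (SLR n ⧸ Λ), μ Eᶜ ≤ 4⁻¹ ∧
      ∀ x ∈ E, ∃ h : SLR n, φ (g k • x) = h • φ x ∧ ‖(h : Mat) - 1‖ < 1 / ((j : ℝ) + 1) ∧
        ∀ m ≤ k, ‖((w ^ m * h * (w ^ m)⁻¹ : SLR n) : Mat) - 1‖ < 1 := by
    intro j
    obtain ⟨k, hk, hjk⟩ := ((hg.eventually (hshadow (1 / ((j : ℝ) + 1)) (by positivity))).and
      (eventually_ge_atTop j)).exists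
    exact ⟨k, hjk, hk k (hgV k)⟩
  choose k hjk E hE hEh using hsub
  have hk : Tendsto k atTop atTop := tendsto_atTop_mono hjk tendsto_id
  have hpow : ∀ᵐ x ∂μ, ∀ m : ℕ, φ (u ^ m • x) = w ^ m • φ x := ae_all_iff.2 fun m => H.pow m
  set E' : ℕ → Set (SLR n ⧸ Λ) := fun j => {x | x ∈ E j ∧ (∀ m : ℕ, φ (u ^ m • x) = w ^ m • φ x) ∧
    ∀ m : ℕ, φ (u ^ m • g (k j) • x) = w ^ m • φ (g (k j) • x)}
  have hE' : ∀ j, μ (E' j)ᶜ ≤ 4⁻¹ := by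
    intro j
    refine (measure_mono_ae ?_).trans (hE j)
    filter_upwards [hpow, ae_smul μ hpow (g (k j))] with x h1 h2 h3 h4
    exact h3 ⟨h4, h1, h2⟩
  set Q : Set (SLR n) := {h | ‖(h : Mat) - 1‖ ≤ 1 ∧ IsUnipotent n h ∧ h * w = w * h}
  have hQ : IsCompact Q := by
    refine (isCompact_norm_sub_one_le 1).of_isClosed_subset ?_ fun h hh => hh.1
    refine (isCompact_norm_sub_one_le 1).isClosed.inter (isClosed_isUnipotent.inter ?_)
    exact isClosed_eq (by fun_prop) (by fun_prop)
  have key := measure_compl_intertwined_le (μ := μ) hφ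
    (g := fun j => u ^ k j * g (k j) * (u ^ k j)⁻¹) (hlim.comp hk)
    (E := fun j => (fun x => (u ^ k j)⁻¹ • x) ⁻¹' E' j) (ε := 4⁻¹) (ε' := 2⁻¹) (fun j => ?_)
    (by rw [ENNReal.inv_lt_inv]; norm_num)
    (fun j h' => ∃ h : SLR n, h' = w ^ k j * h * (w ^ k j)⁻¹ ∧
      ‖(h : Mat) - 1‖ < 1 / ((j : ℝ) + 1) ∧
      ∀ m ≤ k j, ‖((w ^ m * h * (w ^ m)⁻¹ : SLR n) : Mat) - 1‖ < 1)
    (fun j x hx => ?_) (isCompact_norm_sub_one_le 1) (fun j h' hh' => ?_) Q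
    (fun i h' h₀ hi hP hlim' => ?_)
  · have hne : μ {x | ∃ c ∈ Q, φ (g₀ • x) = c • φ x} ≠ 0 := by
      intro h0
      have h1 : (1 : ℝ≥0∞) ≤ 0 + 2⁻¹ := by
        calc (1 : ℝ≥0∞) = μ univ := measure_univ.symm
          _ ≤ μ {x | ∃ c ∈ Q, φ (g₀ • x) = c • φ x} + μ {x | ∃ c ∈ Q, φ (g₀ • x) = c • φ x}ᶜ := by
            rw [← union_compl_self {x | ∃ c ∈ Q, φ (g₀ • x) = c • φ x}]
            exact measure_union_le _ _
          _ ≤ 0 + 2⁻¹ := by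
            rw [h0]
            gcongr
      rw [zero_add] at h1
      exact h1.not_gt (ENNReal.inv_lt_one.2 (by norm_num))
    obtain ⟨c, hc, hcφ⟩ := exists_ae_eq_smul (μ := μ) (ψ := fun x => φ (g₀ • x))
      (fun s hs hus => measure_eq_zero_or_compl_of_isUnipotent hn hu hu1 hs hus) hφ
      (hφ.comp (measurable_const_smul g₀)) H (by
        filter_upwards [ae_smul μ H g₀] with x hx
        simp only [smul_smul] at hx ⊢
        rw [hcomm, hx]) hQ (fun c hc => hc.2.2) hne
    exact ⟨c, hc.2.1, hcφ⟩
  · rw [← preimage_compl]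
    rw [measure_preimage_smul]
    exact hE' j
  · obtain ⟨h, hφh, hh, hhm⟩ := hEh j _ hx.1
    refine ⟨_, ⟨h, rfl, hh, hhm⟩, ?_⟩
    have h1 := hx.2.1 (k j)
    have h2 := hx.2.2 (k j)
    simp only [smul_smul] at h1 h2 hφh
    rw [mul_inv_cancel, one_smul] at h1
    simp only [mul_assoc]
    rw [h2, hφh, h1]
    simp only [smul_smul, mul_assoc, inv_mul_cancel, mul_one]
  · obtain ⟨h, rfl, -, hhm⟩ := hh'
    exact (hhm _ le_rfl).le
  · choose h hh hh1 hhm using hP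
    have h1 : Tendsto h atTop (𝓝 1) :=
      tendsto_one_of_norm_sub_one_le (fun j => (hh1 j).le)
        ((tendsto_one_div_add_atTop_nhds_zero_nat (𝕜 := ℝ)).comp hi.tendsto_atTop)
    have hcl := (isCompact_norm_sub_one_le (n := n) 1).isClosed
    have hbdd : ∀ m : ℕ, ‖((w⁻¹ ^ m * h₀ * (w⁻¹ ^ m)⁻¹ : SLR n) : Mat) - 1‖ ≤ 1 := by
      intro m
      have hc : Continuous fun x : SLR n => w⁻¹ ^ m * x * (w⁻¹ ^ m)⁻¹ := by fun_prop
      refine hcl.mem_of_tendsto ((hc.tendsto h₀).comp hlim') ?_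
      filter_upwards [(hk.comp hi.tendsto_atTop).eventually_ge_atTop m] with j hj
      have h2 := hhm j (k (i j) - m) (Nat.sub_le _ _)
      simp only [Function.comp_apply] at hj ⊢
      rw [hh j]
      have h3 : w⁻¹ ^ m * (w ^ k (i j) * h j * (w ^ k (i j))⁻¹) * (w⁻¹ ^ m)⁻¹ =
          w ^ (k (i j) - m) * h j * (w ^ (k (i j) - m))⁻¹ := by
        rw [pow_sub w hj]
        group
      rw [h3]
      exact h2.le
    refine ⟨by simpa using hbdd 0, IsUnipotent.of_tendsto_conj h1 (by rwa [funext hh] at hlim'), ?_⟩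
    have := Commute.of_bounded_conj hw.inv hbdd
    rw [inv_mul_eq_iff_eq_mul, ← mul_assoc] at this
    exact (eq_mul_inv_iff_mul_eq.1 this)

/-- The elements with a unipotent companion under `φ`. -/
theorem shearClosed_intertwines (hn : 2 ≤ n) (hφ : Measurable φ) :
    ShearClosed {g : SLR n | ∃ h, IsUnipotent n h ∧ Intertwines μ φ g h} := by
  refine ⟨?_, ?_⟩
  · rintro g ⟨h, hh, H⟩ k
    exact ⟨h ^ k, hh.pow k, H.pow k⟩
  · rintro u ⟨w, hw, H⟩ hu hu1
    obtain ⟨V, hV, h⟩ := exists_intertwines_of_shear hn hφ hu hu1 hw H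
    exact ⟨V, hV, h⟩

theorem coe_mem_range_scalar_of_eventually_commute {c : SLR n}
    (hc : ∀ᶠ g in 𝓝 (1 : SLR n), g * c = c * g) :
    (c : Mat) ∈ Set.range (Matrix.scalar (Fin n)) := by
  refine Matrix.mem_range_scalar_of_commute_single fun i j hij => ?_
  have h1 : Tendsto (fun k : ℕ => Matrix.SpecialLinearGroup.transvection hij (1 / ((k : ℝ) + 1)))
      atTop (𝓝 (1 : SLR n)) := by
    refine tendsto_one_of_norm_sub_one_le
      (b := fun k : ℕ => 1 / ((k : ℝ) + 1) * ‖(single i j 1 : Mat)‖) (fun k => ?_) ?_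
    · rw [Matrix.SpecialLinearGroup.transvection_coe, add_sub_cancel_left,
        show (single i j (1 / ((k : ℝ) + 1)) : Mat) = (1 / ((k : ℝ) + 1)) • single i j 1 by
          rw [smul_single, smul_eq_mul, mul_one], norm_smul, Real.norm_of_nonneg (by positivity)]
    · simpa using tendsto_one_div_add_atTop_nhds_zero_nat.mul_const ‖(single i j 1 : Mat)‖
  obtain ⟨k, hk⟩ := (h1.eventually hc).exists
  have h2 := congrArg (fun g : SLR n => (g : Mat)) hk
  simp only [Matrix.SpecialLinearGroup.coe_mul, Matrix.SpecialLinearGroup.transvection_coe,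
    add_mul, mul_add, one_mul, mul_one, add_right_inj] at h2
  have h3 : (single i j (1 / ((k : ℝ) + 1)) : Mat) = (1 / ((k : ℝ) + 1)) • single i j 1 := by
    rw [smul_single, smul_eq_mul, mul_one]
  rw [h3, smul_mul_assoc, mul_smul_comm] at h2
  exact smul_right_injective _ (by positivity : (1 / ((k : ℝ) + 1)) ≠ 0) h2

theorem Intertwines.unique (hn : 2 ≤ n) (hφ : Measurable φ) (hmp : Measure.map φ μ = μ)
    {g h h' : SLR n} (H : Intertwines μ φ g h) (H' : Intertwines μ φ g h')
    (hh : IsUnipotent n h) (hh' : IsUnipotent n h') : h = h' := by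
  have H1 : Intertwines μ φ 1 (h⁻¹ * h') := by simpa using H.inv.mul H'
  obtain ⟨c, hc⟩ := coe_mem_range_scalar_of_eventually_commute (H1.eventually_commute hφ hmp)
  have h1 : (h' : Mat) = c • (h : Mat) := by
    have h2 : (h' : Mat) = (h : Mat) * ((h⁻¹ * h' : SLR n) : Mat) := by
      rw [← Matrix.SpecialLinearGroup.coe_mul, mul_inv_cancel_left]
    have h3 : Matrix.scalar (Fin n) c = c • (1 : Mat) := by
      rw [Matrix.scalar_apply, smul_one_eq_diagonal]
    rw [h2, ← hc, h3, mul_smul_comm, mul_one]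
  have h2 := congrArg Matrix.trace h1
  rw [Matrix.trace_smul, hh.trace, hh'.trace] at h2
  have hn0 : (n : ℝ) ≠ 0 := by positivity
  have h3 : c = 1 := by
    rw [smul_eq_mul] at h2
    exact (mul_eq_right₀ hn0).1 h2.symm
  rw [h3, one_smul] at h1
  exact Subtype.ext h1.symm

end Shear

section Classification

variable {n : ℕ}

local notation "Mat" => Matrix (Fin n) (Fin n) ℝ

/-- The relations satisfied by the images of the elementary matrices `single i j 1`. -/
structure ElementaryRelations (Y : Fin n → Fin n → Matrix (Fin n) (Fin n) ℝ) : Prop where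
  ne_zero : ∀ {i j}, i ≠ j → Y i j ≠ 0
  sq : ∀ {i j}, i ≠ j → Y i j * Y i j = 0
  bracket : ∀ {i j k}, i ≠ j → j ≠ k → i ≠ k → Y i j * Y j k - Y j k * Y i j = Y i k
  mul_eq_zero_or : ∀ {i j k}, i ≠ j → j ≠ k → i ≠ k → Y i j * Y j k = 0 ∨ Y j k * Y i j = 0
  row : ∀ {i j k}, i ≠ j → j ≠ k → i ≠ k → Y i j * Y i k = 0
  col : ∀ {i j k}, i ≠ j → j ≠ k → i ≠ k → Y i k * Y j k = 0
  comm : ∀ {i j k l}, i ≠ j → k ≠ l → i ≠ l → j ≠ k → Y i j * Y k l = Y k l * Y i j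

/-- The three matrices `Y i j`, `Y j k`, `Y i k` multiply like elementary matrices. -/
def DirectTriple (Y : Fin n → Fin n → Matrix (Fin n) (Fin n) ℝ) (i j k : Fin n) : Prop :=
  Y i j * Y j k = Y i k ∧ Y j k * Y i j = 0

namespace ElementaryRelations

variable {Y : Fin n → Fin n → Matrix (Fin n) (Fin n) ℝ}

theorem direct_or (h : ElementaryRelations Y) {i j k : Fin n} (hij : i ≠ j) (hjk : j ≠ k)
    (hik : i ≠ k) :
    DirectTriple Y i j k ∨ Y i j * Y j k = 0 ∧ Y i k = -(Y j k * Y i j) := by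
  have h1 := h.bracket hij hjk hik
  rcases h.mul_eq_zero_or hij hjk hik with h2 | h2
  · exact Or.inr ⟨h2, by rw [← h1, h2, zero_sub]⟩
  · exact Or.inl ⟨by rw [← h1, h2, sub_zero], h2⟩

theorem direct_swap_right (h : ElementaryRelations Y) {i j k : Fin n} (hij : i ≠ j) (hjk : j ≠ k)
    (hik : i ≠ k)
    (hd : DirectTriple Y i j k) : DirectTriple Y i k j := by
  refine (h.direct_or hik hjk.symm hij).resolve_right fun ht => h.ne_zero hik ?_
  rw [← hd.1, ht.2, neg_mul, mul_assoc, h.col hij hjk hik, mul_zero, neg_zero]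

theorem direct_swap_left (h : ElementaryRelations Y) {i j k : Fin n} (hij : i ≠ j) (hjk : j ≠ k)
    (hik : i ≠ k)
    (hd : DirectTriple Y i j k) : DirectTriple Y j i k := by
  refine (h.direct_or hij.symm hik hjk).resolve_right fun ht => h.ne_zero hik ?_
  rw [← hd.1, ht.2, mul_neg, ← mul_assoc, h.row hij hjk hik, zero_mul, neg_zero]

theorem direct_replace (h : ElementaryRelations Y) {i j k l : Fin n} (hij : i ≠ j) (hjk : j ≠ k)
    (hik : i ≠ k)
    (hil : i ≠ l) (hjl : j ≠ l) (hd : DirectTriple Y i j k) : DirectTriple Y i j l := by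
  rcases eq_or_ne k l with rfl | hkl
  · exact hd
  by_contra hnd
  have hnd' : ¬ DirectTriple Y i l j := fun h' => hnd (h.direct_swap_right hil hjl.symm hij h')
  have h1 := (h.direct_or hil hjl.symm hij).resolve_left hnd'
  rcases h.direct_or hik hkl hil with h2 | h2
  · have h3 : Y i l * (Y j k * Y k l) = 0 := by
      rcases h.direct_or hjk hkl hjl with h4 | h4
      · rw [h4.1, h.col hij hjl hil]
      · rw [h4.1, mul_zero]
    have h5 : Y i l = Y i j * (Y j k * Y k l) := by
      rw [← mul_assoc, hd.1, h2.1]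
    refine h.ne_zero hil ?_
    rw [h5, h1.2, neg_mul, mul_assoc, h3, mul_zero, neg_zero]
  · refine h.ne_zero hik ?_
    rw [← hd.1, h1.2, h2.2, neg_mul, mul_neg, neg_mul, neg_neg, mul_assoc, mul_assoc,
      h.col hij hjk hik, mul_zero, mul_zero]

theorem direct_of_direct (h : ElementaryRelations Y) {i j k x y z : Fin n} (hij : i ≠ j)
    (hjk : j ≠ k) (hik : i ≠ k)
    (hd : DirectTriple Y i j k) (hxy : x ≠ y) (hyz : y ≠ z) (hxz : x ≠ z) :
    DirectTriple Y x y z := by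
  obtain ⟨p, q, hxp, hpq, hxq, h1⟩ : ∃ p q, x ≠ p ∧ p ≠ q ∧ x ≠ q ∧ DirectTriple Y x p q := by
    rcases eq_or_ne x i with rfl | hxi
    · exact ⟨j, k, hij, hjk, hik, hd⟩
    rcases eq_or_ne x j with rfl | hxj
    · exact ⟨i, k, hij.symm, hik, hjk, h.direct_swap_left hij hjk hik hd⟩
    · exact ⟨i, j, hxi, hij, hxj, h.direct_swap_left hxi.symm hxj hij
        (h.direct_swap_right hij hxj.symm hxi.symm
          (h.direct_replace hij hjk hik hxi.symm hxj.symm hd))⟩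
  obtain ⟨r, hyr, hxr, h2⟩ : ∃ r, y ≠ r ∧ x ≠ r ∧ DirectTriple Y x y r := by
    rcases eq_or_ne y p with rfl | hyp
    · exact ⟨q, hpq, hxq, h1⟩
    · exact ⟨p, hyp, hxp, h.direct_swap_right hxp hyp.symm hxy
        (h.direct_replace hxp hpq hxq hxy hyp.symm h1)⟩
  exact h.direct_replace hxy hyr hxr hxz hyz h2

theorem neg_transpose (h : ElementaryRelations Y) : ElementaryRelations fun i j => -(Y i j)ᵀ where
  ne_zero hij := by simpa using h.ne_zero hij
  sq hij := by
    rw [neg_mul_neg, ← transpose_mul, h.sq hij, transpose_zero]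
  bracket hij hjk hik := by
    rw [neg_mul_neg, neg_mul_neg, ← transpose_mul, ← transpose_mul, ← transpose_sub,
      ← h.bracket hij hjk hik, ← transpose_neg, neg_sub]
  mul_eq_zero_or hij hjk hik := by
    simp only [neg_mul_neg, ← transpose_mul, transpose_eq_zero]
    exact (h.mul_eq_zero_or hij hjk hik).symm
  row hij hjk hik := by
    rw [neg_mul_neg, ← transpose_mul, h.row hik hjk.symm hij, transpose_zero]
  col hij hjk hik := by
    rw [neg_mul_neg, ← transpose_mul, h.col hij.symm hik hjk, transpose_zero]
  comm hij hkl hil hjk := by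
    rw [neg_mul_neg, neg_mul_neg, ← transpose_mul, ← transpose_mul, h.comm hij hkl hil hjk]

theorem exists_mul_eq_mul_single (h : ElementaryRelations Y) (hn : 3 ≤ n)
    (hd : ∀ {i j k}, i ≠ j → j ≠ k → i ≠ k → DirectTriple Y i j k) :
    ∃ P : Mat, IsUnit P.det ∧ ∀ i j, i ≠ j → Y i j * P = P * single i j 1 := by
  have third : ∀ i j : Fin n, ∃ k, k ≠ i ∧ k ≠ j := by
    intro i j
    have hc : ({i, j} : Finset (Fin n)).card < Fintype.card (Fin n) := by
      rw [Fintype.card_fin]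
      exact Finset.card_le_two.trans_lt (by omega)
    obtain ⟨k, hk⟩ := Finset.exists_mem_notMem_of_card_lt_card
      (s := {i, j}) (t := Finset.univ) (by simpa using hc)
    exact ⟨k, by simpa using hk.2⟩
  let o : Fin n := ⟨0, by omega⟩
  obtain ⟨k₀, hk₀, -⟩ := third o o
  obtain ⟨w, hw⟩ : ∃ w, Y o k₀ *ᵥ w ≠ 0 := by
    by_contra! hc
    exact h.ne_zero hk₀.symm (ext_of_mulVec_single fun i => by rw [hc, zero_mulVec])
  let p : Fin n → Fin n → ℝ := fun i => if i = o then Y o k₀ *ᵥ w else Y i o *ᵥ (Y o k₀ *ᵥ w)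
  have hpo : p o = Y o k₀ *ᵥ w := if_pos rfl
  have hpi : ∀ i, i ≠ o → p i = Y i o *ᵥ p o := fun i hi => by rw [hpo]; exact if_neg hi
  have hrange : ∀ i m, i ≠ m → ∃ v, p i = Y i m *ᵥ v := by
    intro i m him
    rcases eq_or_ne i o with rfl | hi
    · rcases eq_or_ne m k₀ with rfl | hm
      · exact ⟨w, hpo⟩
      · exact ⟨Y m k₀ *ᵥ w, by rw [mulVec_mulVec, (hd him hm hk₀.symm).1, hpo]⟩
    · rcases eq_or_ne m o with rfl | hm
      · exact ⟨_, hpi i hi⟩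
      · exact ⟨Y m o *ᵥ p o, by rw [mulVec_mulVec, (hd him hm hi).1, hpi i hi]⟩
  have hzero : ∀ i j k, i ≠ j → k ≠ j → Y i j *ᵥ p k = 0 := by
    intro i j k hij hkj
    rcases eq_or_ne k i with rfl | hki
    · obtain ⟨m, hmi, hmj⟩ := third k j
      obtain ⟨v, hv⟩ := hrange k m hmi.symm
      rw [hv, mulVec_mulVec, h.row hij hmj.symm hmi.symm, zero_mulVec]
    · obtain ⟨v, hv⟩ := hrange k i hki
      rw [hv, mulVec_mulVec, (hd hki hij hkj).2, zero_mulVec]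
  have hmap : ∀ i j, i ≠ j → Y i j *ᵥ p j = p i := by
    intro i j hij
    rcases eq_or_ne j o with rfl | hj
    · exact (hpi i hij).symm
    rcases eq_or_ne i o with rfl | hi
    · obtain ⟨m, hmi, hmj⟩ := third o j
      obtain ⟨v, hv⟩ := hrange o m hmi.symm
      rw [hpi j hj, hv, mulVec_mulVec, mulVec_mulVec, mul_assoc, (hd hj hmi.symm hmj.symm).1,
        (hd hij hmj.symm hmi.symm).1]
    · rw [hpi j hj, mulVec_mulVec, (hd hij hj hi).1, hpi i hi]
  have hp0 : ∀ i, p i ≠ 0 := by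
    intro i hi
    rcases eq_or_ne i o with rfl | hio
    · exact hw (by rw [← hpo, hi])
    · refine hw ?_
      rw [← hpo, ← hmap o i hio.symm, hi, mulVec_zero]
  let P : Mat := Matrix.of fun a b => p b a
  have hcol : ∀ j, P *ᵥ Pi.single j 1 = p j := by
    intro j
    ext a
    simp [P]
  have hP : ∀ i j, i ≠ j → Y i j * P = P * single i j 1 := by
    intro i j hij
    refine ext_of_mulVec_single fun k => ?_
    rw [← mulVec_mulVec, ← mulVec_mulVec, hcol]
    rcases eq_or_ne k j with rfl | hkj
    · have : (single i k 1 : Mat) *ᵥ Pi.single k 1 = Pi.single i 1 := by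
        ext a
        simp [single_apply, Pi.single_apply, eq_comm]
      rw [this, hcol, hmap i k hij]
    · have : (single i j 1 : Mat) *ᵥ Pi.single k 1 = 0 := by
        ext a
        simp [hkj.symm]
      rw [this, mulVec_zero, hzero i j k hij hkj]
  refine ⟨P, ?_, hP⟩
  rw [isUnit_iff_ne_zero]
  intro hdet
  obtain ⟨x, hx, hPx⟩ := exists_mulVec_eq_zero_iff.2 hdet
  refine hx (funext fun j => ?_)
  obtain ⟨i, hij, -⟩ := third j j
  have h1 : Y i j *ᵥ (P *ᵥ x) = x j • p i := by
    rw [mulVec_mulVec, hP i j hij, ← mulVec_mulVec, ← hcol i, ← mulVec_smul]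
    congr 1
    ext a
    simp [Pi.single_apply, single_mulVec, Function.update_apply, eq_comm]
  rw [hPx, mulVec_zero] at h1
  exact (smul_eq_zero.1 h1.symm).resolve_right (hp0 i)

/-- Matrices satisfying the elementary relations are the images of the elementary matrices under
an automorphism of `SL(n,ℝ)`. -/
theorem exists_conj (h : ElementaryRelations Y) (hn : 3 ≤ n) : ∃ P : Mat, IsUnit P.det ∧
    ((∀ i j, i ≠ j → Y i j * P = P * single i j 1) ∨
      ∀ i j, i ≠ j → Y i j * P = P * -(single i j 1)ᵀ) := by
  let i : Fin n := ⟨0, by omega⟩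
  let j : Fin n := ⟨1, by omega⟩
  let k : Fin n := ⟨2, by omega⟩
  have hij : i ≠ j := by simp [i, j]
  have hjk : j ≠ k := by simp [j, k]
  have hik : i ≠ k := by simp [i, k]
  rcases h.direct_or hij hjk hik with hd | hd
  · obtain ⟨P, hP, hPY⟩ := h.exists_mul_eq_mul_single hn
      fun hxy hyz hxz => h.direct_of_direct hij hjk hik hd hxy hyz hxz
    exact ⟨P, hP, Or.inl hPY⟩
  · have hd' : DirectTriple (fun i j => -(Y i j)ᵀ) i j k := by
      constructor
      · simp only [neg_mul_neg, ← transpose_mul, hd.2, transpose_neg, neg_neg]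
      · simp only [neg_mul_neg, ← transpose_mul, hd.1, transpose_zero]
    obtain ⟨P, hP, hPY⟩ := h.neg_transpose.exists_mul_eq_mul_single hn
      fun hxy hyz hxz => h.neg_transpose.direct_of_direct hij hjk hik hd' hxy hyz hxz
    refine ⟨P⁻¹ᵀ, ?_, Or.inr fun i j hij => ?_⟩
    · rw [det_transpose]
      exact isUnit_nonsing_inv_det _ hP
    · have h1 := hPY i j hij
      have h2 : P⁻¹ * (-(Y i j)ᵀ) = single i j 1 * P⁻¹ := by
        rw [← mul_nonsing_inv_cancel_right P (-(Y i j)ᵀ) hP, h1, mul_assoc,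
          nonsing_inv_mul_cancel_left _ _ hP]
      have h3 := congrArg transpose h2
      rw [transpose_mul, transpose_mul, transpose_neg, transpose_transpose, neg_mul] at h3
      rw [mul_neg, ← h3, neg_neg]

end ElementaryRelations

end Classification

section Mates

open Set Filter Topology
open scoped Matrix.Norms.Operator Nat

variable {n : ℕ}

local notation "Mat" => Matrix (Fin n) (Fin n) ℝ

theorem IsUnipotent.eq_of_pow_eq {u v : SLR n} (hu : IsUnipotent n u) (hv : IsUnipotent n v)
    {k : ℕ} (hk : k ≠ 0) (h : u ^ k = v ^ k) : u = v := by
  have key : ∀ w : SLR n, IsUnipotent n w → w ^ k = v ^ k →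
      (w : Mat) = unipotentPow (((v ^ k : SLR n) : Mat) - 1) (k : ℝ)⁻¹ := by
    intro w hw hwk
    rw [← eq_unipotentPow_inv_of_pow_eq (M := (w : Mat) - 1) (hv.pow k) hw hk, add_sub_cancel]
    rw [add_sub_cancel, add_sub_cancel, ← hwk, Matrix.SpecialLinearGroup.coe_pow]
  exact Subtype.ext ((key u hu h).trans (key v hv rfl).symm)

/-- A closed subgroup of pairs in which unipotent partners are unique. -/
structure MateRelation (R : SLR n → SLR n → Prop) : Prop where
  one : R 1 1
  mul : ∀ {g h g' h'}, R g h → R g' h' → R (g * g') (h * h')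
  inv : ∀ {g h}, R g h → R g⁻¹ h⁻¹
  closed : ∀ {g h : ℕ → SLR n} {g₀ h₀ : SLR n}, Tendsto g atTop (𝓝 g₀) → Tendsto h atTop (𝓝 h₀) →
    (∀ k, R (g k) (h k)) → R g₀ h₀
  right_unique : ∀ {g h h'}, R g h → R g h' → IsUnipotent n h → IsUnipotent n h' → h = h'
  left_unique : ∀ {g g' h}, R g h → R g' h → IsUnipotent n g → IsUnipotent n g' → g = g'

namespace MateRelation

variable {R : SLR n → SLR n → Prop}

theorem pow (hR : MateRelation R) {g h : SLR n} (H : R g h) (k : ℕ) : R (g ^ k) (h ^ k) := by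
  induction k with
  | zero => simpa using hR.one
  | succ k ih => rw [pow_succ, pow_succ]; exact hR.mul ih H

theorem conj (hR : MateRelation R) {g h g' h' : SLR n} (H : R g h) (H' : R g' h') :
    R (g * g' * g⁻¹) (h * h' * h⁻¹) := hR.mul (hR.mul H H') (hR.inv H)

theorem exists_of_tendsto_coe (hR : MateRelation R) {g h : ℕ → SLR n} {A B : Mat}
    (hA : Tendsto (fun k => (g k : Mat)) atTop (𝓝 A))
    (hB : Tendsto (fun k => (h k : Mat)) atTop (𝓝 B)) (H : ∀ k, R (g k) (h k))
    (hh : ∀ k, IsUnipotent n (h k)) :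
    ∃ g₀ h₀ : SLR n, (g₀ : Mat) = A ∧ (h₀ : Mat) = B ∧ IsUnipotent n h₀ ∧ R g₀ h₀ := by
  have hc := (isClosedEmbedding_coe_SLR n).isClosed_range
  obtain ⟨g₀, rfl⟩ := hc.mem_of_tendsto hA (Eventually.of_forall fun k => mem_range_self _)
  obtain ⟨h₀, rfl⟩ := hc.mem_of_tendsto hB (Eventually.of_forall fun k => mem_range_self _)
  exact ⟨g₀, h₀, rfl, rfl, isClosed_isUnipotent.mem_of_tendsto (tendsto_SLR_iff.2 hB)
    (Eventually.of_forall hh), hR.closed (tendsto_SLR_iff.2 hA) (tendsto_SLR_iff.2 hB) H⟩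

/-- If `1 + N` is a partner of a shear and roots of this shear have partners, then the
corresponding one-parameter groups are partners. -/
theorem exists_smul (hR : MateRelation R) {a b : Fin n → ℝ} (hab : b ⬝ᵥ a = 0) {N : Mat}
    (hN : N * N = 0) {q : SLR n} (hq : (q : Mat) = 1 + N) (H : R (shear a b) q)
    (hroot : ∀ k : ℕ, k ≠ 0 → ∃ h, IsUnipotent n h ∧ R (shear ((k : ℝ)⁻¹ • a) b) h) (t : ℝ) :
    ∃ h : SLR n, (h : Mat) = 1 + t • N ∧ IsUnipotent n h ∧ R (shear (t • a) b) h := by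
  have hab' : ∀ t : ℝ, b ⬝ᵥ (t • a) = 0 := fun t => by rw [dotProduct_smul, hab, smul_zero]
  have hNt : ∀ t : ℝ, (t • N) * (t • N) = 0 := fun t => by rw [smul_mul_smul_comm, hN, smul_zero]
  have hNn : ∀ t : ℝ, IsNilpotent (t • N) := fun t => ⟨2, by rw [pow_two, hNt]⟩
  have hshear : ∀ (t : ℝ) (m : ℕ), shear (t • a) b ^ m = shear ((m * t) • a) b := by
    intro t m
    refine eq_shear (hab' _) ?_
    rw [coe_shear_pow (hab' t), smul_vecMulVec, smul_vecMulVec, smul_smul]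
  have hone : ∀ (t : ℝ) (m : ℕ), oneAdd (t • N) (hNn t) ^ m = oneAdd ((m * t) • N) (hNn _) := by
    intro t m
    refine Subtype.ext ?_
    rw [coe_pow_of_sq_eq_zero (hNt t) (coe_oneAdd _ _), coe_oneAdd, smul_smul]
  have h1 : ∀ k : ℕ, k ≠ 0 → R (shear ((k : ℝ)⁻¹ • a) b) (oneAdd ((k : ℝ)⁻¹ • N) (hNn _)) := by
    intro k hk
    obtain ⟨h, hh, hRh⟩ := hroot k hk
    have hk' : (k : ℝ) * (k : ℝ)⁻¹ = 1 := mul_inv_cancel₀ (by exact_mod_cast hk)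
    have h2 := hR.pow hRh k
    rw [hshear, hk', one_smul] at h2
    have h3 : h ^ k = q := hR.right_unique h2 H (hh.pow k)
      (isUnipotent_iff.2 ⟨2, by rw [hq, add_sub_cancel_left, pow_two, hN]⟩)
    have h4 : h = oneAdd ((k : ℝ)⁻¹ • N) (hNn _) := by
      refine hh.eq_of_pow_eq (isUnipotent_oneAdd _ _) hk ?_
      rw [h3, hone]
      refine Subtype.ext ?_
      rw [hq, coe_oneAdd, hk', one_smul]
    rwa [← h4]
  have h2 : ∀ r : ℚ, R (shear ((r : ℝ) • a) b) (oneAdd ((r : ℝ) • N) (hNn _)) := by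
    have hpos : ∀ m k : ℕ, k ≠ 0 → R (shear (((m : ℝ) * (k : ℝ)⁻¹) • a) b)
        (oneAdd (((m : ℝ) * (k : ℝ)⁻¹) • N) (hNn _)) := by
      intro m k hk
      rw [← hshear, ← hone]
      exact hR.pow (h1 k hk) m
    have hneg : ∀ t : ℝ, R (shear (t • a) b) (oneAdd (t • N) (hNn _)) →
        R (shear ((-t) • a) b) (oneAdd ((-t) • N) (hNn _)) := by
      intro t ht
      have e1 : shear ((-t) • a) b = (shear (t • a) b)⁻¹ := by
        refine (eq_shear (hab' _) ?_).symm
        rw [coe_inv_of_sq_eq_zero (vecMulVec_sq (hab' t)) (coe_shear (hab' t)), neg_smul,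
          neg_vecMulVec, sub_eq_add_neg]
      have e2 : oneAdd ((-t) • N) (hNn _) = (oneAdd (t • N) (hNn _))⁻¹ := by
        refine Subtype.ext ?_
        rw [coe_inv_of_sq_eq_zero (hNt t) (coe_oneAdd _ _), coe_oneAdd, neg_smul, sub_eq_add_neg]
      rw [e1, e2]
      exact hR.inv ht
    intro r
    have hr : (r : ℝ) = (r.num : ℝ) * (r.den : ℝ)⁻¹ := by
      rw [← div_eq_mul_inv]; exact Rat.cast_def r
    rcases Int.eq_nat_or_neg r.num with ⟨m, hm | hm⟩
    · have := hpos m r.den r.den_ne_zero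
      rw [hm, Int.cast_natCast] at hr
      rwa [← hr] at this
    · have := hneg _ (hpos m r.den r.den_ne_zero)
      rw [hm, Int.cast_neg, Int.cast_natCast, neg_mul] at hr
      rwa [← hr] at this
  obtain ⟨r, hr, hrt⟩ := mem_closure_iff_seq_limit.1 (Rat.denseRange_cast (𝕜 := ℝ) t)
  choose r' hr' using hr
  refine ⟨oneAdd (t • N) (hNn t), coe_oneAdd _ _, isUnipotent_oneAdd _ _, ?_⟩
  refine hR.closed (g := fun k => shear (r k • a) b) (h := fun k => oneAdd (r k • N) (hNn _))
    ?_ ?_ fun k => ?_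
  · rw [tendsto_SLR_iff]
    simp only [coe_shear (hab' _), smul_vecMulVec]
    exact (hrt.smul_const _).const_add 1
  · rw [tendsto_SLR_iff]
    simp only [coe_oneAdd]
    exact (hrt.smul_const _).const_add 1
  · have := h2 (r' k)
    rwa [hr' k] at this

theorem exists_vecMulVec_ne_zero {N : Mat} {p : ℕ} (hp1 : 1 ≤ p) (hp : N ^ p ≠ 0)
    (hp' : N ^ (p + 1) = 0) :
    ∃ c d : Fin n → ℝ, d ⬝ᵥ c = 0 ∧ N ^ p * vecMulVec c d * N ^ p ≠ 0 := by
  obtain ⟨c, hc⟩ : ∃ c, N ^ p *ᵥ c ≠ 0 := by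
    by_contra! hc
    exact hp (ext_of_mulVec_single fun i => by rw [hc, zero_mulVec])
  set e := N ^ p *ᵥ c with he
  have hNe : N ^ p *ᵥ e = 0 := by
    rw [he, mulVec_mulVec, ← pow_add, pow_eq_zero_of_le (by omega) hp', zero_mulVec]
  have hc0 : c ⬝ᵥ c ≠ 0 := fun h => hc (by rw [he, dotProduct_self_eq_zero.1 h, mulVec_zero])
  obtain ⟨d, hd⟩ : ∃ d, d = (c ⬝ᵥ c) • e - (e ⬝ᵥ c) • c := ⟨_, rfl⟩
  have hdc : d ⬝ᵥ c = 0 := by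
    rw [hd, sub_dotProduct, smul_dotProduct, smul_dotProduct, smul_eq_mul, smul_eq_mul]
    ring
  have hd0 : d ≠ 0 := by
    intro h0
    have h1 : N ^ p *ᵥ d = -((e ⬝ᵥ c) • e) := by
      rw [hd, mulVec_sub, mulVec_smul, mulVec_smul, hNe, ← he, smul_zero, zero_sub]
    rw [h0, mulVec_zero, eq_comm, neg_eq_zero, smul_eq_zero, or_iff_left hc] at h1
    rw [h1, zero_smul, sub_zero, h0, eq_comm, smul_eq_zero, or_iff_right hc0] at hd
    exact hc hd
  have hde : d ⬝ᵥ e ≠ 0 := by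
    intro h0
    refine hd0 (dotProduct_self_eq_zero.1 ?_)
    nth_rw 2 [hd]
    rw [dotProduct_sub, dotProduct_smul, dotProduct_smul, h0, hdc, smul_zero, smul_zero, sub_zero]
  refine ⟨c, d, hdc, ?_⟩
  rw [mulVec_vecMulVec_vecMul]
  refine vecMulVec_ne_zero hc fun h0 => hde ?_
  rw [he, dotProduct_mulVec, h0, zero_dotProduct]

/-- If all shears have unipotent partners on both sides, then the partner of a shear is a
shear. -/
theorem exists_shear (hR : MateRelation R)
    (hr : ∀ a b : Fin n → ℝ, b ⬝ᵥ a = 0 → ∃ h, IsUnipotent n h ∧ R (shear a b) h)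
    (hl : ∀ a b : Fin n → ℝ, b ⬝ᵥ a = 0 → ∃ g, IsUnipotent n g ∧ R g (shear a b))
    {a b : Fin n → ℝ} (hab : b ⬝ᵥ a = 0) (ha : a ≠ 0) (hb : b ≠ 0) :
    ∃ α β : Fin n → ℝ, vecMulVec α β ≠ 0 ∧ β ⬝ᵥ α = 0 ∧
      ∀ t : ℝ, R (shear (t • a) b) (shear (t • α) β) := by
  obtain ⟨q, hqu, hq⟩ := hr a b hab
  obtain ⟨N, hN⟩ : ∃ N, (q : Mat) = 1 + N := ⟨q - 1, (add_sub_cancel _ _).symm⟩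
  have hNn : IsNilpotent N := by
    have := isUnipotent_iff.1 hqu
    rwa [hN, add_sub_cancel_left] at this
  have hN0 : N ≠ 0 := by
    rintro rfl
    have h1 : q = 1 := Subtype.ext (by rw [hN, add_zero, Matrix.SpecialLinearGroup.coe_one])
    rw [h1] at hq
    exact shear_ne_one hab ha hb
      (hR.left_unique hq hR.one (isUnipotent_shear a b) IsUnipotent.one)
  obtain ⟨p, hp1, hp, hp'⟩ := exists_pow_ne_zero_pow_succ_eq_zero hNn hN0
  obtain ⟨c, d, hdc, hne⟩ := exists_vecMulVec_ne_zero hp1 hp hp'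
  have hdc' : ∀ t : ℝ, d ⬝ᵥ (t • c) = 0 := fun t => by rw [dotProduct_smul, hdc, smul_zero]
  choose g hgu hgR using fun k : ℕ => hl (((k : ℝ) ^ (2 * p))⁻¹ • c) d (hdc' _)
  obtain ⟨N', hN'⟩ : ∃ N', (g 1 : Mat) = 1 + N' := ⟨g 1 - 1, (add_sub_cancel _ _).symm⟩
  have hN'n : N' ^ n = 0 := by
    have := hgu 1
    rwa [IsUnipotent, hN', add_sub_cancel_left] at this
  have hgpow : ∀ k : ℕ, k ≠ 0 → (g k : Mat) = unipotentPow N' ((k : ℝ) ^ (2 * p))⁻¹ := by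
    intro k hk
    have hk2 : k ^ (2 * p) ≠ 0 := pow_ne_zero _ hk
    have hk3 : ((k : ℝ) ^ (2 * p)) ≠ 0 := pow_ne_zero _ (by exact_mod_cast hk)
    have h1 := hR.pow (hgR k) (k ^ (2 * p))
    have h2 : shear (((k : ℝ) ^ (2 * p))⁻¹ • c) d ^ (k ^ (2 * p)) =
        shear ((((1 : ℕ) : ℝ) ^ (2 * p))⁻¹ • c) d := by
      refine eq_shear (hdc' _) ?_
      rw [coe_shear_pow (hdc' _), smul_vecMulVec, smul_vecMulVec, smul_smul, Nat.cast_pow,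
        mul_inv_cancel₀ hk3, Nat.cast_one, one_pow, inv_one]
    rw [h2] at h1
    have h3 : g k ^ k ^ (2 * p) = g 1 := hR.left_unique h1 (hgR 1) ((hgu k).pow _) (hgu 1)
    have h4 := eq_unipotentPow_inv_of_pow_eq (N := N') (M := (g k : Mat) - 1) hN'n (hgu k) hk2 (by
      rw [add_sub_cancel, ← Matrix.SpecialLinearGroup.coe_pow, h3, hN'])
    rwa [add_sub_cancel, Nat.cast_pow] at h4
  obtain ⟨D, hD⟩ := exists_tendsto_smul_unipotentPow hN'n
  have hinv : Tendsto (fun k : ℕ => ((k : ℝ) ^ (2 * p))⁻¹) atTop (𝓝[≠] 0) := by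
    refine tendsto_nhdsWithin_iff.2 ⟨tendsto_inv_atTop_zero.comp
      ((tendsto_pow_atTop (by omega)).comp tendsto_natCast_atTop_atTop), ?_⟩
    filter_upwards [eventually_ne_atTop 0] with k hk
    exact inv_ne_zero (pow_ne_zero _ (by exact_mod_cast hk))
  have hDg : Tendsto (fun k : ℕ => (k : ℝ) ^ (2 * p) • ((g k : Mat) - 1)) atTop (𝓝 D) := by
    refine (hD.comp hinv).congr' ?_
    filter_upwards [eventually_ne_atTop 0] with k hk
    rw [Function.comp_apply, _root_.inv_inv, hgpow k hk]
  obtain ⟨-, hq1, hq2⟩ := conj_pow_asymptotics hN hp'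
  have hright : Tendsto (fun k : ℕ => ((q ^ k * shear (((k : ℝ) ^ (2 * p))⁻¹ • c) d * (q ^ k)⁻¹ :
      SLR n) : Mat)) atTop (𝓝 (1 + (((p ! : ℝ)⁻¹ * ((-1) ^ p * (p ! : ℝ)⁻¹)) •
        (N ^ p * vecMulVec c d * N ^ p)))) := by
    have h1 := ((hq1.mul_const (vecMulVec c d)).mul hq2).const_add 1
    rw [smul_mul_assoc, smul_mul_smul_comm] at h1
    refine h1.congr fun k => ?_
    rw [Matrix.SpecialLinearGroup.coe_mul, Matrix.SpecialLinearGroup.coe_mul, coe_shear (hdc' _),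
      mul_add, add_mul, mul_one, ← Matrix.SpecialLinearGroup.coe_mul (q ^ k), mul_inv_cancel,
      Matrix.SpecialLinearGroup.coe_one, smul_mul_assoc, smul_mul_smul_comm, smul_vecMulVec,
      mul_smul_comm, smul_mul_assoc, ← _root_.mul_inv_rev, ← pow_add, two_mul]
  have hZ : ((p ! : ℝ)⁻¹ * ((-1) ^ p * (p ! : ℝ)⁻¹)) • (N ^ p * vecMulVec c d * N ^ p) ≠ 0 := by
    refine smul_ne_zero ?_ hne
    have : (p ! : ℝ) ≠ 0 := by exact_mod_cast p.factorial_ne_zero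
    refine mul_ne_zero (inv_ne_zero this) (mul_ne_zero (pow_ne_zero _ (by norm_num))
      (inv_ne_zero this))
  obtain ⟨X, hX⟩ : ∃ X, X = vecMulVec a b := ⟨_, rfl⟩
  have hleft : ∀ ε : ℝ, Tendsto (fun k : ℕ => -((k : ℝ) ^ 2 * ((k : ℝ) ^ (2 * p))⁻¹)) atTop (𝓝 ε) →
      Tendsto (fun k : ℕ => ((shear a b ^ k * g k * (shear a b ^ k)⁻¹ : SLR n) : Mat)) atTop
        (𝓝 (1 + ε • (X * D * X))) := by
    intro ε hε
    have hK0 : Tendsto (fun k : ℕ => ((k : ℝ) ^ (2 * p))⁻¹) atTop (𝓝 0) :=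
      hinv.mono_right nhdsWithin_le_nhds
    have hK1 : Tendsto (fun k : ℕ => (k : ℝ) * ((k : ℝ) ^ (2 * p))⁻¹) atTop (𝓝 0) := by
      have h1 : Tendsto (fun k : ℕ => ((k : ℝ) ^ (2 * p - 1))⁻¹) atTop (𝓝 0) :=
        tendsto_inv_atTop_zero.comp
          ((tendsto_pow_atTop (by omega)).comp tendsto_natCast_atTop_atTop)
      refine h1.congr' ?_
      filter_upwards [eventually_ne_atTop 0] with k hk
      have hk' : (k : ℝ) ≠ 0 := by exact_mod_cast hk
      rw [show 2 * p = (2 * p - 1) + 1 by omega, pow_succ, _root_.mul_inv, add_tsub_cancel_right]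
      field_simp
    have h1 := ((((hK0.smul hDg).add (hK1.smul ((hDg.const_mul X).sub (hDg.mul_const X)))).add
      (hε.smul ((hDg.const_mul X).mul_const X))).const_add 1)
    rw [zero_smul, zero_smul, zero_add, zero_add] at h1
    refine h1.congr' ?_
    filter_upwards [eventually_ne_atTop 0] with k hk
    have hk3 : ((k : ℝ) ^ (2 * p)) ≠ 0 := pow_ne_zero _ (by exact_mod_cast hk)
    obtain ⟨M, hM⟩ : ∃ M, (g k : Mat) = 1 + M := ⟨g k - 1, (add_sub_cancel _ _).symm⟩
    rw [Matrix.SpecialLinearGroup.coe_mul, Matrix.SpecialLinearGroup.coe_mul, hM, mul_add,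
      add_mul, mul_one, ← Matrix.SpecialLinearGroup.coe_mul (shear a b ^ k), mul_inv_cancel,
      Matrix.SpecialLinearGroup.coe_one, coe_shear_pow hab, coe_shear_pow_inv hab, ← hX,
      add_sub_cancel_left]
    simp only [mul_smul_comm, smul_mul_assoc, ← smul_sub, smul_smul, mul_assoc,
      inv_mul_cancel₀ hk3, mul_one, one_smul, neg_mul, neg_smul]
    simp only [mul_sub, add_mul, one_mul, mul_one, smul_sub, smul_add, smul_mul_assoc,
        mul_smul_comm,
      smul_smul, pow_two]
    abel
  have hu : ∀ k : ℕ, IsUnipotent n (q ^ k * shear (((k : ℝ) ^ (2 * p))⁻¹ • c) d * (q ^ k)⁻¹) :=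
    fun k => (isUnipotent_shear _ _).conj _
  rcases hp1.eq_or_lt with rfl | hp2
  swap
  · exfalso
    have h1 : Tendsto (fun k : ℕ => -((k : ℝ) ^ 2 * ((k : ℝ) ^ (2 * p))⁻¹)) atTop (𝓝 0) := by
      have h1 : Tendsto (fun k : ℕ => -((k : ℝ) ^ (2 * p - 2))⁻¹) atTop (𝓝 (-0)) :=
        (tendsto_inv_atTop_zero.comp
          ((tendsto_pow_atTop (by omega)).comp tendsto_natCast_atTop_atTop)).neg
      rw [neg_zero] at h1
      refine h1.congr' ?_
      filter_upwards [eventually_ne_atTop 0] with k hk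
      have hk' : (k : ℝ) ≠ 0 := by exact_mod_cast hk
      rw [show 2 * p = (2 * p - 2) + 2 by omega, pow_add, _root_.mul_inv, add_tsub_cancel_right]
      field_simp
    obtain ⟨g₀, h₀, hg₀, hh₀, hh₀u, H⟩ := hR.exists_of_tendsto_coe (hleft 0 h1) hright
      (fun k => hR.conj (hR.pow hq k) (hgR k)) hu
    have hg1 : g₀ = 1 := Subtype.ext (by
      rw [hg₀, zero_smul, add_zero, Matrix.SpecialLinearGroup.coe_one])
    rw [hg1] at H
    have hh1 := hR.right_unique H hR.one hh₀u IsUnipotent.one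
    rw [hh1, Matrix.SpecialLinearGroup.coe_one, left_eq_add] at hh₀
    exact hZ hh₀
  have h1 : Tendsto (fun k : ℕ => -((k : ℝ) ^ 2 * ((k : ℝ) ^ (2 * 1))⁻¹)) atTop (𝓝 (-1)) := by
    refine tendsto_const_nhds.congr' ?_
    filter_upwards [eventually_ne_atTop 0] with k hk
    rw [mul_one, mul_inv_cancel₀ (pow_ne_zero _ (by exact_mod_cast hk))]
  obtain ⟨g₀, h₀, hg₀, hh₀, hh₀u, H⟩ := hR.exists_of_tendsto_coe (hleft (-1) h1) hright
    (fun k => hR.conj (hR.pow hq k) (hgR k)) hu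
  have hab' : ∀ t : ℝ, b ⬝ᵥ (t • a) = 0 := fun t => by rw [dotProduct_smul, hab, smul_zero]
  have hNN : N * N = 0 := by rw [← pow_two]; exact hp'
  have hscale := hR.exists_smul hab hNN hN hq fun k _ => hr _ b (hab' _)
  simp only [pow_one, Nat.factorial_one, Nat.cast_one, inv_one, one_mul, mul_one] at hh₀ hne
  obtain ⟨κ, hκ⟩ : ∃ κ, κ = b ⬝ᵥ (D *ᵥ a) := ⟨_, rfl⟩
  have hg₀' : g₀ = shear ((-κ) • a) b := by
    refine eq_shear (hab' _) ?_
    rw [hg₀, hX, mul_assoc, mul_vecMulVec, vecMulVec_mul_vecMulVec, smul_vecMulVec, ← hκ,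
      vecMulVec_smul, smul_smul, neg_one_mul]
  obtain ⟨h', hh', hh'u, H'⟩ := hscale (-κ)
  rw [hg₀'] at H
  have h2 := hR.right_unique H H' hh₀u hh'u
  rw [← h2, hh₀, add_right_inj, neg_smul, neg_smul, one_smul, neg_inj, mulVec_vecMulVec_vecMul]
    at hh'
  rw [mulVec_vecMulVec_vecMul] at hne
  have hκ0 : κ ≠ 0 := by
    rintro h0
    rw [h0, zero_smul] at hh'
    exact hne hh'
  have hNe : N = vecMulVec (κ⁻¹ • (N *ᵥ c)) (d ᵥ* N) := by
    rw [smul_vecMulVec, hh', smul_smul, inv_mul_cancel₀ hκ0, one_smul]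
  have hdot : (d ᵥ* N) ⬝ᵥ (κ⁻¹ • (N *ᵥ c)) = 0 := by
    rw [dotProduct_smul, dotProduct_mulVec, vecMul_vecMul, hNN, vecMul_zero, zero_dotProduct,
      smul_zero]
  refine ⟨κ⁻¹ • (N *ᵥ c), d ᵥ* N, hNe ▸ hN0, hdot, fun t => ?_⟩
  obtain ⟨h, hh, -, H⟩ := hscale t
  have : h = shear (t • κ⁻¹ • (N *ᵥ c)) (d ᵥ* N) := by
    refine eq_shear (by rw [dotProduct_smul, hdot, smul_zero]) ?_
    rw [hh, smul_vecMulVec, ← hNe]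
  rwa [← this]

end MateRelation

end Mates

section Automorphism

open Set Filter Topology

variable {n : ℕ}

local notation "Mat" => Matrix (Fin n) (Fin n) ℝ

/-- Conjugation of `SL(n,ℝ)` by an invertible matrix. -/
noncomputable def conjSLR (P : Matrix (Fin n) (Fin n) ℝ) (hP : IsUnit P.det) : SLR n ≃* SLR n where
  toFun g := ⟨P * g * P⁻¹, by
    rw [det_mul, det_mul, mul_right_comm, ← det_mul, mul_nonsing_inv _ hP, det_one, one_mul, g.2]⟩
  invFun g := ⟨P⁻¹ * g * P, by
    rw [det_mul, det_mul, mul_right_comm, ← det_mul, nonsing_inv_mul _ hP, det_one, one_mul, g.2]⟩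
  left_inv g := Subtype.ext <| by
    change P⁻¹ * (P * (g : Mat) * P⁻¹) * P = g
    rw [mul_assoc P, nonsing_inv_mul_cancel_left _ _ hP, nonsing_inv_mul_cancel_right _ _ hP]
  right_inv g := Subtype.ext <| by
    change P * (P⁻¹ * (g : Mat) * P) * P⁻¹ = g
    rw [mul_assoc P⁻¹, mul_nonsing_inv_cancel_left _ _ hP, mul_nonsing_inv_cancel_right _ _ hP]
  map_mul' g h := Subtype.ext <| by
    change P * ((g * h : SLR n) : Mat) * P⁻¹ = P * (g : Mat) * P⁻¹ * (P * (h : Mat) * P⁻¹)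
    rw [Matrix.SpecialLinearGroup.coe_mul, mul_assoc _ P⁻¹, mul_assoc P (h : Mat) P⁻¹,
      nonsing_inv_mul_cancel_left _ _ hP, mul_assoc, mul_assoc, mul_assoc]

variable {P : Matrix (Fin n) (Fin n) ℝ} {hP : IsUnit P.det}

theorem coe_conjSLR (g : SLR n) : (conjSLR P hP g : Mat) = P * g * P⁻¹ := rfl

theorem continuous_conjSLR : Continuous (conjSLR P hP) :=
  continuous_induced_rng.2 ((continuous_const.matrix_mul continuous_coe_SLR).matrix_mul
    continuous_const)

theorem continuous_conjSLR_symm : Continuous (conjSLR P hP).symm :=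
  continuous_induced_rng.2 ((continuous_const.matrix_mul continuous_coe_SLR).matrix_mul
    continuous_const)

theorem coe_invTranspose_transvection {i j : Fin n} (hij : i ≠ j) (t : ℝ) :
    (invTranspose n (Matrix.SpecialLinearGroup.transvection hij t) : Mat) =
      1 + t • -(single i j (1 : ℝ))ᵀ := by
  have h2 : (shear (Pi.single j (1 : ℝ)) (-Pi.single i t) : Mat) =
      1 + vecMulVec (Pi.single j (1 : ℝ)) (-Pi.single i t) := coe_shear (by simp [hij])
  have h3 : (Pi.single i t : Fin n → ℝ) = t • Pi.single i (1 : ℝ) := by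
    rw [← Pi.single_smul, smul_eq_mul, mul_one]
  rw [transvection_eq_shear, invTranspose_shear (by simp [hij.symm]), h2, transpose_single,
    vecMulVec_neg, h3, vecMulVec_smul, ← single_eq_single_vecMulVec_single, smul_neg]

namespace MateRelation

variable {R : SLR n → SLR n → Prop}

theorem commute_of_commute (hR : MateRelation R) {g h g' h' : SLR n} (H : R g h) (H' : R g' h')
    (hh' : IsUnipotent n h') (hg : Commute g g') : Commute h h' := by
  have h1 := hR.conj H H'
  rw [hg.eq, mul_inv_cancel_right] at h1
  have h2 := hR.right_unique h1 H' (hh'.conj h) hh'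
  exact mul_inv_eq_iff_eq_mul.1 h2

theorem commute_transvection {i j k l : Fin n} (hij : i ≠ j) (hkl : k ≠ l) (hil : i ≠ l)
    (hjk : j ≠ k) (s t : ℝ) : Commute (Matrix.SpecialLinearGroup.transvection hij s)
      (Matrix.SpecialLinearGroup.transvection hkl t) := by
  refine Subtype.ext ?_
  rw [Matrix.SpecialLinearGroup.coe_mul, Matrix.SpecialLinearGroup.coe_mul,
    Matrix.SpecialLinearGroup.transvection_coe, Matrix.SpecialLinearGroup.transvection_coe,
    mul_add, add_mul, mul_add, add_mul, single_mul_single_of_ne _ _ _ _ hjk, add_mul _ _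
        (single i j s),
    single_mul_single_of_ne _ _ _ _ hil.symm]
  simp only [mul_one, one_mul]
  abel

theorem transvection_conj {i j k : Fin n} (hij : i ≠ j) (hjk : j ≠ k) (hik : i ≠ k) (s t : ℝ) :
    Matrix.SpecialLinearGroup.transvection hij s * Matrix.SpecialLinearGroup.transvection hjk t *
      (Matrix.SpecialLinearGroup.transvection hij s)⁻¹ =
    Matrix.SpecialLinearGroup.transvection hjk t *
      Matrix.SpecialLinearGroup.transvection hik (s * t) := by
  rw [mul_inv_eq_iff_eq_mul]
  refine Subtype.ext ?_
  simp only [Matrix.SpecialLinearGroup.coe_mul, Matrix.SpecialLinearGroup.transvection_coe, mul_add,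
    add_mul, single_mul_single_same, single_mul_single_of_ne _ _ _ _ hik.symm, mul_one, one_mul,
    add_zero, mul_assoc]
  abel

theorem elementaryRelations (hR : MateRelation R) {α β : Fin n → Fin n → Fin n → ℝ}
    (hne : ∀ i j, i ≠ j → vecMulVec (α i j) (β i j) ≠ 0)
    (hdot : ∀ i j, i ≠ j → β i j ⬝ᵥ α i j = 0)
    (H : ∀ i j (hij : i ≠ j) t, R (Matrix.SpecialLinearGroup.transvection hij t)
      (shear (t • α i j) (β i j))) :
    ElementaryRelations fun i j => vecMulVec (α i j) (β i j) := by
  have hdot' : ∀ i j (t : ℝ), i ≠ j → β i j ⬝ᵥ (t • α i j) = 0 := fun i j t hij => by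
    rw [dotProduct_smul, hdot i j hij, smul_zero]
  have hcoe : ∀ i j (t : ℝ), i ≠ j → (shear (t • α i j) (β i j) : Mat) =
      1 + t • vecMulVec (α i j) (β i j) := fun i j t hij => by
    rw [coe_shear (hdot' i j t hij), smul_vecMulVec]
  have hcomm' : ∀ {i j k l} (s t : ℝ), i ≠ j → k ≠ l → i ≠ l → j ≠ k →
      Commute (shear (s • α i j) (β i j)) (shear (t • α k l) (β k l)) :=
    fun s t hij hkl hil hjk => hR.commute_of_commute (H _ _ hij s) (H _ _ hkl t)
      (isUnipotent_shear _ _) (commute_transvection hij hkl hil hjk s t)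
  have hsq : ∀ {i j}, i ≠ j → vecMulVec (α i j) (β i j) * vecMulVec (α i j) (β i j) = 0 :=
    fun hij => vecMulVec_sq (hdot _ _ hij)
  have hcomm : ∀ {i j k l}, i ≠ j → k ≠ l → i ≠ l → j ≠ k →
      vecMulVec (α i j) (β i j) * vecMulVec (α k l) (β k l) =
        vecMulVec (α k l) (β k l) * vecMulVec (α i j) (β i j) := by
    intro i j k l hij hkl hil hjk
    have h1 := (hcomm' 1 1 hij hkl hil hjk).coe_SLR.eq
    rw [hcoe _ _ _ hij, hcoe _ _ _ hkl, one_smul, one_smul, mul_add, add_mul, mul_add,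
      add_mul] at h1
    simp only [mul_one, one_mul, add_mul] at h1
    linear_combination (norm := module) h1
  have hmain : ∀ {i j k}, i ≠ j → j ≠ k → i ≠ k →
      vecMulVec (α i j) (β i j) * vecMulVec (α j k) (β j k) * vecMulVec (α i j) (β i j) = 0 ∧
      vecMulVec (α j k) (β j k) * vecMulVec (α i k) (β i k) = 0 ∧
      vecMulVec (α i j) (β i j) * vecMulVec (α j k) (β j k) -
        vecMulVec (α j k) (β j k) * vecMulVec (α i j) (β i j) = vecMulVec (α i k) (β i k) := by
    intro i j k hij hjk hik
    have key : ∀ s t : ℝ,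
        (1 + s • vecMulVec (α i j) (β i j)) * (1 + t • vecMulVec (α j k) (β j k)) *
          (1 - s • vecMulVec (α i j) (β i j)) =
        (1 + t • vecMulVec (α j k) (β j k)) * (1 + (s * t) • vecMulVec (α i k) (β i k)) := by
      intro s t
      have h1 := hR.conj (H _ _ hij s) (H _ _ hjk t)
      rw [transvection_conj hij hjk hik] at h1
      have h2 := hR.right_unique h1 (hR.mul (H _ _ hjk t) (H _ _ hik (s * t)))
        ((isUnipotent_shear _ _).conj _)
        ((isUnipotent_shear _ _).mul (isUnipotent_shear _ _) (hcomm' _ _ hjk hik hjk hik.symm))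
      have h3 := congrArg (fun g : SLR n => (g : Mat)) h2
      simp only [Matrix.SpecialLinearGroup.coe_mul] at h3
      rwa [hcoe _ _ _ hij, hcoe _ _ _ hjk, hcoe _ _ _ hik, coe_inv_of_sq_eq_zero _ (hcoe _ _ _ hij)]
        at h3
      rw [smul_mul_smul_comm, hsq hij, smul_zero]
    have hA := hsq hij
    generalize vecMulVec (α i j) (β i j) = A at *
    generalize vecMulVec (α j k) (β j k) = B at *
    generalize vecMulVec (α i k) (β i k) = C at *
    have e1 := key 1 1
    have e2 := key (-1) 1
    have e3 := key 1 (-1)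
    have expand : ∀ s t : ℝ, (1 + s • A) * (1 + t • B) * (1 - s • A) =
        1 + t • B + (s * t) • (A * B - B * A) - (s * t * s) • (A * B * A) := by
      intro s t
      simp only [mul_sub, mul_add, add_mul, smul_mul_smul_comm, hA, smul_zero, smul_sub, mul_one,
        one_mul, mul_comm t s]
      abel
    have expand' : ∀ s t : ℝ, (1 + t • B) * (1 + (s * t) • C) =
        1 + t • B + (s * t) • C + (t * (s * t)) • (B * C) := by
      intro s t
      simp only [mul_add, add_mul, smul_mul_smul_comm, mul_one, one_mul]
      abel
    rw [expand, expand'] at e1 e2 e3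
    simp only [mul_one, mul_neg, neg_neg, one_smul, neg_smul] at e1 e2 e3
    generalize A * B * A = W at *
    generalize B * C = V at *
    generalize A * B - B * A = U at *
    have h1 : U - W = C + V := by linear_combination (norm := module) e1
    have h2 : -U - W = -C - V := by linear_combination (norm := module) e2
    have h3 : -U + W = -C + V := by linear_combination (norm := module) e3
    refine ⟨?_, ?_, ?_⟩
    · linear_combination (norm := module) -(2 : ℝ)⁻¹ • h1 - (2 : ℝ)⁻¹ • h2
    · linear_combination (norm := module) -(2 : ℝ)⁻¹ • h1 - (2 : ℝ)⁻¹ • h3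
    · linear_combination (norm := module) -(2 : ℝ)⁻¹ • h2 - (2 : ℝ)⁻¹ • h3
  refine ⟨fun hij => hne _ _ hij, hsq, fun hij hjk hik => (hmain hij hjk hik).2.2,
    fun {i j k} hij hjk hik => ?_, fun {i j k} hij hjk hik => ?_, fun {i j k} hij hjk hik => ?_,
    hcomm⟩
  · have h1 := (hmain hij hjk hik).1
    have h2 := hne i j hij
    rw [Ne, vecMulVec_eq_zero, not_or] at h2
    rw [vecMulVec_mul_vecMulVec, vecMulVec_mul_vecMulVec, vecMulVec_eq_zero, smul_eq_zero,
      smul_dotProduct, smul_eq_zero] at h1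
    rw [vecMulVec_mul_vecMulVec, vecMulVec_mul_vecMulVec]
    rcases h1.resolve_left h2.1 with (h3 | h3) | h3
    · exact Or.inl (by rw [h3, zero_smul, vecMulVec_zero])
    · exact Or.inr (by rw [h3, zero_smul, vecMulVec_zero])
    · exact absurd h3 h2.2
  · have h1 := (hmain hij hjk hik)
    rw [← h1.2.2, mul_sub, ← mul_assoc, hsq hij, zero_mul, ← mul_assoc, h1.1, sub_zero]
  · rw [hcomm hik hjk hik.symm.symm hjk.symm, (hmain hij hjk hik).2.1]

theorem _root_.conjSLR_eq_shear {P M : Matrix (Fin n) (Fin n) ℝ} (hP : IsUnit P.det)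
    {α β : Fin n → ℝ} (hdot : β ⬝ᵥ α = 0) (hM : vecMulVec α β * P = P * M) {g : SLR n} {t : ℝ}
    (hg : (g : Mat) = 1 + t • M) : conjSLR P hP g = shear (t • α) β := by
  refine eq_shear (by rw [dotProduct_smul, hdot, smul_zero]) ?_
  rw [coe_conjSLR, hg, mul_add, mul_one, mul_smul_comm, ← hM, add_mul, smul_mul_assoc,
    mul_nonsing_inv _ hP, mul_nonsing_inv_cancel_right _ _ hP, smul_vecMulVec]

/-- If all elementary unipotents are related to unipotents on either side, the relation contains
the graph of a bicontinuous automorphism. -/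
theorem exists_mulEquiv (hR : MateRelation R) (hn : 3 ≤ n)
    (hr : ∀ a b : Fin n → ℝ, b ⬝ᵥ a = 0 → ∃ h, IsUnipotent n h ∧ R (shear a b) h)
    (hl : ∀ a b : Fin n → ℝ, b ⬝ᵥ a = 0 → ∃ g, IsUnipotent n g ∧ R g (shear a b)) :
    ∃ A : SLR n ≃* SLR n, Continuous A ∧ Continuous A.symm ∧ ∀ g, R g (A g) := by
  have h1 : ∀ i j : Fin n, ∃ α β : Fin n → ℝ, i ≠ j → vecMulVec α β ≠ 0 ∧ β ⬝ᵥ α = 0 ∧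
      ∀ t : ℝ, R (shear (t • Pi.single i (1 : ℝ)) (Pi.single j 1)) (shear (t • α) β) := by
    intro i j
    by_cases hij : i = j
    · exact ⟨0, 0, fun h => absurd hij h⟩
    · obtain ⟨α, β, h⟩ := hR.exists_shear hr hl (a := Pi.single i 1) (b := Pi.single j 1)
        (by simp [Ne.symm hij]) (by simp) (by simp)
      exact ⟨α, β, fun _ => h⟩
  choose α β h1 using h1
  have H : ∀ i j (hij : i ≠ j) t, R (Matrix.SpecialLinearGroup.transvection hij t)
      (shear (t • α i j) (β i j)) := by
    intro i j hij t
    have h2 := (h1 i j hij).2.2 t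
    rwa [← Pi.single_smul, smul_eq_mul, mul_one, ← transvection_eq_shear hij] at h2
  obtain ⟨P, hP, hY⟩ := (hR.elementaryRelations (fun i j hij => (h1 i j hij).1)
    (fun i j hij => (h1 i j hij).2.1) H).exists_conj hn
  have key : ∀ A : SLR n ≃* SLR n, (∀ i j (hij : i ≠ j) t,
      A (Matrix.SpecialLinearGroup.transvection hij t) = shear (t • α i j) (β i j)) →
      ∀ g, R g (A g) := by
    intro A hA
    let T : Subgroup (SLR n) :=
      { carrier := {g | R g (A g)}
        one_mem' := by
          change R 1 (A 1)
          rw [map_one]; exact hR.one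
        mul_mem' := by
          intro a b ha hb
          change R (a * b) (A (a * b))
          rw [map_mul]; exact hR.mul ha hb
        inv_mem' := by
          intro a ha
          change R a⁻¹ (A a⁻¹)
          rw [map_inv]; exact hR.inv ha }
    have hT : T = ⊤ := by
      refine subgroup_eq_top_of_transvection_mem (by omega) fun i j hij t => ?_
      change R _ (A _)
      rw [hA]
      exact H i j hij t
    intro g
    exact (hT ▸ Subgroup.mem_top g : g ∈ T)
  rcases hY with hY | hY
  · refine ⟨conjSLR P hP, continuous_conjSLR, continuous_conjSLR_symm, key _ ?_⟩
    intro i j hij t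
    refine conjSLR_eq_shear hP (h1 i j hij).2.1 (hY i j hij) ?_
    rw [Matrix.SpecialLinearGroup.transvection_coe, smul_single, smul_eq_mul, mul_one]
  · refine ⟨(invTranspose n).trans (conjSLR P hP), ?_, ?_, key _ ?_⟩
    · have h3 : ⇑((invTranspose n).trans (conjSLR P hP)) = conjSLR P hP ∘ invTranspose n := rfl
      rw [h3]
      exact continuous_conjSLR.comp continuous_invTranspose
    · have h2 : (invTranspose n).symm = invTranspose n := by
        ext1 g
        rw [MulEquiv.symm_apply_eq, invTranspose_invTranspose]
      have h3 : ⇑((invTranspose n).trans (conjSLR P hP)).symm =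
          invTranspose n ∘ (conjSLR P hP).symm := by
        funext g
        change (invTranspose n).symm _ = _
        rw [h2]; rfl
      rw [h3]
      exact continuous_invTranspose.comp continuous_conjSLR_symm
    intro i j hij t
    exact conjSLR_eq_shear hP (h1 i j hij).2.1 (hY i j hij) (coe_invTranspose_transvection hij t)

end MateRelation

end Automorphism

section Mates

open Set Filter Topology

set_option linter.unusedSectionVars false

attribute [local instance] t2Space_quotient_of_discrete

variable {n : ℕ} {Λ : Subgroup (SLR n)} [DiscreteTopology Λ] {μ : Measure (SLR n ⧸ Λ)}
  [IsProbabilityMeasure μ] [SMulInvariantMeasure (SLR n) (SLR n ⧸ Λ) μ]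
  {φ φ' : SLR n ⧸ Λ → SLR n ⧸ Λ}

theorem mateRelation_intertwines (hn : 2 ≤ n) (hφ : Measurable φ) (hmp : Measure.map φ μ = μ)
    (hφ' : Measurable φ') (hmp' : Measure.map φ' μ = μ) (h1 : ∀ᵐ x ∂μ, φ' (φ x) = x)
    (h2 : ∀ᵐ x ∂μ, φ (φ' x) = x) : MateRelation fun g h => Intertwines μ φ g h where
  one := Intertwines.one
  mul H H' := H.mul H'
  inv H := H.inv
  closed hg hh H := Intertwines.of_tendsto hφ hg hh H
  right_unique H H' hh hh' := H.unique hn hφ hmp H' hh hh'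
  left_unique H H' hg hg' := (H.inverse hφ' hmp' h1 h2).unique hn hφ' hmp'
    (H'.inverse hφ' hmp' h1 h2) hg hg'

theorem exists_intertwines_shear (hn : 3 ≤ n) (hφ : Measurable φ) {u : SLR n}
    (hu : IsUnipotent n u) (hu1 : u ≠ 1) (H : Intertwines μ φ u u) {a b : Fin n → ℝ}
    (hab : b ⬝ᵥ a = 0) : ∃ h, IsUnipotent n h ∧ Intertwines μ φ (shear a b) h := by
  by_cases ha : a = 0
  · have h1 : (1 : SLR n) = shear a b := eq_shear hab (by
      rw [ha, zero_vecMulVec, add_zero, Matrix.SpecialLinearGroup.coe_one])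
    exact ⟨1, IsUnipotent.one, h1 ▸ Intertwines.one⟩
  · exact (shearClosed_intertwines (by omega) hφ).shear_mem hn (u := u) ⟨u, hu, H⟩ hu hu1 ha hab

theorem exists_mulEquiv_intertwines_of_three_le (hn : 3 ≤ n) (hφ : Measurable φ)
    (hmp : Measure.map φ μ = μ) (hφ' : Measurable φ') (hmp' : Measure.map φ' μ = μ)
    (h1 : ∀ᵐ x ∂μ, φ' (φ x) = x) (h2 : ∀ᵐ x ∂μ, φ (φ' x) = x) {u : SLR n}
    (hu : IsUnipotent n u) (hu1 : u ≠ 1) (H : Intertwines μ φ u u) :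
    ∃ A : SLR n ≃* SLR n, Continuous A ∧ Continuous A.symm ∧ ∀ g, Intertwines μ φ g (A g) := by
  refine (mateRelation_intertwines (by omega) hφ hmp hφ' hmp' h1 h2).exists_mulEquiv hn
    (fun a b hab => exists_intertwines_shear hn hφ hu hu1 H hab) fun a b hab => ?_
  obtain ⟨g, hg, Hg⟩ := exists_intertwines_shear hn hφ' hu hu1 (H.inverse hφ' hmp' h1 h2) hab
  exact ⟨g, hg, Hg.inverse hφ hmp h2 h1⟩

end Mates

section Affine

set_option linter.unusedSectionVars false

open Set Filter Topology

attribute [local instance] t2Space_quotient_of_discrete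

variable {G : Type*} [Group G] [TopologicalSpace G] [IsTopologicalGroup G]
  [LocallyCompactSpace G] [PolishSpace G] [MeasurableSpace G] [BorelSpace G]
  {Γ : Subgroup G} [DiscreteTopology Γ] {μ : Measure (G ⧸ Γ)} [IsProbabilityMeasure μ]
  [SMulInvariantMeasure G (G ⧸ Γ) μ] {φ φ' : G ⧸ Γ → G ⧸ Γ}

/-- A map intertwining every translation with its image under a continuous automorphism
satisfies the intertwining relation along almost all of some orbit map. -/
theorem exists_orbit_of_forall_intertwines (hφ : Measurable φ) {A : G → G} (hA : Continuous A)
    (H : ∀ g, Intertwines μ φ g (A g)) :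
    ∃ x₀, ∀ᵐ g ∂(Measure.haar : Measure G), φ (g • x₀) = A g • φ x₀ := by
  have hm : MeasurableSet {p : G × (G ⧸ Γ) | φ (p.1 • p.2) = A p.1 • φ p.2} :=
    measurableSet_eq_fun (hφ.comp measurable_smul)
      ((hA.measurable.comp measurable_fst).smul (hφ.comp measurable_snd))
  have h1 : ∀ᵐ g ∂(Measure.haar : Measure G), ∀ᵐ x ∂μ, φ (g • x) = A g • φ x :=
    Eventually.of_forall H
  rw [Measure.ae_ae_comm hm] at h1
  exact h1.exists

theorem smul_mk_one (g : G) : g • (QuotientGroup.mk (1 : G) : G ⧸ Γ) = QuotientGroup.mk g := by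
  change QuotientGroup.mk (g * 1) = _
  rw [mul_one]

theorem exists_affine_of_forall_intertwines (hφ : Measurable φ) (hφ' : Measurable φ')
    (h1 : ∀ᵐ x ∂μ, φ' (φ x) = x) (A : G ≃* G) (hA : Continuous A)
    (H : ∀ g, Intertwines μ φ g (A g)) :
    ∃ (B : G ≃* G) (h : G), Continuous B ∧ Γ.map B.toMonoidHom = Γ ∧
      ∃ ψ : G ⧸ Γ → G ⧸ Γ, (∀ g : G, ψ (QuotientGroup.mk g) = QuotientGroup.mk (h * B g)) ∧
        (∀ᵐ x ∂μ, φ x = ψ x) ∧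
        ∀ f, Intertwines μ φ f f → ∀ x, ψ (f • x) = f • ψ x := by
  obtain ⟨x₀, hx₀⟩ := exists_orbit_of_forall_intertwines hφ hA H
  obtain ⟨g₀, rfl⟩ := QuotientGroup.mk_surjective x₀
  obtain ⟨k₀, hk₀⟩ := QuotientGroup.mk_surjective (φ (QuotientGroup.mk g₀))
  set ν : Measure G := Measure.haar
  set k : G := (A g₀)⁻¹ * k₀
  set B : G ≃* G := A.trans (MulAut.conj k⁻¹)
  have hB : ∀ g, k * B g = A g * k := fun g => by
    change k * (k⁻¹ * A g * k⁻¹⁻¹) = _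
    group
  have hBc : Continuous B := by
    change Continuous fun g => k⁻¹ * A g * k⁻¹⁻¹
    fun_prop
  have hae : ∀ᵐ g ∂ν, φ (QuotientGroup.mk g) = QuotientGroup.mk (k * B g) := by
    have h2 := (quasiMeasurePreserving_mul_right ν g₀⁻¹).ae hx₀
    filter_upwards [h2] with g hg
    rw [← hk₀] at hg
    change φ (QuotientGroup.mk (g * g₀⁻¹ * g₀)) = QuotientGroup.mk (A (g * g₀⁻¹) * k₀) at hg
    rw [inv_mul_cancel_right] at hg
    rw [hg, hB, map_mul, map_inv, mul_assoc]
  have hφ'ae : ∀ᵐ g ∂ν, φ' (QuotientGroup.mk (k * B g)) = QuotientGroup.mk g := by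
    have h2 := (ae_iff_ae_orbit (measurableSet_eq_fun (hφ'.comp hφ) measurable_id)
      (QuotientGroup.mk (1 : G))).1 h1
    filter_upwards [h2, hae] with g hg hg'
    rw [smul_mk_one] at hg
    rw [← hg']
    exact hg
  have hmem : ∀ γ : G, B γ ∈ Γ ↔ γ ∈ Γ := by
    intro γ
    have hiff : ∀ g : G, (QuotientGroup.mk (k * B (g * γ)) : G ⧸ Γ) = QuotientGroup.mk (k * B g) ↔
        B γ ∈ Γ := fun g => by
      rw [eq_comm, QuotientGroup.eq, map_mul]
      exact iff_of_eq (congrArg (· ∈ Γ) (by group))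
    constructor
    · intro hγ
      obtain ⟨g, hg, hg'⟩ := (hφ'ae.and ((quasiMeasurePreserving_mul_right ν γ).ae hφ'ae)).exists
      rw [(hiff g).2 hγ, hg, QuotientGroup.eq, inv_mul_cancel_left] at hg'
      exact hg'
    · intro hγ
      obtain ⟨g, hg, hg'⟩ := (hae.and ((quasiMeasurePreserving_mul_right ν γ).ae hae)).exists
      rw [QuotientGroup.mk_mul_of_mem g hγ, hg] at hg'
      exact (hiff g).1 hg'.symm
  have hψ : ∀ a b : G, QuotientGroup.leftRel Γ a b →
      (QuotientGroup.mk (k * B a) : G ⧸ Γ) = QuotientGroup.mk (k * B b) := by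
    intro a b hab
    rw [QuotientGroup.leftRel_apply] at hab
    rw [QuotientGroup.eq, _root_.mul_inv_rev, mul_assoc, inv_mul_cancel_left, ← map_inv, ← map_mul]
    exact (hmem _).2 hab
  set ψ : G ⧸ Γ → G ⧸ Γ := Quotient.lift (fun g => QuotientGroup.mk (k * B g)) hψ
  have hψmk : ∀ g : G, ψ (QuotientGroup.mk g) = QuotientGroup.mk (k * B g) := fun g => rfl
  have hψc : Continuous ψ :=
    continuous_quot_lift hψ (QuotientGroup.continuous_mk.comp (continuous_const.mul hBc))
  have hφψ : ∀ᵐ x ∂μ, φ x = ψ x := by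
    refine (ae_iff_ae_orbit (measurableSet_eq_fun hφ hψc.measurable)
      (QuotientGroup.mk (1 : G))).2 ?_
    filter_upwards [hae] with g hg
    rw [smul_mk_one, hg, hψmk]
  refine ⟨B, k, hBc, ?_, ψ, hψmk, hφψ, fun f hf x => ?_⟩
  · ext γ
    constructor
    · rintro ⟨δ, hδ, rfl⟩
      exact (hmem δ).2 hδ
    · intro hγ
      exact ⟨B.symm γ, (hmem _).1 (by rwa [B.apply_symm_apply]), B.apply_symm_apply γ⟩
  · have h2 : ∀ᵐ x ∂μ, ψ (f • x) = f • ψ x := by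
      filter_upwards [hf, hφψ, ae_smul μ hφψ f] with x h3 h4 h5
      rw [← h4, ← h5, h3]
    have h3 := (ae_iff_ae_orbit (measurableSet_eq_fun (by fun_prop) (by fun_prop))
      (QuotientGroup.mk (1 : G))).1 h2
    have hc : Continuous fun g : G => g • (QuotientGroup.mk (1 : G) : G ⧸ Γ) := by fun_prop
    have h4 := (Continuous.ae_eq_iff_eq ν (hψc.comp (hc.const_smul f))
      ((hψc.comp hc).const_smul f)).1 h3
    obtain ⟨g, rfl⟩ := QuotientGroup.mk_surjective x
    have h5 := congrFun h4 g
    change ψ (f • g • QuotientGroup.mk (1 : G)) = f • ψ (g • QuotientGroup.mk (1 : G)) at h5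
    rwa [smul_mk_one] at h5

end Affine

section Nontrivial

set_option linter.unusedSectionVars false

open Set Filter Topology

attribute [local instance] t2Space_quotient_of_discrete

section

variable {G : Type*} [Group G] [TopologicalSpace G] [IsTopologicalGroup G]
  [LocallyCompactSpace G] [PolishSpace G] [MeasurableSpace G] [BorelSpace G]
  {Γ : Subgroup G} [DiscreteTopology Γ] {μ : Measure (G ⧸ Γ)} [IsProbabilityMeasure μ]
  [SMulInvariantMeasure G (G ⧸ Γ) μ]

theorem measure_ne_zero_of_isOpen {s : Set (G ⧸ Γ)} (hs : IsOpen s) (hne : s.Nonempty) :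
    μ s ≠ 0 := by
  obtain ⟨x, hx⟩ := hne
  rw [Ne, measure_eq_zero_iff_ae_orbit hs.measurableSet x, ae_iff]
  have hc : Continuous fun g : G => g • x := by fun_prop
  have h1 : {g : G | ¬ g • x ∉ s} = (fun g : G => g • x) ⁻¹' s := by
    ext g
    exact not_not
  rw [h1, (hs.preimage hc).measure_eq_zero_iff (Measure.haar : Measure G)]
  exact Nonempty.ne_empty ⟨1, by simpa using hx⟩

theorem eq_top_of_forall_measure_eq_zero_or_compl
    (h : ∀ s : Set (G ⧸ Γ), MeasurableSet s → μ s = 0 ∨ μ sᶜ = 0) : Γ = ⊤ := by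
  refine (Subgroup.eq_top_iff' Γ).2 fun g => ?_
  by_contra hg
  have hne : (QuotientGroup.mk 1 : G ⧸ Γ) ≠ QuotientGroup.mk g := fun h1 => hg (by
    simpa using QuotientGroup.eq.1 h1)
  obtain ⟨U, V, hU, hV, h1U, hgV, hUV⟩ := t2_separation hne
  rcases h U hU.measurableSet with h1 | h1
  · exact measure_ne_zero_of_isOpen hU ⟨_, h1U⟩ h1
  · exact measure_ne_zero_of_isOpen hV ⟨_, hgV⟩
      (measure_mono_null hUV.subset_compl_left h1)

end

variable {n : ℕ}

theorem tendsto_transvection {i j : Fin n} (hij : i ≠ j) :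
    Tendsto (fun t : ℝ => (Matrix.SpecialLinearGroup.transvection hij t : SLR n)) (𝓝 0) (𝓝 1) := by
  rw [tendsto_SLR_iff]
  have h1 : Tendsto (fun t : ℝ => (1 : Matrix (Fin n) (Fin n) ℝ) + t • single i j 1) (𝓝 0)
      (𝓝 (1 + (0 : ℝ) • single i j 1)) := (by fun_prop : Continuous fun t : ℝ =>
        (1 : Matrix (Fin n) (Fin n) ℝ) + t • single i j 1).tendsto 0
  rw [zero_smul, add_zero] at h1
  refine h1.congr fun t => ?_
  rw [Matrix.SpecialLinearGroup.transvection_coe, smul_single, smul_eq_mul, mul_one]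

theorem not_discreteTopology_SLR (hn : 2 ≤ n) : ¬ DiscreteTopology (SLR n) := by
  intro h
  have hij : (⟨0, by omega⟩ : Fin n) ≠ ⟨1, by omega⟩ := by simp
  have h1 := tendsto_transvection hij
  rw [nhds_discrete (SLR n), tendsto_pure] at h1
  obtain ⟨t, ht, ht0⟩ := ((h1.filter_mono nhdsWithin_le_nhds).and
    (self_mem_nhdsWithin (a := (0 : ℝ)) (s := {0}ᶜ))).exists
  have h2 := congrArg (fun g : SLR n => (g : Matrix (Fin n) (Fin n) ℝ) ⟨0, by omega⟩ ⟨1, by omega⟩)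
      ht
  simp only [Matrix.SpecialLinearGroup.transvection_coe, Matrix.SpecialLinearGroup.coe_one,
    Matrix.add_apply, one_apply_ne hij, single_apply_same, zero_add] at h2
  exact ht0 h2

theorem exists_isUnipotent_ne_one (hn : 2 ≤ n) {Λ : Subgroup (SLR n)} [DiscreteTopology Λ]
    {μ : Measure (SLR n ⧸ Λ)} [IsProbabilityMeasure μ]
    [SMulInvariantMeasure (SLR n) (SLR n ⧸ Λ) μ] {S : Set (SLR n)}
    (hS : ∀ u ∈ S, IsUnipotent n u)
    (herg : ∀ s : Set (SLR n ⧸ Λ), MeasurableSet s → (∀ f ∈ Subgroup.closure S, f • s = s) →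
      μ s = 0 ∨ μ sᶜ = 0) : ∃ u ∈ S, IsUnipotent n u ∧ u ≠ 1 := by
  by_contra! hc
  have h1 : Subgroup.closure S = ⊥ := by
    rw [Subgroup.closure_eq_bot_iff]
    exact fun u hu => hc u hu (hS u hu)
  have h2 : Λ = ⊤ := eq_top_of_forall_measure_eq_zero_or_compl (μ := μ) fun s hs =>
    herg s hs fun f hf => by
      rw [h1, Subgroup.mem_bot] at hf
      rw [hf, one_smul]
  subst h2
  exact not_discreteTopology_SLR hn
    ((Homeomorph.Set.univ (SLR n)).symm.isEmbedding.discreteTopology)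

end Nontrivial

section UpperRoots

open Set Filter Topology
open scoped Matrix.Norms.Operator

set_option linter.unusedSectionVars false

attribute [local instance] t2Space_quotient_of_discrete

theorem upperUni_eq_shear (s τ : ℝ) : upperUni (s * τ) = shear (s • ![τ, 0]) ![0, 1] :=
  eq_shear (by simp) (by
    rw [coe_upperUni]
    ext i j
    fin_cases i <;> fin_cases j <;> simp)

theorem upperUni_conj_lower (x c : ℝ) :
    (upperUni x : Matrix (Fin 2) (Fin 2) ℝ) * (c • single 1 0 1) *
        (((upperUni x)⁻¹ : SLR 2) : Matrix (Fin 2) (Fin 2) ℝ) =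
      c • single 1 0 1 + (c * x) • (single 0 0 1 - single 1 1 1) - (c * x ^ 2) • single 0 1 1 := by
  have h1 : c • single 1 0 1 = !![0, 0; c, 0] := by
    ext i j
    fin_cases i <;> fin_cases j <;> simp
  rw [upperUni_inv, coe_upperUni, coe_upperUni, h1]
  ext i j
  fin_cases i <;> fin_cases j <;> simp <;> ring

theorem ShearClosed.upperUni_mem {H : Set (SLR 2)} (hH : ShearClosed H) {τ : ℝ} (hτ : τ ≠ 0)
    (h : upperUni τ ∈ H) (s : ℝ) : upperUni s ∈ H := by
  set c : ℝ := -s / τ ^ 2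
  set ε : ℕ → ℝ := fun k => ((k : ℝ)⁻¹) ^ 2
  have hlim0 : Tendsto (fun k : ℕ => (k : ℝ)⁻¹) atTop (𝓝 0) :=
    tendsto_inv_atTop_nhds_zero_nat (𝕜 := ℝ)
  have hexp : ∀ (k m : ℕ), ε k • (((upperUni τ ^ m : SLR 2) : Matrix (Fin 2) (Fin 2) ℝ) *
      (c • single 1 0 1) * (((upperUni τ ^ m)⁻¹ : SLR 2) : Matrix (Fin 2) (Fin 2) ℝ)) =
      (ε k * c) • single 1 0 1 + (ε k * (c * (m * τ))) • (single 0 0 1 - single 1 1 1) -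
        (ε k * (c * (m * τ) ^ 2)) • single 0 1 1 := by
    intro k m
    rw [upperUni_pow, upperUni_conj_lower, smul_sub, smul_add, smul_smul, smul_smul, smul_smul]
  refine hH.mem_of_tendsto (A := c • single 1 0 1) (B := s • single 0 1 1) (ε := ε)
    (C := |c| * ‖(single 1 0 1 : Matrix (Fin 2) (Fin 2) ℝ)‖ +
      |c * τ| * ‖(single 0 0 1 - single 1 1 1 : Matrix (Fin 2) (Fin 2) ℝ)‖ +
      |c * τ ^ 2| * ‖(single 0 1 1 : Matrix (Fin 2) (Fin 2) ℝ)‖)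
    h (isUnipotent_upperUni τ) ?_ ?_ ?_ ?_ ?_ ?_ ?_ ?_
  · intro h1
    have h2 := congrArg (fun g : SLR 2 => (g : Matrix (Fin 2) (Fin 2) ℝ) 0 1) h1
    simp [coe_upperUni] at h2
    exact hτ h2
  · simp
  · simp
  · simpa [ε] using hlim0.pow 2
  · intro k m hmk
    have hm : (k : ℝ)⁻¹ * m ≤ 1 := by
      rcases Nat.eq_zero_or_pos k with rfl | hk
      · simp
      · rw [inv_mul_le_iff₀ (by exact_mod_cast hk), mul_one]
        exact_mod_cast hmk
    have hk : (k : ℝ)⁻¹ ≤ 1 := Nat.cast_inv_le_one k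
    have hk0 : 0 ≤ (k : ℝ)⁻¹ := by positivity
    have hm0 : 0 ≤ (k : ℝ)⁻¹ * m := by positivity
    rw [hexp]
    refine (norm_sub_le _ _).trans (add_le_add ((norm_add_le _ _).trans (add_le_add ?_ ?_)) ?_)
    · rw [norm_smul, Real.norm_eq_abs, abs_mul]
      gcongr
      refine mul_le_of_le_one_left (abs_nonneg _) ?_
      rw [abs_of_nonneg (by positivity)]
      exact pow_le_one₀ hk0 hk
    · rw [norm_smul, Real.norm_eq_abs, show ε k * (c * (m * τ)) =
        ((k : ℝ)⁻¹ * ((k : ℝ)⁻¹ * m)) * (c * τ) by simp only [ε]; ring, abs_mul _ (c * τ)]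
      gcongr
      refine mul_le_of_le_one_left (abs_nonneg _) ?_
      rw [abs_of_nonneg (by positivity)]
      exact mul_le_one₀ hk hm0 hm
    · rw [norm_smul, Real.norm_eq_abs, show ε k * (c * (m * τ) ^ 2) =
        ((k : ℝ)⁻¹ * m) ^ 2 * (c * τ ^ 2) by simp only [ε]; ring, abs_mul _ (c * τ ^ 2)]
      gcongr
      refine mul_le_of_le_one_left (abs_nonneg _) ?_
      rw [abs_of_nonneg (by positivity)]
      exact pow_le_one₀ hm0 hm
  · have h1 : Tendsto (fun k : ℕ => (((k : ℝ)⁻¹) ^ 2 * c) •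
        (single 1 0 1 : Matrix (Fin 2) (Fin 2) ℝ) +
        ((k : ℝ)⁻¹ * (c * τ)) • (single 0 0 1 - single 1 1 1) + s • single 0 1 1) atTop
        (𝓝 (((0 : ℝ) ^ 2 * c) • single 1 0 1 + ((0 : ℝ) * (c * τ)) •
          (single 0 0 1 - single 1 1 1) + s • single 0 1 1)) :=
      ((((hlim0.pow 2).mul_const c).smul_const _).add
        ((hlim0.mul_const _).smul_const _)).add_const _
    rw [zero_pow two_ne_zero, zero_mul, zero_mul, zero_smul, zero_smul, zero_add, zero_add] at h1
    refine h1.congr' ?_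
    filter_upwards [eventually_ne_atTop 0] with k hk
    have hk' : (k : ℝ) ≠ 0 := Nat.cast_ne_zero.2 hk
    rw [hexp, show ε k * (c * (k * τ)) = (k : ℝ)⁻¹ * (c * τ) by simp only [ε]; field_simp,
      show ε k * (c * (k * τ) ^ 2) = -s by simp only [ε, c]; field_simp, neg_smul, sub_neg_eq_add]
  · rw [Commute, SemiconjBy, coe_upperUni]
    ext i j
    fin_cases i <;> fin_cases j <;> simp [Matrix.mul_apply, Fin.sum_univ_two]
  · rw [coe_upperUni]
    ext i j
    fin_cases i <;> fin_cases j <;> simp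

variable {Λ : Subgroup (SLR 2)} [DiscreteTopology Λ] {μ : Measure (SLR 2 ⧸ Λ)}
  [IsProbabilityMeasure μ] [SMulInvariantMeasure (SLR 2) (SLR 2 ⧸ Λ) μ]
  {φ φ' : SLR 2 ⧸ Λ → SLR 2 ⧸ Λ}

theorem intertwines_upperUni (hφ : Measurable φ) (hmp : Measure.map φ μ = μ)
    (hφ' : Measurable φ') (hmp' : Measure.map φ' μ = μ) (h1 : ∀ᵐ x ∂μ, φ' (φ x) = x)
    (h2 : ∀ᵐ x ∂μ, φ (φ' x) = x) {τ : ℝ} (hτ : τ ≠ 0)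
    (H : Intertwines μ φ (upperUni τ) (upperUni τ)) (s : ℝ) :
    Intertwines μ φ (upperUni s) (upperUni s) := by
  have hτ1 : upperUni τ = shear ![τ, 0] ![0, 1] := by
    simpa using upperUni_eq_shear 1 τ
  obtain ⟨h, hh, -, Hh⟩ := (mateRelation_intertwines le_rfl hφ hmp hφ' hmp' h1 h2).exists_smul
    (a := ![τ, 0]) (b := ![0, 1]) (by simp) (N := τ • single 0 1 1) (q := upperUni τ) (by simp) (by
      rw [coe_upperUni]
      ext i j
      fin_cases i <;> fin_cases j <;> simp) (hτ1 ▸ H) (fun k _ => by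
      rw [← upperUni_eq_shear]
      exact (shearClosed_intertwines le_rfl hφ).upperUni_mem hτ
        ⟨_, isUnipotent_upperUni τ, H⟩ _) (s / τ)
  rw [← upperUni_eq_shear, div_mul_cancel₀ _ hτ] at Hh
  have h3 : h = upperUni s := by
    refine Subtype.ext (hh.trans ?_)
    rw [coe_upperUni, smul_smul, div_mul_cancel₀ _ hτ]
    ext i j
    fin_cases i <;> fin_cases j <;> simp
  rwa [h3] at Hh

end UpperRoots

section DiagonalMates

open Set Filter Topology
open scoped Matrix.Norms.Operator ENNReal

set_option linter.unusedSectionVars false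

attribute [local instance] t2Space_quotient_of_discrete

theorem abs_apply_le_norm {n : ℕ} (M : Matrix (Fin n) (Fin n) ℝ) (i j : Fin n) : |M i j| ≤ ‖M‖ := by
  rw [linfty_opNorm_def, ← Real.norm_eq_abs, ← coe_nnnorm, NNReal.coe_le_coe]
  exact (Finset.single_le_sum (f := fun j => ‖M i j‖₊) (fun _ _ => zero_le)
      (Finset.mem_univ j)).trans
    (Finset.le_sup (f := fun i => ∑ j, ‖M i j‖₊) (Finset.mem_univ i))

/-- An element of `SL(2,ℝ)` close to `1` commuting with the upper unipotents is upper unipotent. -/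
theorem exists_eq_upperUni {c : SLR 2} (hc : c * upperUni 1 = upperUni 1 * c)
    (hc1 : ‖(c : Matrix (Fin 2) (Fin 2) ℝ) - 1‖ < 1) : ∃ τ, c = upperUni τ := by
  obtain ⟨p, q, r, s, h⟩ : ∃ p q r s, (c : Matrix (Fin 2) (Fin 2) ℝ) = !![p, q; r, s] :=
    ⟨_, _, _, _, eta_fin_two _⟩
  have h1 := congrArg (fun g : SLR 2 => (g : Matrix (Fin 2) (Fin 2) ℝ)) hc
  simp only [Matrix.SpecialLinearGroup.coe_mul, coe_upperUni, h] at h1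
  have h00 := congrFun (congrFun h1 0) 0
  have h01 := congrFun (congrFun h1 0) 1
  simp at h00 h01
  have hdet := c.2
  rw [h, det_fin_two_of] at hdet
  have hp := (abs_apply_le_norm _ 0 0).trans_lt hc1
  rw [h] at hp
  simp at hp
  subst h00
  have hs : s = p := by linarith
  subst hs
  have hs1 : s = 1 := by
    have := (abs_lt.1 hp).1
    nlinarith
  exact ⟨q, Subtype.ext (by rw [h, coe_upperUni, hs1])⟩

variable {Λ : Subgroup (SLR 2)} [DiscreteTopology Λ] {μ : Measure (SLR 2 ⧸ Λ)}
  [IsProbabilityMeasure μ] [SMulInvariantMeasure (SLR 2) (SLR 2 ⧸ Λ) μ]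
  {φ φ' : SLR 2 ⧸ Λ → SLR 2 ⧸ Λ}

/-- The set where two maps related by `φ (a • ·)` and `a • φ` differ by a small centralizing
translation. -/
theorem eventually_exists_commute_smul (hφ : Measurable φ)
    (H : ∀ s, Intertwines μ φ (upperUni s) (upperUni s)) {δ : ℝ} (hδ : 0 < δ) :
    ∀ᶠ s in 𝓝 (0 : ℝ), μ {x | ∃ c ∈ {c : SLR 2 | ‖(c : Matrix (Fin 2) (Fin 2) ℝ) - 1‖ ≤ δ ∧
      c * upperUni 1 = upperUni 1 * c},
      (expDiag s)⁻¹ • φ (expDiag s • x) = c • φ x} ≠ 0 := by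
  have hq : 0 < 4 * (2 * 2 + 1) ^ 2 := by norm_num
  obtain ⟨K, hK, hφK, hgood⟩ := exists_good_set μ hφ (4 * (2 * 2 + 1) ^ 2) (ε := 4⁻¹) (by simp)
  obtain ⟨δ', hδ', hcore⟩ := exists_forall_norm_conj_lt (isUnipotent_upperUni 1)
    (hK.image_of_continuousOn hφK) hδ
  have hcont : Tendsto (fun p : SLR 2 × SLR 2 => p.1⁻¹ * p.2) (𝓝 1 ×ˢ 𝓝 1) (𝓝 1) := by
    simpa using (tendsto_fst.inv.mul tendsto_snd :
      Tendsto (fun p : SLR 2 × SLR 2 => p.1⁻¹ * p.2) (𝓝 1 ×ˢ 𝓝 1) (𝓝 (1⁻¹ * 1)))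
  obtain ⟨B, hB, hBB⟩ := eventually_prod_self_iff'.1 (hcont.eventually
    (eventually_norm_sub_one_lt hδ'))
  have hlim : Tendsto expDiag (𝓝 0) (𝓝 1) := by
    simpa [expDiag_zero] using continuous_expDiag.tendsto 0
  filter_upwards [hlim.eventually (eventually_exists_smul_eq hK hφK hB), hlim hB] with s hs hsB
  set a := expDiag s
  set u := upperUni 1
  obtain ⟨E₁, hE₁, hμE₁, hEK₁⟩ := hgood u
  obtain ⟨E₂, hE₂, hμE₂, hEK₂⟩ := hgood (a * u * a⁻¹)
  have Hu : Intertwines μ φ (a * u * a⁻¹) (a * u * a⁻¹) := by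
    rw [expDiag_mul_upperUni]
    exact H _
  have hpow : ∀ᵐ x ∂μ, ∀ m : ℕ, φ (u ^ m • x) = u ^ m • φ x := ae_all_iff.2 fun m => (H 1).pow m
  have hpowa := ae_smul μ (ae_all_iff.2 fun m => Hu.pow m) a
  have hmem₁ : ∀ x ∈ E₁, x ∈ K := fun x hx => by
    simpa using apply_zero_of_dense (p := fun m => u ^ m • x ∈ K) hq (hEK₁ x hx)
  have hmem₂ : ∀ x ∈ E₂, x ∈ K := fun x hx => by
    simpa using apply_zero_of_dense (p := fun m => (a * u * a⁻¹) ^ m • x ∈ K) hq (hEK₂ x hx)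
  have hconj : ∀ m : ℕ, (a * u * a⁻¹) ^ m * a = a * u ^ m := fun m => by
    rw [conj_pow, inv_mul_cancel_right]
  set E : Set (SLR 2 ⧸ Λ) := E₁ ∩ (fun x => a • x) ⁻¹' E₂ ∩
    {x | (∀ m : ℕ, φ (u ^ m • x) = u ^ m • φ x) ∧
      ∀ m : ℕ, φ ((a * u * a⁻¹) ^ m • a • x) = (a * u * a⁻¹) ^ m • φ (a • x)}
  have hμE : μ Eᶜ ≤ 2⁻¹ := by
    rw [compl_inter, compl_inter, ← preimage_compl]
    refine (measure_union_le _ _).trans ?_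
    rw [show μ {x | (∀ m : ℕ, φ (u ^ m • x) = u ^ m • φ x) ∧
      ∀ m : ℕ, φ ((a * u * a⁻¹) ^ m • a • x) = (a * u * a⁻¹) ^ m • φ (a • x)}ᶜ = 0 from
      mem_ae_iff.1 (hpow.and hpowa), add_zero]
    refine (measure_union_le _ _).trans ?_
    rw [(measurePreserving_smul a μ).measure_preimage hE₂.compl.nullMeasurableSet]
    refine (add_le_add hμE₁ hμE₂).trans_eq ?_
    rw [← two_mul, show (4 : ℝ≥0∞) = 2 * 2 by norm_num, ENNReal.mul_inv (by simp) (by simp),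
      ← mul_assoc, ENNReal.mul_inv_cancel (by simp) (by simp), one_mul]
  have hE0 : μ E ≠ 0 := fun h0 => by
    have h1 : (1 : ℝ≥0∞) ≤ 2⁻¹ := by
      calc (1 : ℝ≥0∞) = μ (E ∪ Eᶜ) := by rw [union_compl_self, measure_univ]
        _ ≤ μ E + μ Eᶜ := measure_union_le _ _
        _ ≤ 2⁻¹ := by rwa [h0, zero_add]
    exact absurd h1 (not_le.2 ENNReal.one_half_lt_one)
  refine fun h0 => hE0 (measure_mono_null ?_ h0)
  rintro x ⟨⟨hx, hax⟩, hx1, hx2⟩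
  obtain ⟨h, hh, hφh⟩ := hs x (hmem₁ x hx) (hmem₂ _ hax)
  have hbound : ∀ m : ℕ, ‖((u ^ m * (a⁻¹ * h) * (u ^ m)⁻¹ : SLR 2) : Matrix (Fin 2) (Fin 2) ℝ) - 1‖
      < δ := fun m => by
    refine hcore m (a⁻¹ * h) (φ x)
      (fun m => u ^ m • x ∈ K ∧ (a * u * a⁻¹) ^ m • a • x ∈ K) (hBB a hsB h hh)
      (fun m _ hg => ?_) (fun M hM => ?_) m le_rfl
    · have hg2 : a • u ^ m • x ∈ K := by
        rw [smul_smul, ← hconj, mul_smul]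
        exact hg.2
      obtain ⟨h₂, hh₂, heq⟩ := hs _ hg.1 hg2
      refine ⟨hx1 m ▸ mem_image_of_mem φ hg.1, a⁻¹ * h₂, hBB a hsB h₂ hh₂, ?_⟩
      rw [smul_smul a, ← hconj, mul_smul, hx2, hφh, hx1, conj_pow, mul_smul, mul_smul] at heq
      rw [mul_smul a⁻¹ h₂, ← heq, inv_smul_smul, mul_smul]
    · exact card_filter_lt_of_dense (hEK₁ x hx M hM) (hEK₂ _ hax M hM)
  refine ⟨a⁻¹ * h, ⟨?_, ?_⟩, ?_⟩
  · simpa using (hbound 0).le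
  · exact (Commute.of_bounded_conj (isUnipotent_upperUni 1) fun m => (hbound m).le).symm
  · rw [hφh, mul_smul]

end DiagonalMates

section DiagonalMates

open Set Filter Topology
open scoped Matrix.Norms.Operator ENNReal

set_option linter.unusedSectionVars false

attribute [local instance] t2Space_quotient_of_discrete

theorem isCompact_norm_sub_one_le_centralizer (δ : ℝ) (u : SLR 2) :
    IsCompact {c : SLR 2 | ‖(c : Matrix (Fin 2) (Fin 2) ℝ) - 1‖ ≤ δ ∧ c * u = u * c} :=
  (isCompact_norm_sub_one_le δ).inter_right
    (isClosed_eq (continuous_id.mul continuous_const) (continuous_const.mul continuous_id))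

theorem upperUni_mul_expDiag (t s : ℝ) :
    upperUni t * expDiag s = expDiag s * upperUni (Real.exp (-(2 * s)) * t) := by
  have h := expDiag_mul_upperUni s (Real.exp (-(2 * s)) * t)
  rw [← mul_assoc, ← Real.exp_add, add_neg_cancel, Real.exp_zero, one_mul,
    mul_inv_eq_iff_eq_mul] at h
  exact h.symm

theorem upperUni_injective : Function.Injective upperUni := fun s t h => by
  have h2 := congrArg (fun g : SLR 2 => (g : Matrix (Fin 2) (Fin 2) ℝ) 0 1) h
  simpa [coe_upperUni] using h2

theorem upperUni_conj_expDiag (b s : ℝ) : upperUni b * expDiag s * (upperUni b)⁻¹ =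
    expDiag s * upperUni (Real.exp (-(2 * s)) * b - b) := by
  rw [upperUni_mul_expDiag, upperUni_inv, mul_assoc, upperUni_mul, sub_eq_add_neg]

theorem Intertwines.expDiag_eq {Λ : Subgroup (SLR 2)} [DiscreteTopology Λ]
    {μ : Measure (SLR 2 ⧸ Λ)} [IsProbabilityMeasure μ]
    [SMulInvariantMeasure (SLR 2) (SLR 2 ⧸ Λ) μ]
    {φ : SLR 2 ⧸ Λ → SLR 2 ⧸ Λ} (hφ : Measurable φ)
    (hmp : Measure.map φ μ = μ) {s t σ τ : ℝ}
    (Hs : Intertwines μ φ (expDiag s) (expDiag s * upperUni σ))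
    (Ht : Intertwines μ φ (expDiag t) (expDiag t * upperUni τ)) :
    Real.exp (-(2 * t)) * σ + τ = Real.exp (-(2 * s)) * τ + σ := by
  have H := (Hs.mul Ht).inv.mul (Ht.mul Hs)
  have hexp : ∀ s t σ τ, expDiag s * upperUni σ * (expDiag t * upperUni τ) =
      expDiag (s + t) * upperUni (Real.exp (-(2 * t)) * σ + τ) := fun s t σ τ => by
    rw [mul_assoc, ← mul_assoc (upperUni σ), upperUni_mul_expDiag, mul_assoc, upperUni_mul,
      ← mul_assoc, expDiag_mul]
  rw [expDiag_mul, expDiag_mul, hexp, hexp, add_comm t s, inv_mul_cancel, _root_.mul_inv_rev,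
    mul_assoc, inv_mul_cancel_left, upperUni_inv, upperUni_mul] at H
  have h1 := H.unique le_rfl hφ hmp Intertwines.one (isUnipotent_upperUni _)
    (upperUni_zero ▸ isUnipotent_upperUni 0)
  rw [← upperUni_zero] at h1
  linarith [upperUni_injective h1]

variable {Λ : Subgroup (SLR 2)} [DiscreteTopology Λ] {μ : Measure (SLR 2 ⧸ Λ)}
  [IsProbabilityMeasure μ] [SMulInvariantMeasure (SLR 2) (SLR 2 ⧸ Λ) μ]
  {φ φ' : SLR 2 ⧸ Λ → SLR 2 ⧸ Λ}

theorem eventually_exists_intertwines_expDiag (hφ : Measurable φ)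
    (H : ∀ s, Intertwines μ φ (upperUni s) (upperUni s)) :
    ∀ᶠ s in 𝓝 (0 : ℝ), ∃ τ, Intertwines μ φ (expDiag s) (expDiag s * upperUni τ) := by
  filter_upwards [eventually_exists_commute_smul hφ H (δ := 1 / 2) (by norm_num)] with s hs
  have hψ : Measurable fun x => (expDiag s)⁻¹ • φ (expDiag s • x) :=

    (hφ.comp (measurable_const_smul (expDiag s))).const_smul (expDiag s)⁻¹
  have hψu : Intertwines μ (fun x => (expDiag s)⁻¹ • φ (expDiag s • x)) (upperUni 1)
      (upperUni 1) := by
    have h := (H (Real.exp (2 * s) * 1)).conj (expDiag s) (expDiag s)⁻¹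
    rw [← expDiag_mul_upperUni] at h
    simpa [mul_assoc] using h
  have hu1 : upperUni 1 ≠ 1 := fun h => by
    rw [← upperUni_zero] at h
    exact one_ne_zero (upperUni_injective h)
  obtain ⟨c, ⟨hc1, hc⟩, hcx⟩ := exists_ae_eq_smul (fun t ht htu =>
      measure_eq_zero_or_compl_of_isUnipotent le_rfl (isUnipotent_upperUni 1) hu1 ht htu)
    hφ hψ (H 1) hψu (isCompact_norm_sub_one_le_centralizer (1 / 2) (upperUni 1))
    (fun c hc => hc.2) hs
  obtain ⟨τ, rfl⟩ := exists_eq_upperUni hc (hc1.trans_lt (by norm_num))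
  refine ⟨τ, hcx.mono fun x hx => ?_⟩
  rw [mul_smul, ← hx, smul_inv_smul]

/-- Up to conjugation by a fixed upper unipotent, `φ` commutes with the diagonal subgroup. -/
theorem exists_intertwines_expDiag (hφ : Measurable φ) (hmp : Measure.map φ μ = μ)
    (H : ∀ s, Intertwines μ φ (upperUni s) (upperUni s)) :
    ∃ b, ∀ s, Intertwines μ φ (expDiag s) (upperUni b * expDiag s * (upperUni b)⁻¹) := by
  have hev := eventually_exists_intertwines_expDiag hφ H
  obtain ⟨S, hS, hS0⟩ := ((hev.filter_mono nhdsWithin_le_nhds).and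
    (self_mem_nhdsWithin : Ioi (0 : ℝ) ∈ 𝓝[>] 0)).exists
  obtain ⟨σ, hσ⟩ := hS
  have hlt : Real.exp (-(2 * S)) - 1 < 0 := sub_neg.2 (Real.exp_lt_one_iff.2 (by simpa using hS0))
  refine ⟨σ / (Real.exp (-(2 * S)) - 1), fun s => ?_⟩
  set b := σ / (Real.exp (-(2 * S)) - 1)
  have hb : σ = b * (Real.exp (-(2 * S)) - 1) := (div_mul_cancel₀ _ hlt.ne).symm
  have hsmall : ∀ᶠ s in 𝓝 (0 : ℝ),
      Intertwines μ φ (expDiag s) (upperUni b * expDiag s * (upperUni b)⁻¹) := by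
    filter_upwards [hev] with t ⟨τ, ht⟩
    have h := Intertwines.expDiag_eq hφ hmp ht hσ
    rw [hb] at h
    have h2 : τ = Real.exp (-(2 * t)) * b - b :=
      mul_right_cancel₀ hlt.ne (by linear_combination h)
    rwa [upperUni_conj_expDiag, ← h2]
  have hlim : Tendsto (fun k : ℕ => (k : ℝ)⁻¹ * s) atTop (𝓝 0) := by
    simpa using (tendsto_inv_atTop_nhds_zero_nat (𝕜 := ℝ)).mul_const s
  obtain ⟨k, hk, hk0⟩ := ((hlim.eventually hsmall).and (eventually_gt_atTop 0)).exists
  have h := hk.pow k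
  rwa [conj_pow, expDiag_pow, mul_inv_cancel_left₀ (by exact_mod_cast hk0.ne')] at h

end DiagonalMates

section LowerRoots

open Set Filter Topology
open scoped Matrix.Norms.Operator ENNReal

set_option linter.unusedSectionVars false

attribute [local instance] t2Space_quotient_of_discrete

theorem norm_le_of_forall_abs_apply_le {M : Matrix (Fin 2) (Fin 2) ℝ} {B : ℝ} (hB : 0 ≤ B)
    (h : ∀ i j, |M i j| ≤ B) : ‖M‖ ≤ 2 * B := by
  lift B to NNReal using hB
  rw [linfty_opNorm_def, show (2 : ℝ) * B = ((2 * B : NNReal) : ℝ) by push_cast; rfl,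
    NNReal.coe_le_coe]
  refine Finset.sup_le fun i _ => (Finset.sum_le_card_nsmul _ _ B fun j _ => ?_).trans_eq (by simp)
  exact_mod_cast h i j

theorem coe_upperUni_conj {h : SLR 2} {α β γ d : ℝ}
    (hh : (h : Matrix (Fin 2) (Fin 2) ℝ) = !![α, β; γ, d]) (t : ℝ) :
    ((upperUni t * h * (upperUni t)⁻¹ : SLR 2) : Matrix (Fin 2) (Fin 2) ℝ) =
      !![α + t * γ, β + t * (d - α) - t ^ 2 * γ; γ, d - t * γ] := by
  rw [upperUni_inv]
  simp only [Matrix.SpecialLinearGroup.coe_mul, coe_upperUni, hh]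
  ext i j
  fin_cases i <;> fin_cases j <;> simp <;> ring

theorem coe_expDiag_conj {h : SLR 2} {α β γ d : ℝ}
    (hh : (h : Matrix (Fin 2) (Fin 2) ℝ) = !![α, β; γ, d]) {L : ℝ} (hL : 0 < L) :
    ((expDiag (-Real.log L) * h * (expDiag (-Real.log L))⁻¹ : SLR 2) :
      Matrix (Fin 2) (Fin 2) ℝ) = !![α, β / L ^ 2; γ * L ^ 2, d] := by
  rw [expDiag_inv]
  simp only [Matrix.SpecialLinearGroup.coe_mul, coe_expDiag, hh, neg_neg, Real.exp_neg,
    Real.exp_log hL]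
  ext i j
  fin_cases i <;> fin_cases j <;> simp <;> field_simp

theorem expDiag_conj_lowerUni (t : ℝ) {L : ℝ} (hL : 0 < L) :
    expDiag (-Real.log L) * lowerUni t * (expDiag (-Real.log L))⁻¹ = lowerUni (t * L ^ 2) :=
  Subtype.ext (by rw [coe_expDiag_conj (coe_lowerUni t) hL, zero_div, coe_lowerUni])

/-- The matrices close to lower unipotents, as they arise by rescaling a matrix whose conjugates
by upper unipotents stay bounded for a long time. -/
def NearLowerUni (η : ℝ) (h : SLR 2) : Prop :=
  |(h : Matrix (Fin 2) (Fin 2) ℝ) 0 0 - 1| ≤ 1 / 2 ∧ |(h : Matrix (Fin 2) (Fin 2) ℝ) 0 1| ≤ η ∧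
  |(h : Matrix (Fin 2) (Fin 2) ℝ) 1 0| ≤ 6 ∧
  |(h : Matrix (Fin 2) (Fin 2) ℝ) 1 1 - (h : Matrix (Fin 2) (Fin 2) ℝ) 0 0| ≤ 5 * η

theorem NearLowerUni.mono {η η' : ℝ} {h : SLR 2} (H : NearLowerUni η h) (hη : η ≤ η') :
    NearLowerUni η' h :=
  ⟨H.1, H.2.1.trans hη, H.2.2.1, H.2.2.2.trans (by linarith)⟩

theorem nearLowerUni_of_norm_conj {l : ℕ} (hl : 1 ≤ l) {h : SLR 2}
    (H : ∀ m ≤ 2 * l, ‖((upperUni 1 ^ m * h * (upperUni 1 ^ m)⁻¹ : SLR 2) :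
      Matrix (Fin 2) (Fin 2) ℝ) - 1‖ < 1 / 2) :
    NearLowerUni (1 / l) (expDiag (-Real.log (2 * l)) * h * (expDiag (-Real.log (2 * l)))⁻¹) := by
  obtain ⟨α, β, γ, d, hh⟩ : ∃ α β γ d, (h : Matrix (Fin 2) (Fin 2) ℝ) = !![α, β; γ, d] :=
    ⟨_, _, _, _, eta_fin_two _⟩
  have hl1 : (1 : ℝ) ≤ l := by exact_mod_cast hl
  have hl0 : (0 : ℝ) < l := by linarith
  have hent : ∀ m ≤ 2 * l, |α + m * γ - 1| ≤ 1 / 2 ∧ |β + m * (d - α) - m ^ 2 * γ| ≤ 1 / 2 := by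
    intro m hm
    have h1 := (H m hm).le
    rw [upperUni_pow, mul_one] at h1
    have h00 := (abs_apply_le_norm _ 0 0).trans h1
    have h01 := (abs_apply_le_norm _ 0 1).trans h1
    rw [coe_upperUni_conj hh] at h00 h01
    simp at h00 h01
    exact ⟨by linarith, by linarith⟩
  have h0 := hent 0 (by omega)
  have h1 := (hent l (by omega)).2
  have h2 := (hent (2 * l) le_rfl).2
  push_cast at h0 h1 h2
  simp only [zero_mul, add_zero, zero_pow two_ne_zero, sub_zero] at h0
  obtain ⟨h00, h01⟩ := h0
  rw [abs_le] at h00 h01 h1 h2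
  rw [NearLowerUni, coe_expDiag_conj hh (by positivity)]
  simp only [of_apply, cons_val', cons_val_zero, cons_val_one, cons_val_fin_one]
  refine ⟨abs_le.2 h00, ?_, ?_, ?_⟩
  · rw [abs_div, abs_of_pos (by positivity : (0 : ℝ) < (2 * l) ^ 2),
      div_le_div_iff₀ (by positivity) hl0, one_mul]
    have : |β| ≤ 1 / 2 := abs_le.2 h01
    nlinarith
  · rw [abs_le]
    constructor <;> nlinarith
  · rw [← mul_div_assoc, le_div_iff₀ hl0, ← abs_of_pos hl0, ← abs_mul, abs_le]
    constructor <;> nlinarith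

theorem NearLowerUni.norm_sub_one_le {η : ℝ} {h : SLR 2} (H : NearLowerUni η h) (hη : η ≤ 1) :
    ‖(h : Matrix (Fin 2) (Fin 2) ℝ) - 1‖ ≤ 2 * 6 := by
  obtain ⟨h1, h2, h3, h4⟩ := H
  refine norm_le_of_forall_abs_apply_le (by norm_num) fun i j => ?_
  rw [abs_le] at h1 h2 h3 h4 ⊢
  fin_cases i <;> fin_cases j <;> simp <;> constructor <;> linarith

theorem eq_lowerUni_of_tendsto {η : ℕ → ℝ} (hη : Tendsto η atTop (𝓝 0)) {h : ℕ → SLR 2}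
    (H : ∀ j, NearLowerUni (η j) (h j)) {h₀ : SLR 2} (hh : Tendsto h atTop (𝓝 h₀)) :
    ∃ γ, |γ| ≤ 6 ∧ h₀ = lowerUni γ := by
  have hent : ∀ a b, Tendsto (fun j => (h j : Matrix (Fin 2) (Fin 2) ℝ) a b) atTop
      (𝓝 ((h₀ : Matrix (Fin 2) (Fin 2) ℝ) a b)) := fun a b =>
    tendsto_pi_nhds.1 (tendsto_pi_nhds.1 (tendsto_SLR_iff.1 hh) a) b
  have h00 := le_of_tendsto' ((hent 0 0).sub_const 1).abs fun j => (H j).1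
  have h01 := le_of_tendsto_of_tendsto' (hent 0 1).abs hη fun j => (H j).2.1
  have h10 := le_of_tendsto' (hent 1 0).abs fun j => (H j).2.2.1
  have h11 := le_of_tendsto_of_tendsto' ((hent 1 1).sub (hent 0 0)).abs (hη.const_mul 5)
    fun j => (H j).2.2.2
  obtain ⟨α, β, γ, d, h⟩ : ∃ α β γ d, (h₀ : Matrix (Fin 2) (Fin 2) ℝ) = !![α, β; γ, d] :=
    ⟨_, _, _, _, eta_fin_two _⟩
  have hdet := h₀.2
  rw [h] at h00 h01 h10 h11 hdet
  rw [det_fin_two_of] at hdet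
  simp at h00 h01 h10 h11
  have hd : d = α := by linarith
  subst hd h01
  have hd1 : d = 1 := by
    have := (abs_le.1 h00).1
    nlinarith
  exact ⟨γ, h10, Subtype.ext (by rw [h, coe_lowerUni, hd1])⟩

end LowerRoots

section LowerMates

open Set Filter Topology
open scoped Matrix.Norms.Operator ENNReal

set_option linter.unusedSectionVars false

attribute [local instance] t2Space_quotient_of_discrete

theorem measure_compl_conj_le {G : Type*} [Group G] [TopologicalSpace G] [IsTopologicalGroup G]
    [LocallyCompactSpace G] [PolishSpace G] [MeasurableSpace G] [BorelSpace G] {Γ : Subgroup G}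
    [DiscreteTopology Γ] {μ : Measure (G ⧸ Γ)} [IsProbabilityMeasure μ]
    [SMulInvariantMeasure G (G ⧸ Γ) μ] {φ : G ⧸ Γ → G ⧸ Γ} {a b : G}
    (H : Intertwines μ φ a b) (g : G) {Q Q' : Set G} (hQ : ∀ h ∈ Q, b * h * b⁻¹ ∈ Q') :
    μ {x | ∃ h ∈ Q', φ ((a * g * a⁻¹) • x) = h • φ x}ᶜ ≤
      μ {x | ∃ h ∈ Q, φ (g • x) = h • φ x}ᶜ := by
  rw [← measure_preimage_smul μ a]
  refine measure_mono_ae ?_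
  have H' : ∀ᵐ x ∂μ, φ (a • x) = b • φ x := H
  filter_upwards [H', ae_smul μ H' g] with x h1 h2 hx
  refine fun ⟨h, hh, hφ⟩ => hx ⟨b * h * b⁻¹, hQ h hh, ?_⟩
  change φ ((a * g * a⁻¹) • a • x) = (b * h * b⁻¹) • φ (a • x)
  rw [h1, smul_smul, smul_smul, inv_mul_cancel_right, inv_mul_cancel_right, mul_smul, h2, hφ,
    mul_smul]

variable {Λ : Subgroup (SLR 2)} [DiscreteTopology Λ] {μ : Measure (SLR 2 ⧸ Λ)}
  [IsProbabilityMeasure μ] [SMulInvariantMeasure (SLR 2) (SLR 2 ⧸ Λ) μ]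
  {φ φ' : SLR 2 ⧸ Λ → SLR 2 ⧸ Λ}

/-- If `φ` commutes with the upper unipotents and the diagonal matrices, then for most `x` a point
on the lower unipotent orbit of `x` is sent to a point on the lower unipotent orbit of `φ x`. -/
theorem exists_measure_compl_lowerUni_le (hφ : Measurable φ)
    (Hu : Intertwines μ φ (upperUni 1) (upperUni 1))
    (Ha : ∀ s, Intertwines μ φ (expDiag s) (expDiag s)) {ε : ℝ≥0∞} (hε : ε ≠ 0) (hε' : ε ≠ ⊤) :
    ∃ c > 0, μ {x | ∃ h ∈ {h | ∃ γ, |γ| ≤ 6 ∧ h = lowerUni γ},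
      φ (lowerUni c • x) = h • φ x}ᶜ ≤ ε := by
  obtain ⟨V, hV, hshadow⟩ := exists_shadow hφ Hu (isUnipotent_upperUni 1)
    (ENNReal.half_pos hε).ne' (δ := 1 / 2) (by norm_num)
  obtain ⟨δ, hδ, hδV⟩ := exists_norm_sub_one_lt_subset hV
  set c : ℝ := δ / 3
  have hc : 0 < c := by positivity
  have hlim : Tendsto (fun l : ℕ => lowerUni (c / (2 * l) ^ 2)) atTop (𝓝 1) := by
    have h1 : Tendsto (fun l : ℕ => c / (2 * (l : ℝ)) ^ 2) atTop (𝓝 0) := by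
      refine tendsto_const_nhds.div_atTop ?_
      refine (tendsto_pow_atTop two_ne_zero).comp ?_
      exact tendsto_natCast_atTop_atTop.const_mul_atTop two_pos
    rw [← lowerUni_zero]
    exact (continuous_lowerUni.tendsto 0).comp h1
  obtain ⟨N, hN⟩ := eventually_atTop.1 (hlim.eventually (hshadow 1 one_pos))
  have hE : ∀ k : ℕ, μ {x | ∃ h ∈ {h | NearLowerUni (1 / (N + k + 1 : ℕ)) h},
      φ (lowerUni c • x) = h • φ x}ᶜ ≤ ε / 2 := fun k => by
    set l := N + k + 1
    have hl1 : (1 : ℝ) ≤ l := by exact_mod_cast (by omega : 1 ≤ l)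
    have hl : (0 : ℝ) < 2 * l := by positivity
    obtain ⟨E, hE, hEx⟩ := hN l (by omega) (2 * l) fun m hm => hδV _ (by
      have hml : (m : ℝ) ≤ 2 * l := by exact_mod_cast hm
      have hm0 : (0 : ℝ) ≤ m := m.cast_nonneg
      rw [upperUni_pow, mul_one, coe_upperUni_conj (coe_lowerUni _)]
      have hb : ∀ t, 0 ≤ t → t ≤ (2 * (l : ℝ)) ^ 2 → t * (c / (2 * l) ^ 2) ≤ c := fun t ht htl => by
        rw [mul_div_assoc', div_le_iff₀ (by positivity), mul_comm]
        exact mul_le_mul_of_nonneg_left htl hc.le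
      have hr : 0 ≤ c / (2 * (l : ℝ)) ^ 2 := by positivity
      have h1 := hb 1 zero_le_one (by nlinarith)
      have h2 := hb m hm0 (by nlinarith)
      have h3 := hb (m ^ 2) (by positivity) (by nlinarith)
      have h2' := mul_nonneg hm0 hr
      have h3' := mul_nonneg (pow_nonneg hm0 2) hr
      refine (norm_le_of_forall_abs_apply_le hc.le fun i j => ?_).trans_lt
        (show 2 * c < δ by simp only [c]; linarith)
      fin_cases i <;> fin_cases j <;> simp [-abs_mul, -abs_pow] <;> rw [abs_le] <;>
        constructor <;> linarith)
    have hconj := measure_compl_conj_le (Ha (-Real.log (2 * l))) (lowerUni (c / (2 * l) ^ 2))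
      (Q := {h | ∀ m ≤ 2 * l, ‖((upperUni 1 ^ m * h * (upperUni 1 ^ m)⁻¹ : SLR 2) :
        Matrix (Fin 2) (Fin 2) ℝ) - 1‖ < 1 / 2})
      (Q' := {h | NearLowerUni (1 / l) h}) fun h hh => nearLowerUni_of_norm_conj (by omega) hh
    rw [expDiag_conj_lowerUni _ hl, div_mul_cancel₀ _ (by positivity)] at hconj
    refine hconj.trans ((measure_mono (compl_subset_compl.2 fun x hx => ?_)).trans hE)
    obtain ⟨h, hh, -, hh'⟩ := hEx x hx
    exact ⟨h, hh', hh⟩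
  have hη1 : ∀ k : ℕ, (1 : ℝ) / (N + k + 1 : ℕ) ≤ 1 / (k + 1) := fun k =>
    one_div_le_one_div_of_le (by positivity) (by push_cast; linarith [N.cast_nonneg (α := ℝ)])
  refine ⟨c, hc, measure_compl_intertwined_le hφ tendsto_const_nhds hE
    (ENNReal.half_lt_self hε hε') (fun k h => NearLowerUni (1 / (k + 1)) h)
    (fun k x hx => ?_) (isCompact_norm_sub_one_le (2 * 6)) (fun k h hh =>
      hh.norm_sub_one_le ?_) _ fun k h h₀ hk hP hh => ?_⟩
  · obtain ⟨h, hh, hx⟩ := hx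
    exact ⟨h, NearLowerUni.mono hh (hη1 k), hx⟩
  · rw [div_le_one (by positivity)]
    linarith [k.cast_nonneg (α := ℝ)]
  · exact eq_lowerUni_of_tendsto (tendsto_one_div_add_atTop_nhds_zero_nat.comp hk.tendsto_atTop)
      hP hh

theorem exists_forall_measure_compl_lowerUni_le (hφ : Measurable φ)
    (Hu : Intertwines μ φ (upperUni 1) (upperUni 1))
    (Ha : ∀ s, Intertwines μ φ (expDiag s) (expDiag s)) {ε : ℝ≥0∞} (hε : ε ≠ 0) (hε' : ε ≠ ⊤) :
    ∃ C ≥ 0, ∀ r > 0, μ {x | ∃ h ∈ {h | ∃ γ, |γ| ≤ C * r ∧ h = lowerUni γ},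
      φ (lowerUni r • x) = h • φ x}ᶜ ≤ ε := by
  obtain ⟨c, hc, hμ⟩ := exists_measure_compl_lowerUni_le hφ Hu Ha hε hε'
  refine ⟨6 / c, by positivity, fun r hr => ?_⟩
  have hL : 0 < √(r / c) := Real.sqrt_pos.2 (by positivity)
  have hL2 : √(r / c) ^ 2 = r / c := Real.sq_sqrt (by positivity)
  have hconj := measure_compl_conj_le (Ha (-Real.log √(r / c))) (lowerUni c)
    (Q := {h | ∃ γ, |γ| ≤ 6 ∧ h = lowerUni γ})
    (Q' := {h | ∃ γ, |γ| ≤ 6 / c * r ∧ h = lowerUni γ}) (by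
      rintro _ ⟨γ, hγ, rfl⟩
      refine ⟨γ * (r / c), ?_, by rw [expDiag_conj_lowerUni _ hL, hL2]⟩
      rw [abs_mul, abs_of_pos (div_pos hr hc), div_mul_comm, mul_comm (r / c)]
      exact mul_le_mul_of_nonneg_right hγ (by positivity))
  rw [expDiag_conj_lowerUni _ hL, hL2, mul_div_cancel₀ _ hc.ne'] at hconj
  exact hconj.trans hμ

end LowerMates

section LowerCommutes

open Set Filter Topology
open scoped Matrix.Norms.Operator ENNReal

set_option linter.unusedSectionVars false

attribute [local instance] t2Space_quotient_of_discrete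

theorem upperUni_mul_lowerUni (r : ℝ) : upperUni r * lowerUni r =
    lowerUni (r / (1 + r ^ 2)) * expDiag (Real.log (1 + r ^ 2)) *
      upperUni (r / (1 + r ^ 2)) := by
  have h : 0 < 1 + r ^ 2 := by positivity
  refine Subtype.ext ?_
  simp only [Matrix.SpecialLinearGroup.coe_mul, coe_expDiag, coe_upperUni, coe_lowerUni,
    Real.exp_neg, Real.exp_log h]
  ext i j
  fin_cases i <;> fin_cases j <;> simp <;> field_simp
  ring

theorem eq_of_upperUni_mul_lowerUni {r γ γ' : ℝ} (hr : r ≠ 0)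
    (h : upperUni r * lowerUni γ = lowerUni γ' * expDiag (Real.log (1 + r ^ 2)) *
      upperUni (r / (1 + r ^ 2))) : γ = r := by
  have h1 := congrArg (fun g : SLR 2 => (g : Matrix (Fin 2) (Fin 2) ℝ) 0 0) h
  simp only [Matrix.SpecialLinearGroup.coe_mul, coe_expDiag, coe_upperUni, coe_lowerUni,
    Real.exp_neg, Real.exp_log (by positivity : 0 < 1 + r ^ 2)] at h1
  simp at h1
  exact mul_left_cancel₀ hr (by linear_combination h1)

theorem exists_forall_bruhat_mem {W : Set (SLR 2)} (hW : W ∈ 𝓝 1) : ∃ ρ > 0,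
    ∀ γ γ' r σ s : ℝ, |γ| < ρ → |γ'| < ρ → |r| < ρ → |σ| < ρ → |s| < ρ →
      (lowerUni γ' * expDiag σ * upperUni s)⁻¹ * (upperUni r * lowerUni γ) ∈ W := by
  have hcont : Continuous fun p : Fin 5 → ℝ =>
      (lowerUni (p 1) * expDiag (p 3) * upperUni (p 4))⁻¹ * (upperUni (p 2) * lowerUni (p 0)) :=
    (((continuous_lowerUni.comp (continuous_apply 1)).mul
      (continuous_expDiag.comp (continuous_apply 3))).mul
      (continuous_upperUni.comp (continuous_apply 4))).inv.mul
      ((continuous_upperUni.comp (continuous_apply 2)).mul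
        (continuous_lowerUni.comp (continuous_apply 0)))
  have hlim := hcont.tendsto 0
  simp only [Pi.zero_apply, lowerUni_zero, upperUni_zero, expDiag_zero, mul_one, inv_one] at hlim
  obtain ⟨ρ, hρ, h⟩ := Metric.eventually_nhds_iff.1 (hlim.eventually hW)
  refine ⟨ρ, hρ, fun γ γ' r σ s h0 h1 h2 h3 h4 => ?_⟩
  refine h (y := ![γ, γ', r, σ, s]) ?_
  rw [dist_pi_lt_iff hρ]
  intro i
  fin_cases i <;> simpa

variable {Λ : Subgroup (SLR 2)} [DiscreteTopology Λ] {μ : Measure (SLR 2 ⧸ Λ)}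
  [IsProbabilityMeasure μ] [SMulInvariantMeasure (SLR 2) (SLR 2 ⧸ Λ) μ]
  {φ φ' : SLR 2 ⧸ Λ → SLR 2 ⧸ Λ}

theorem exists_measure_compl_lowerUni_eq_le (hφ : Measurable φ) (hmp : Measure.map φ μ = μ)
    (Hu : ∀ s, Intertwines μ φ (upperUni s) (upperUni s))
    (Ha : ∀ s, Intertwines μ φ (expDiag s) (expDiag s)) {ε : ℝ≥0∞} (hε : ε ≠ 0) (hε' : ε ≠ ⊤) :
    ∃ r > 0, μ {x | φ (lowerUni r • x) = lowerUni r • φ x}ᶜ ≤ ε + ε + ε := by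
  obtain ⟨C, hC, hμC⟩ := exists_forall_measure_compl_lowerUni_le hφ (Hu 1) Ha hε hε'
  obtain ⟨K, -, hK, -, hμK⟩ := exists_isCompact_continuousOn μ MeasurableSet.univ hφ hε
  rw [← compl_eq_univ_sdiff] at hμK
  obtain ⟨ρ, hρ, hρW⟩ := exists_forall_bruhat_mem (eventually_smul_eq_self_imp hK)
  obtain ⟨r, hr, hr1, hrρ, hCr⟩ : ∃ r > 0, r ≤ 1 ∧ r < ρ ∧ C * r < ρ := by
    have h1 : Tendsto (fun r : ℝ => C * r) (𝓝 0) (𝓝 0) := by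
      simpa using (tendsto_id (α := ℝ) (x := 𝓝 0)).const_mul C
    obtain ⟨r, ⟨⟨h1, h2⟩, h3⟩, h4⟩ := (((((eventually_lt_nhds hρ).and
      (h1.eventually (eventually_lt_nhds hρ))).and (eventually_le_nhds one_pos)).filter_mono
        nhdsWithin_le_nhds).and (self_mem_nhdsWithin : Ioi (0 : ℝ) ∈ 𝓝[>] 0)).exists
    exact ⟨r, h4, h3, h1, h2⟩
  refine ⟨r, hr, ?_⟩
  set t := r / (1 + r ^ 2)
  set a := expDiag (Real.log (1 + r ^ 2))
  have ht : 0 < t := by positivity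
  have htr : t ≤ r := div_le_self hr.le (by nlinarith)
  have hσ0 : 0 ≤ Real.log (1 + r ^ 2) := Real.log_nonneg (by nlinarith)
  have hσ : Real.log (1 + r ^ 2) ≤ r := by
    have := Real.log_le_sub_one_of_pos (by positivity : 0 < 1 + r ^ 2)
    nlinarith
  set Q : ℝ → Set (SLR 2) := fun r => {h | ∃ γ, |γ| ≤ C * r ∧ h = lowerUni γ}
  have hKφ : μ (φ ⁻¹' Kᶜ) ≤ ε := by
    rw [← Measure.map_apply hφ hK.measurableSet.compl, hmp]
    exact hμK.le
  have hpre := measure_preimage_smul μ (a * upperUni t)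
    {x | ∃ h ∈ Q t, φ (lowerUni t • x) = h • φ x}ᶜ
  refine le_trans ?_ (add_le_add (add_le_add (hμC r hr) (hpre.le.trans (hμC t ht))) hKφ)
  refine (measure_mono_ae ?_).trans ((measure_union_le _ _).trans
    (add_le_add_left (measure_union_le _ _) _))
  have Hu' : ∀ s, ∀ᵐ x ∂μ, φ (upperUni s • x) = upperUni s • φ x := Hu
  have Ha' : ∀ᵐ x ∂μ, φ (a • x) = a • φ x := Ha _
  filter_upwards [Hu' t, ae_smul μ (Hu' r) (lowerUni r), ae_smul μ Ha' (upperUni t)]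
    with x h1 h2 h3 hx
  by_contra hcon
  refine hx ?_
  obtain ⟨hc, hxK⟩ := not_or.1 hcon
  obtain ⟨ha, hb⟩ := not_or.1 hc
  obtain ⟨_, ⟨γ, hγ, rfl⟩, hxγ⟩ := not_not.1 ha
  obtain ⟨_, ⟨γ', hγ', rfl⟩, hxγ'⟩ := not_not.1 hb
  have hxK : φ x ∈ K := not_not.1 hxK
  beta_reduce at hxγ'
  rw [smul_smul, ← mul_assoc, ← upperUni_mul_lowerUni, mul_smul, h2, hxγ, mul_smul a, h3, h1,
    smul_smul, smul_smul, smul_smul] at hxγ'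
  have hCt : C * t ≤ C * r := mul_le_mul_of_nonneg_left htr hC
  have hmem := hρW γ γ' r (Real.log (1 + r ^ 2)) t (hγ.trans_lt hCr)
    ((hγ'.trans hCt).trans_lt hCr) (by rwa [abs_of_pos hr])
    (by rw [abs_of_nonneg hσ0]; exact hσ.trans_lt hrρ)
    (by rw [abs_of_pos ht]; exact htr.trans_lt hrρ)
  have h4 := hmem (φ x) hxK (by rw [mul_smul, hxγ', inv_smul_smul])
  have h5 := eq_of_upperUni_mul_lowerUni hr.ne' (inv_mul_eq_one.1 h4).symm
  rw [h5] at hxγ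
  exact hxγ

theorem intertwines_lowerUni (hφ : Measurable φ) (hmp : Measure.map φ μ = μ)
    (Hu : ∀ s, Intertwines μ φ (upperUni s) (upperUni s))
    (Ha : ∀ s, Intertwines μ φ (expDiag s) (expDiag s)) (t : ℝ) :
    Intertwines μ φ (lowerUni t) (lowerUni t) := by
  have hle : ∀ r > 0, ∀ t > 0, μ {x | φ (lowerUni t • x) = lowerUni t • φ x}ᶜ ≤
      μ {x | φ (lowerUni r • x) = lowerUni r • φ x}ᶜ := fun r hr t ht => by
    have hL : 0 < √(t / r) := Real.sqrt_pos.2 (by positivity)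
    have hL2 : √(t / r) ^ 2 = t / r := Real.sq_sqrt (by positivity)
    have h := measure_compl_conj_le (Ha (-Real.log √(t / r))) (lowerUni r)
      (Q := {lowerUni r}) (Q' := {lowerUni t}) (by
        rintro _ rfl
        rw [expDiag_conj_lowerUni _ hL, hL2, mul_div_cancel₀ _ hr.ne']
        rfl)
    rw [expDiag_conj_lowerUni _ hL, hL2, mul_div_cancel₀ _ hr.ne'] at h
    simpa using h
  have hpos : ∀ t > 0, Intertwines μ φ (lowerUni t) (lowerUni t) := fun t ht => by
    refine mem_ae_iff.2 (measure_eq_zero_of_forall_le fun ε hε => ?_)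
    rcases eq_or_ne ε ⊤ with rfl | hε'
    · exact le_top
    obtain ⟨r, hr, h⟩ := exists_measure_compl_lowerUni_eq_le hφ hmp Hu Ha
      (ENNReal.div_pos hε (by norm_num : (3 : ℝ≥0∞) ≠ ⊤)).ne' (ENNReal.div_ne_top hε' (by norm_num))
    exact ((hle r hr t ht).trans h).trans_eq (ENNReal.add_thirds ε)
  rcases lt_trichotomy t 0 with ht | rfl | ht
  · have h := (hpos (-t) (neg_pos.2 ht)).inv
    rwa [lowerUni_inv, neg_neg] at h
  · rw [lowerUni_zero]
    exact Intertwines.one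
  · exact hpos t ht

/-- A map commuting with a nontrivial upper unipotent commutes with all of `SL(2,ℝ)` up to
conjugation. -/
theorem exists_forall_intertwines_conj (hφ : Measurable φ) (hmp : Measure.map φ μ = μ)
    (hinj : ∃ s : Set (SLR 2 ⧸ Λ), μ sᶜ = 0 ∧ Set.InjOn φ s)
    {u : SLR 2} (hu : IsUnipotent 2 u) (hu1 : u ≠ 1) (H : Intertwines μ φ u u) :
    ∃ k : SLR 2, ∀ g, Intertwines μ φ g (k * g * k⁻¹) := by
  have htrans : ∀ a b : SLR 2, Measurable (fun x => b • φ (a • x)) ∧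
      Measure.map (fun x => b • φ (a • x)) μ = μ ∧
      ∃ s : Set (SLR 2 ⧸ Λ), μ sᶜ = 0 ∧ Set.InjOn (fun x => b • φ (a • x)) s := fun a b => by
    have hmpφ : MeasurePreserving φ μ μ := ⟨hφ, hmp⟩
    have h := (measurePreserving_smul b μ).comp (hmpφ.comp (measurePreserving_smul a μ))
    refine ⟨h.measurable, h.map_eq, ?_⟩
    obtain ⟨s, hs, hinj⟩ := hinj
    refine ⟨(fun x => a • x) ⁻¹' s, ?_, fun x hx y hy hxy => ?_⟩
    · rw [← preimage_compl, measure_preimage_smul, hs]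
    · exact smul_left_cancel a (hinj hx hy (smul_left_cancel b hxy))
  obtain ⟨g, τ, hτ, hg⟩ := exists_conj_eq_upperUni hu hu1
  obtain ⟨hφ₁, hmp₁, hinj₁⟩ := htrans g⁻¹ g
  have H₁ := H.conj g⁻¹ g
  rw [_root_.inv_inv, hg] at H₁
  obtain ⟨φ', hφ', hmp', h1, h2⟩ := exists_measurable_inverse hφ₁ hmp₁ hinj₁
  have Hu := intertwines_upperUni hφ₁ hmp₁ hφ' hmp' h1 h2 hτ H₁
  obtain ⟨b, hb⟩ := exists_intertwines_expDiag hφ₁ hmp₁ Hu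
  obtain ⟨hφ₂, hmp₂, -⟩ := htrans g⁻¹ ((upperUni b)⁻¹ * g)
  have hconj : ∀ {x y : SLR 2}, Intertwines μ (fun x => g • φ (g⁻¹ • x)) x y →
      Intertwines μ (fun x => ((upperUni b)⁻¹ * g) • φ (g⁻¹ • x)) x
        ((upperUni b)⁻¹ * y * upperUni b) := fun {x y} h => by
    simpa [mul_smul] using h.conj 1 (upperUni b)⁻¹
  have Hu₂ : ∀ s, Intertwines μ (fun x => ((upperUni b)⁻¹ * g) • φ (g⁻¹ • x)) (upperUni s)
      (upperUni s) := fun s => by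
    have h := hconj (Hu s)
    rwa [mul_assoc, upperUni_mul, add_comm, ← upperUni_mul, inv_mul_cancel_left] at h
  have Ha₂ : ∀ s, Intertwines μ (fun x => ((upperUni b)⁻¹ * g) • φ (g⁻¹ • x)) (expDiag s)
      (expDiag s) := fun s => by
    have h := hconj (hb s)
    rwa [mul_assoc, inv_mul_cancel_right, inv_mul_cancel_left] at h
  have Hl₂ := intertwines_lowerUni hφ₂ hmp₂ Hu₂ Ha₂
  set D : Subgroup (SLR 2) :=
    { carrier := {x | Intertwines μ (fun x => ((upperUni b)⁻¹ * g) • φ (g⁻¹ • x)) x x}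
      mul_mem' := fun h h' => by
        rw [mem_ofPred_eq] at h h' ⊢
        exact h.mul h'
      one_mem' := by
        rw [mem_ofPred_eq]
        exact Intertwines.one
      inv_mem' := fun h => by
        rw [mem_ofPred_eq] at h ⊢
        exact h.inv }
  have hD : D = ⊤ := subgroup_eq_top_of_upperUni_lowerUni Hu₂ Hl₂
  refine ⟨((upperUni b)⁻¹ * g)⁻¹ * g, fun x => ?_⟩
  have hx : g * x * g⁻¹ ∈ D := hD ▸ Subgroup.mem_top _
  have h := Intertwines.unconj (show Intertwines μ _ _ _ from hx)
  simpa [mul_assoc] using h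

end LowerCommutes

theorem exists_mulEquiv_intertwines {n : ℕ} (hn : 2 ≤ n) {Λ : Subgroup (SLR n)}
    [DiscreteTopology Λ] {μ : Measure (SLR n ⧸ Λ)} [IsProbabilityMeasure μ]
    [SMulInvariantMeasure (SLR n) (SLR n ⧸ Λ) μ] {φ : SLR n ⧸ Λ → SLR n ⧸ Λ}
    (hφ : Measurable φ) (hmp : Measure.map φ μ = μ)
    (hinj : ∃ s : Set (SLR n ⧸ Λ), μ sᶜ = 0 ∧ Set.InjOn φ s)
    {u : SLR n} (hu : IsUnipotent n u) (hu1 : u ≠ 1) (H : Intertwines μ φ u u) :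
    ∃ A : SLR n ≃* SLR n, Continuous A ∧ ∀ g, Intertwines μ φ g (A g) := by
  rcases hn.eq_or_lt with rfl | hn3
  · obtain ⟨k, hk⟩ := exists_forall_intertwines_conj hφ hmp hinj hu hu1 H
    exact ⟨MulAut.conj k, (continuous_const.mul continuous_id).mul continuous_const, hk⟩
  · obtain ⟨φ', hφ', hmp', h1, h2⟩ := exists_measurable_inverse hφ hmp hinj
    obtain ⟨A, hA, -, h⟩ :=
      exists_mulEquiv_intertwines_of_three_le hn3 hφ hmp hφ' hmp' h1 h2 hu hu1 H
    exact ⟨A, hA, h⟩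

/-- a measurable, measure-preserving, essentially injective and essentially
surjective self-map of `SL(n,ℝ)⧸Λ` commuting a.e. with an ergodic subgroup `F'` generated by
unipotent elements agrees a.e. with `gΛ ↦ h·A(g)·Λ` for a continuous automorphism `A`
preserving `Λ` and some `h ∈ SL(n,ℝ)`, and the latter map commutes with `F'`. -/
theorem commuting_map_is_affine (n : ℕ) (hn : 2 ≤ n) (Λ : Subgroup (SLR n))
    (hΛ : DiscreteTopology ↥Λ) (μ : Measure (SLR n ⧸ Λ)) [IsProbabilityMeasure μ]
    (hinv : ∀ g : SLR n, Measure.map (fun x => g • x) μ = μ)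
    (F' : Subgroup (SLR n))
    (hF' : ∃ S : Set (SLR n), (∀ u ∈ S, IsUnipotent n u) ∧ F' = Subgroup.closure S)
    (herg : ∀ s : Set (SLR n ⧸ Λ), MeasurableSet s → (∀ f ∈ F', f • s = s) →
      μ s = 0 ∨ μ sᶜ = 0)
    (φ : SLR n ⧸ Λ → SLR n ⧸ Λ) (hmeas : Measurable φ)
    (hmp : Measure.map φ μ = μ)
    (hinj : ∃ s : Set (SLR n ⧸ Λ), μ sᶜ = 0 ∧ Set.InjOn φ s)
    (hsurj : ∃ t : Set (SLR n ⧸ Λ), μ tᶜ = 0 ∧ t ⊆ Set.range φ)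
    (hcomm : ∀ f ∈ F', ∀ᵐ x ∂μ, φ (f • x) = f • φ x) :
    ∃ (A : SLR n ≃* SLR n) (h : SLR n), Continuous A ∧ Λ.map A.toMonoidHom = Λ ∧
      ∃ ψ : SLR n ⧸ Λ → SLR n ⧸ Λ,
        (∀ g : SLR n, ψ (QuotientGroup.mk g) = QuotientGroup.mk (h * A g)) ∧
        (∀ᵐ x ∂μ, φ x = ψ x) ∧
        (∀ f ∈ F', ∀ x, ψ (f • x) = f • ψ x) := by
  have := hΛ
  have : SMulInvariantMeasure (SLR n) (SLR n ⧸ Λ) μ := ⟨fun g s hs => by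
    rw [← Measure.map_apply (measurable_const_smul g) hs, hinv]⟩
  obtain ⟨S, hS, rfl⟩ := hF'
  obtain ⟨φ', hφ', -, h1, -⟩ := exists_measurable_inverse hmeas hmp hinj
  obtain ⟨u, huS, hu, hu1⟩ := exists_isUnipotent_ne_one hn hS herg
  obtain ⟨A, hA, H⟩ := exists_mulEquiv_intertwines hn hmeas hmp hinj hu hu1
    (hcomm u (Subgroup.subset_closure huS))
  obtain ⟨B, h, hB, hΛB, ψ, hψ, hφψ, hcomm'⟩ :=
    exists_affine_of_forall_intertwines hmeas hφ' h1 A hA H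
  exact ⟨B, h, hB, hΛB, ψ, hψ, hφψ, fun f hf => hcomm' f (hcomm f hf)⟩
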